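/- Let Γ be a group generated by a finite symmetric set S with 1 ∉ S, and let G be the Cayley graph of (Γ, S). Assume there is a constant c0 > 0 such that every nonempty finite set A ⊆ Γ has at least c0·|A| edges of G between A and its complement (non-amenability of G). Then there exists a measurable map φ : [0,1]^Γ → {0,1}^{E(G)} (with respect to the product σ-algebras) that is Γ-equivariant — φ(g·x) = g·φ(x) for all g ∈ Γ and x ∈ [0,1]^Γ — and such that, for the product μ over Γ of Lebesgue measure on [0,1], for μ-almost every x the edge set {e ∈ E(G) : φ(x)(e) = 1} is a perfect matching of G. -/

import Mathlib

open scoped Classical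

namespace PaperPM

/-- The Cayley graph of `(Γ, S)`: `g` and `g·s` are adjacent for `s ∈ S`. (For `S`
symmetric with `1 ∉ S` this is the relation `g⁻¹ * h ∈ S`.) -/
def cayley {Γ : Type*} [Group Γ] (S : Set Γ) : SimpleGraph Γ :=
  SimpleGraph.fromRel (fun g h => g⁻¹ * h ∈ S)

lemma cayley_adj_mul {Γ : Type*} [Group Γ] (S : Set Γ) (g a b : Γ) :
    (cayley S).Adj (g * a) (g * b) ↔ (cayley S).Adj a b := by
  simp [cayley, SimpleGraph.fromRel_adj, mul_inv_rev, mul_assoc]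

lemma cayley_edge_mul {Γ : Type*} [Group Γ] (S : Set Γ) (g : Γ) (e : Sym2 Γ)
    (he : e ∈ (cayley S).edgeSet) :
    Sym2.map (fun v => g * v) e ∈ (cayley S).edgeSet := by
  induction e using Sym2.ind with
  | _ a b =>
    rw [SimpleGraph.mem_edgeSet] at he
    simpa [SimpleGraph.mem_edgeSet] using (cayley_adj_mul S g a b).2 he

/-- The action of `g ∈ Γ` on the edges of the Cayley graph, induced by left
multiplication on the vertices. -/
def edgeShift {Γ : Type*} [Group Γ] (S : Set Γ) (g : Γ)
    (e : (cayley S).edgeSet) : (cayley S).edgeSet :=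
  ⟨Sym2.map (fun v => g * v) e.1, cayley_edge_mul S g e.1 e.2⟩

/-- `M` is a perfect matching of `G`: every vertex lies in exactly one edge of `M`. -/
def IsPerfectMatching {V : Type*} (G : SimpleGraph V) (M : Set (Sym2 V)) : Prop :=
  M ⊆ G.edgeSet ∧ ∀ v : V, ∃! e, e ∈ M ∧ v ∈ e

/-- The set of edges of `G` with one endpoint in `A` and the other outside `A`. -/
def cutEdges {V : Type*} (G : SimpleGraph V) (A : Set V) : Set (Sym2 V) :=
  {e | e ∈ G.edgeSet ∧ ∃ u v : V, e = s(u, v) ∧ u ∈ A ∧ v ∉ A}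

end PaperPM

open scoped Classical
namespace PaperPM
section Comb
variable {V : Type*} (adj : V → V → Prop) (σ : V → V) (Y : Set V)

/-- Hypotheses of the combinatorial system. -/
structure Sys : Prop where
  symm : ∀ a b, adj a b → adj b a
  inv : ∀ a, σ (σ a) = a
  hY : ∀ y, y ∈ Y → σ y ∈ Y → σ y = y
  fix : ∀ y, σ y = y → y ∈ Y

def nd (l : List V) (v : V) : Prop := v ∈ l ∨ σ v ∈ l

/-- `a` may be appended to the path `l`. -/
def Ext : List V → V → Prop
  | [], _ => False
  | b :: l, a => adj (σ b) a ∧ ¬ nd σ (b :: l) a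

def Seg : List V → Prop
  | [] => True
  | a :: l => (l = [] ∨ Ext adj σ l a) ∧ Seg l

def Pure (a : V) : Prop := a ∉ Y ∧ σ a ∉ Y

def Pth : List V → Prop
  | [] => False
  | a :: l => (l = [] ∧ σ a ∈ Y) ∨ (Pure σ Y a ∧ Ext adj σ l a ∧ Pth l)

def Rch (n : ℕ) (y : V) : Prop := ∃ l, Pth adj σ Y l ∧ l.length ≤ n ∧ Ext adj σ l y

variable {adj σ Y}

lemma exists_first {p : List V} {P : V → Prop} (h : ∃ x ∈ p, P x) :
    ∃ p1 c p2, p = p1 ++ c :: p2 ∧ P c ∧ ∀ x ∈ p2, ¬ P x := by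
  induction p with
  | nil => simp at h
  | cons a p ih =>
    by_cases h' : ∃ x ∈ p, P x
    · obtain ⟨p1, c, p2, rfl, hc, h2⟩ := ih h'
      exact ⟨a :: p1, c, p2, rfl, hc, h2⟩
    · push Not at h'
      refine ⟨[], a, p, rfl, ?_, h'⟩
      obtain ⟨x, hx, hP⟩ := h
      rcases List.mem_cons.1 hx with rfl | hx
      · exact hP
      · exact absurd hP (h' x hx)

lemma exists_last {p : List V} {P : V → Prop} (h : ∃ x ∈ p, P x) :
    ∃ p1 c p2, p = p1 ++ c :: p2 ∧ P c ∧ ∀ x ∈ p1, ¬ P x := by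
  have h' : ∃ x ∈ p.reverse, P x := by simpa using h
  obtain ⟨p1, c, p2, h1, hc, h2⟩ := exists_first h'
  refine ⟨p2.reverse, c, p1.reverse, ?_, hc, by simpa using h2⟩
  have := congrArg List.reverse h1
  simpa using this

lemma nd_append (a b : List V) (v : V) : nd σ (a ++ b) v ↔ nd σ a v ∨ nd σ b v := by
  simp only [nd, List.mem_append]; tauto

lemma nd_cons (a : V) (b : List V) (v : V) : nd σ (a :: b) v ↔ v = a ∨ σ v = a ∨ nd σ b v := by
  simp only [nd, List.mem_cons]; tauto

lemma nd_nil (v : V) : ¬ nd σ [] v := by simp [nd]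

lemma ext_nd {l : List V} {a : V} (h : Ext adj σ l a) : ¬ nd σ l a := by
  cases l with
  | nil => exact h.elim
  | cons b l => exact h.2

namespace Sys
variable (H : Sys adj σ Y)
include H

lemma nd_inv (l : List V) (v : V) : nd σ l (σ v) ↔ nd σ l v := by
  simp only [nd, H.inv]; tauto

lemma nd_of_mem' {l : List V} {v : V} (h : v ∈ l) : nd σ l (σ v) := (H.nd_inv _ _).2 (Or.inl h)

omit H in
lemma nd_iff (l : List V) (v : V) : nd σ l v ↔ ∃ x ∈ l, v = x ∨ σ v = x := by
  constructor
  · rintro (h | h)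
    · exact ⟨_, h, Or.inl rfl⟩
    · exact ⟨_, h, Or.inr rfl⟩
  · rintro ⟨x, hx, rfl | rfl⟩
    · exact Or.inl hx
    · exact Or.inr hx

/-- symmetric avoidance -/
lemma avoid_symm {l m : List V} (h : ∀ x ∈ l, ¬ nd σ m x) : ∀ x ∈ m, ¬ nd σ l x := by
  rintro x hx (h1 | h1)
  · exact h x h1 (Or.inl hx)
  · exact h _ h1 (by rw [H.nd_inv]; exact Or.inl hx)

lemma avoid_nd {l m : List V} (h : ∀ x ∈ l, ¬ nd σ m x) {v : V} (hv : nd σ l v) : ¬ nd σ m v := by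
  rcases hv with h1 | h1
  · exact h _ h1
  · rw [← H.nd_inv]; exact h _ h1

lemma nd_rev (l : List V) (v : V) : nd σ (l.map σ).reverse v ↔ nd σ l v := by
  simp only [nd, List.mem_reverse, List.mem_map]
  constructor
  · rintro (⟨a, h, rfl⟩ | ⟨a, h, h'⟩)
    · right; rwa [H.inv]
    · left
      have := congrArg σ h'
      rw [H.inv, H.inv] at this; rwa [← this]
  · rintro (h | h)
    · right; exact ⟨v, h, rfl⟩
    · left; exact ⟨_, h, H.inv _⟩

lemma pure_inv {a : V} : Pure σ Y (σ a) ↔ Pure σ Y a := by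
  simp only [Pure, H.inv]; tauto

omit H in
lemma pth_ne {l : List V} (h : Pth adj σ Y l) : l ≠ [] := by
  rintro rfl; exact h

omit H in
lemma pth_seg {l : List V} (h : Pth adj σ Y l) : Seg adj σ l := by
  induction l with
  | nil => trivial
  | cons a l ih =>
    rcases h with ⟨rfl, h⟩ | ⟨_, h2, h3⟩
    · exact ⟨Or.inl rfl, trivial⟩
    · exact ⟨Or.inr h2, ih h3⟩

omit H in
lemma pth_suffix {a b : List V} (h : Pth adj σ Y (a ++ b)) (hb : b ≠ []) : Pth adj σ Y b := by
  induction a with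
  | nil => exact h
  | cons x a ih =>
    rcases h with ⟨h, _⟩ | ⟨_, _, h3⟩
    · simp [hb] at h
    · exact ih h3

omit H in
lemma pth_pure {a b : List V} (h : Pth adj σ Y (a ++ b)) (hb : b ≠ []) : ∀ x ∈ a, Pure σ Y x := by
  induction a with
  | nil => simp
  | cons x a ih =>
    rcases h with ⟨h, _⟩ | ⟨h1, _, h3⟩
    · simp [hb] at h
    · intro z hz
      rcases List.mem_cons.1 hz with rfl | hz
      · exact h1
      · exact ih h3 z hz

omit H in
lemma seg_suffix {a b : List V} (h : Seg adj σ (a ++ b)) : Seg adj σ b := by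
  induction a with
  | nil => exact h
  | cons x a ih => exact ih h.2

omit H in
lemma seg_prefix {a b : List V} (h : Seg adj σ (a ++ b)) : Seg adj σ a := by
  induction a with
  | nil => trivial
  | cons x a ih =>
    refine ⟨?_, ih h.2⟩
    rcases h.1 with h1 | h1
    · left; exact (List.append_eq_nil_iff.1 h1).1
    · cases a with
      | nil => left; rfl
      | cons y a =>
        right
        refine ⟨h1.1, fun h2 => h1.2 ?_⟩
        change nd σ ((y :: a) ++ b) x
        rw [nd_append]; exact Or.inl h2

omit H in
lemma seg_avoid {a b : List V} (h : Seg adj σ (a ++ b)) : ∀ x ∈ a, ¬ nd σ b x := by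
  induction a with
  | nil => simp
  | cons x a ih =>
    intro z hz
    rcases List.mem_cons.1 hz with rfl | hz
    · rcases h.1 with h1 | h1
      · rw [(List.append_eq_nil_iff.1 h1).2]; exact nd_nil _
      · intro h2
        exact ext_nd h1 ((nd_append a b z).2 (Or.inr h2))
    · exact ih h.2 z hz

omit H in
/-- glue two segments along a common element -/
lemma seg_glue {a b : List V} {c : V} (h1 : Seg adj σ (a ++ [c])) (h2 : Seg adj σ (c :: b))
    (h3 : ∀ x ∈ a, ¬ nd σ b x) : Seg adj σ (a ++ c :: b) := by
  induction a with
  | nil => exact h2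
  | cons x a ih =>
    refine ⟨Or.inr ?_, ih h1.2 (fun z hz => h3 z (List.mem_cons_of_mem _ hz))⟩
    have hx := h3 x List.mem_cons_self
    rcases h1.1 with h | h
    · simp at h
    · cases a with
      | nil =>
        refine ⟨h.1, ?_⟩
        have := h.2
        simp only [nd_cons] at this ⊢
        have h4 : ¬ nd σ [] x := nd_nil _
        tauto
      | cons y a =>
        refine ⟨h.1, ?_⟩
        have := h.2
        change ¬ nd σ ((y :: a) ++ [c]) x at this
        change ¬ nd σ ((y :: a) ++ (c :: b)) x
        simp only [nd_append, nd_cons] at this ⊢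
        have h4 : ¬ nd σ [] x := nd_nil _
        tauto

omit H in
lemma pth_splice {a b : List V} {c : V} (h1 : Seg adj σ (a ++ [c])) (h2 : Pth adj σ Y (c :: b))
    (h3 : ∀ x ∈ a, ¬ nd σ b x) (h4 : ∀ x ∈ a, Pure σ Y x) : Pth adj σ Y (a ++ c :: b) := by
  have hs := seg_glue h1 (pth_seg h2) h3
  induction a with
  | nil => exact h2
  | cons x a ih =>
    right
    refine ⟨h4 x List.mem_cons_self, ?_, ih h1.2 (fun z hz => h3 z (List.mem_cons_of_mem _ hz))
      (fun z hz => h4 z (List.mem_cons_of_mem _ hz)) hs.2⟩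
    rcases hs.1 with h | h
    · simp at h
    · exact h

lemma seg_pair {a b : V} (h : Seg adj σ [a, b]) : Seg adj σ [σ b, σ a] := by
  refine ⟨Or.inr ⟨?_, ?_⟩, ⟨Or.inl rfl, trivial⟩⟩
  · rw [H.inv]
    rcases h.1 with h | h
    · simp at h
    · exact H.symm _ _ h.1
  · rcases h.1 with h | h
    · simp at h
    · have := h.2
      rw [H.nd_inv]
      rw [nd_cons] at *
      have h4 : ∀ x, ¬ nd σ [] x := nd_nil
      rintro (h5 | h5 | h5)
      · apply this; right; left; rw [h5]
      · have h6 := congrArg σ h5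
        rw [H.inv, H.inv] at h6
        apply this; left; exact h6.symm
      · exact h4 _ h5

lemma seg_rev {F : List V} (h : Seg adj σ F) : Seg adj σ (F.map σ).reverse := by
  induction F with
  | nil => exact h
  | cons a F ih =>
    have ih := ih h.2
    cases F with
    | nil => exact ⟨Or.inl rfl, trivial⟩
    | cons b F =>
      simp only [List.map_cons, List.reverse_cons, List.append_assoc, List.cons_append,
        List.nil_append] at ih ⊢
      apply seg_glue ih
      · apply H.seg_pair
        exact seg_prefix (a := [a, b]) (b := F) (by simpa using h)
      · have h1 : ∀ x ∈ [a], ¬ nd σ F x := by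
          intro x hx
          have := seg_avoid (a := [a]) (b := b :: F) (by simpa using h) x hx
          rw [nd_cons] at this; tauto
        intro x hx hx'
        have h2 : nd σ F x := by rw [← H.nd_rev]; exact Or.inl hx
        refine H.avoid_nd h1 (v := x) ?_ h2
        simp only [nd, List.mem_singleton] at hx' ⊢
        rcases hx' with rfl | h'
        · right; exact H.inv _
        · left; rw [← H.inv x, h', H.inv]

omit H in
lemma rch_mono {n m : ℕ} (h : n ≤ m) {y : V} (hr : Rch adj σ Y n y) : Rch adj σ Y m y := by
  obtain ⟨l, h1, h2, h3⟩ := hr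
  exact ⟨l, h1, h2.trans h, h3⟩

omit H in
lemma fwd1 {c : V} {p : List V} (h : Pth adj σ Y (c :: p)) (hp : p ≠ []) :
    Rch adj σ Y p.length c := by
  rcases h with ⟨h, _⟩ | ⟨_, h2, h3⟩
  · exact absurd h hp
  · exact ⟨p, h3, le_rfl, h2⟩

omit H in
lemma fwd {b c : V} {f p : List V} (h1 : Seg adj σ (b :: f ++ [c])) (h2 : Pth adj σ Y (c :: p))
    (h3 : ∀ x ∈ b :: f, ¬ nd σ p x) (h4 : ∀ x ∈ f, Pure σ Y x) :
    Rch adj σ Y (f.length + 1 + p.length) b := by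
  have hs := seg_glue h1 (pth_seg h2) h3
  refine ⟨f ++ c :: p, pth_splice h1.2 h2 (fun x hx => h3 x (List.mem_cons_of_mem _ hx)) h4,
    by simp; omega, ?_⟩
  rcases hs.1 with h | h
  · simp at h
  · exact h

lemma back {y c : V} {bs p : List V} (h1 : Seg adj σ (bs ++ [σ y])) (hb : ∀ x ∈ bs, Pure σ Y x)
    (h2 : Pth adj σ Y (c :: p)) (hc : σ c ∈ bs) (h3 : ∀ x ∈ p, ¬ nd σ (bs ++ [σ y]) x) :
    Rch adj σ Y (bs.length + p.length) y := by
  obtain ⟨f1, f2, rfl⟩ := List.append_of_mem hc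
  have hs := H.seg_rev (seg_suffix (a := f1) (b := σ c :: f2 ++ [σ y]) (by simpa using h1))
  simp only [List.map_append, List.map_cons, List.reverse_append, List.reverse_cons, H.inv,
    List.map_nil, List.reverse_nil, List.nil_append, List.cons_append] at hs
  refine rch_mono ?_ (fwd (f := (f2.map σ).reverse) (c := c) (p := p) hs h2 ?_ ?_)
  · simp
  · apply H.avoid_symm
    intro x hx hx'
    apply h3 x hx
    rw [nd_cons, H.nd_rev] at hx'
    simp only [nd_append, nd_cons]
    rcases hx' with h | h | h
    · right; right; left; rw [h]
    · right; left; rw [← h, H.inv]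
    · left; right; right; right; exact h
  · intro x hx
    simp only [List.mem_reverse, List.mem_map] at hx
    obtain ⟨z, hz, rfl⟩ := hx
    rw [H.pure_inv]; exact hb z (by simp [hz])

lemma hit_aux {b e c : V} {mid p : List V} (h1 : Seg adj σ (b :: mid ++ [e]))
    (hm : ∀ x ∈ mid, Pure σ Y x) (hp : Pth adj σ Y (c :: p)) (hc : c ∈ b :: mid ++ [e])
    (h3 : ∀ x ∈ p, ¬ nd σ (b :: mid ++ [e]) x) :
    Rch adj σ Y (mid.length + 1 + p.length) b ∨ (c = b ∧ p = []) := by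
  by_cases hcb : c = b
  · subst hcb
    by_cases hp0 : p = []
    · exact Or.inr ⟨rfl, hp0⟩
    · exact Or.inl (rch_mono (by omega) (fwd1 hp hp0))
  · left
    have hc' : c ∈ mid ++ [e] := by simpa [hcb] using hc
    obtain ⟨f1, f2, hf⟩ := List.append_of_mem hc'
    have hmid : mid = f1 ++ (c :: f2).dropLast := by
      have := congrArg List.dropLast hf
      rwa [List.dropLast_concat, List.dropLast_append_cons] at this
    have hl : f1.length ≤ mid.length := by rw [hmid]; simp
    refine rch_mono (by omega) (fwd (f := f1) (c := c) (p := p) ?_ hp ?_ ?_)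
    · refine seg_prefix (b := f2) ?_
      simpa [hf] using h1
    · apply H.avoid_symm
      intro x hx hx'
      apply h3 x hx
      rw [List.cons_append, hf, nd_cons, nd_append]
      rw [nd_cons] at hx'
      tauto
    · intro x hx
      exact hm x (by rw [hmid]; simp [hx])

omit H in
lemma rev_eq (b e : V) (mid : List V) : ((b :: mid ++ [e]).map σ).reverse
    = σ e :: (mid.map σ).reverse ++ [σ b] := by simp

lemma mem_rev {c : V} {F : List V} (h : σ c ∈ F) : c ∈ (F.map σ).reverse := by
  simp only [List.mem_reverse, List.mem_map]
  exact ⟨_, h, H.inv _⟩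

lemma pure_rev {F : List V} (h : ∀ x ∈ F, Pure σ Y x) : ∀ x ∈ (F.map σ).reverse, Pure σ Y x := by
  intro x hx
  simp only [List.mem_reverse, List.mem_map] at hx
  obtain ⟨z, hz, rfl⟩ := hx
  exact H.pure_inv.2 (h z hz)

lemma hit_aux_rev {b e c : V} {mid p : List V} (h1 : Seg adj σ (b :: mid ++ [e]))
    (hm : ∀ x ∈ mid, Pure σ Y x) (hp : Pth adj σ Y (c :: p)) (hc : σ c ∈ b :: mid ++ [e])
    (h3 : ∀ x ∈ p, ¬ nd σ (b :: mid ++ [e]) x) :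
    Rch adj σ Y (mid.length + 1 + p.length) (σ e) ∨ (c = σ e ∧ p = []) := by
  have hs := H.seg_rev h1
  rw [rev_eq] at hs
  have := H.hit_aux hs (H.pure_rev hm) hp (by rw [← rev_eq]; exact H.mem_rev hc)
    (by intro x hx; rw [← rev_eq, H.nd_rev]; exact h3 x hx)
  simpa using this

omit H in
lemma pth_single {c : V} (h : Pth adj σ Y [c]) : σ c ∈ Y := by
  rcases h with ⟨_, h⟩ | ⟨_, h2, h3⟩
  · exact h
  · exact h3.elim

omit H in
lemma seg_ends {b e : V} {mid : List V} (h1 : Seg adj σ (b :: mid ++ [e])) : b ≠ e ∧ σ b ≠ e := by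
  have := seg_avoid h1 b (by simp)
  simpa [nd] using this

/-- Lemma S -/
lemma hit {p F mid : List V} {b e : V} (hp : Pth adj σ Y p) (hFe : F = b :: mid ++ [e])
    (hF : Seg adj σ F) (hm : ∀ x ∈ mid, Pure σ Y x) (hb : σ b ∈ Y → σ b = b)
    (he : e ∈ Y → σ e = e) (hh : ∃ x ∈ p, nd σ F x) :
    Rch adj σ Y (p.length + F.length) b ∨ Rch adj σ Y (p.length + F.length) (σ e) := by
  subst hFe
  obtain ⟨p1, c, p2, rfl, hc, h2⟩ := exists_first hh
  have hcp := pth_suffix hp (by simp)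
  have hle : mid.length + 1 + p2.length ≤
    (p1 ++ c :: p2).length + (b :: mid ++ [e]).length := by simp; omega
  have hends := seg_ends hF
  rcases hc with hc | hc
  · rcases H.hit_aux hF hm hcp hc h2 with h | ⟨rfl, rfl⟩
    · exact Or.inl (rch_mono hle h)
    · have hcc := hb (pth_single hcp)
      rcases H.hit_aux_rev hF hm hcp (by rw [hcc]; exact hc) h2 with h | ⟨h, _⟩
      · exact Or.inr (rch_mono hle h)
      · exact absurd (by rw [h, H.inv]) hends.2
  · rcases H.hit_aux_rev hF hm hcp hc h2 with h | ⟨rfl, rfl⟩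
    · exact Or.inr (rch_mono hle h)
    · have hcc := he (by simpa [H.inv] using pth_single hcp)
      rcases H.hit_aux hF hm hcp (by rw [hcc]; simp) h2 with h | ⟨h, _⟩
      · exact Or.inl (rch_mono hle h)
      · exact absurd (by rw [← h, hcc]) hends.1

/-- refined hit -/
lemma hit' {p mid : List V} {b e : V} (hp : Pth adj σ Y p)
    (hF : Seg adj σ (b :: mid ++ [e])) (hm : ∀ x ∈ b :: mid, Pure σ Y x) (hav : ¬ nd σ p e)
    (hh : ∃ x ∈ p, nd σ (b :: mid ++ [e]) x) :
    Rch adj σ Y (p.length + mid.length + 2) (σ e) ∨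
      ∃ q, Pth adj σ Y (b :: q) ∧ (b :: q).length ≤ p.length + mid.length + 2 ∧
        ¬ nd σ (b :: q) e := by
  obtain ⟨p1, c, p2, rfl, hc, h2⟩ := exists_first hh
  have hcp := pth_suffix hp (by simp)
  have hce : c ≠ e := by
    rintro rfl; exact hav (Or.inl (by simp))
  have hce' : c ≠ σ e := by
    rintro rfl; exact hav (Or.inr (by simp))
  rcases hc with hc | hc
  · right
    have hc' : c ∈ b :: mid := by simpa [hce] using hc
    obtain ⟨f1, f2, hf⟩ := List.append_of_mem hc'
    have hpth : Pth adj σ Y (f1 ++ c :: p2) := by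
      refine pth_splice (a := f1) ?_ hcp ?_ ?_
      · rw [hf] at hF
        exact seg_prefix (b := f2 ++ [e]) (by simpa using hF)
      · apply H.avoid_symm
        intro x hx hx'
        apply h2 x hx
        rw [hf, nd_append, nd_append]; exact Or.inl (Or.inl hx')
      · intro x hx
        exact hm x (by rw [hf]; simp [hx])
    have hav2 : ¬ nd σ (f1 ++ c :: p2) e := by
      have hs := H.avoid_symm (seg_avoid hF) e (by simp)
      rw [hf] at hs
      rw [nd_append, nd_cons] at hs hav ⊢
      tauto
    have hlen : f1.length ≤ mid.length := by
      have := congrArg List.length hf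
      simp at this; omega
    obtain ⟨q, hq⟩ : ∃ q, f1 ++ c :: p2 = b :: q := by
      cases f1 with
      | nil => simp at hf; exact ⟨p2, by simp [hf.1]⟩
      | cons z f1 => simp at hf; exact ⟨f1 ++ c :: p2, by simp [hf.1]⟩
    refine ⟨q, hq ▸ hpth, ?_, hq ▸ hav2⟩
    rw [← hq]; simp; omega
  · left
    rcases H.hit_aux_rev hF (fun x hx => hm x (List.mem_cons_of_mem _ hx)) hcp hc h2 with h | ⟨h, _⟩
    · exact rch_mono (by simp; omega) h
    · exact absurd h hce'

lemma zind {y : V} (hy : σ y ∈ Y → σ y = y) (N : ℕ) : ∀ (n : ℕ) (bs g h : List V) (β : V),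
    bs.length ≤ n → Seg adj σ (β :: bs ++ [σ y]) → (∀ x ∈ β :: bs, Pure σ Y x) →
    Pth adj σ Y (β :: g) → Pth adj σ Y (σ β :: h) → g.length + h.length ≤ N →
    (∀ x ∈ g, ¬ nd σ (β :: bs ++ [σ y]) x) → Rch adj σ Y (N + bs.length + 2) y := by
  intro n
  induction n using Nat.strong_induction_on with
  | _ n IH =>
  intro bs g h β hn hS hpure hg hh hN hav
  by_cases hhit : ∃ x ∈ h, nd σ (bs ++ [σ y]) x
  swap
  · push Not at hhit
    refine rch_mono ?_ (H.back (c := σ β) (p := h) hS hpure hh (by simp [H.inv]) ?_)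
    · simp; omega
    · intro x hx
      rw [List.cons_append, nd_cons]
      rintro (rfl | h1 | h1)
      · exact seg_avoid (a := [σ x]) (pth_seg hh) (σ x) (by simp) (H.nd_of_mem' hx)
      · subst h1
        rw [H.inv] at hh
        exact seg_avoid (a := [x]) (pth_seg hh) x (by simp) (Or.inl hx)
      · exact hhit x hx h1
  obtain ⟨h1', c, h2, rfl, hc, hlast⟩ := exists_last hhit
  have hHseg := pth_seg hh
  set h1 := σ β :: h1' with hh1
  have hHp : Pth adj σ Y (h1 ++ c :: h2) := hh
  have h1pure := pth_pure hHp (by simp)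
  have hβav : ¬ nd σ (bs ++ [σ y]) β := seg_avoid (a := [β]) (by simpa using hS) β (by simp)
  have h1av : ∀ x ∈ h1, ¬ nd σ (bs ++ [σ y]) x := by
    intro x hx
    rcases List.mem_cons.1 hx with rfl | hx
    · rwa [H.nd_inv]
    · exact hlast x hx
  obtain ⟨g1, d, g2, hgeq, hd, hd2⟩ := exists_first (p := β :: g) (P := nd σ h1)
    ⟨β, by simp, Or.inr (by simp [hh1])⟩
  have hg2 : ∀ x ∈ g2, x ∈ g := by
    intro x hx
    cases g1 with
    | nil => simp at hgeq; rw [hgeq.2]; exact hx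
    | cons z g1 => simp at hgeq; rw [hgeq.2]; simp [hx]
  have hg2l : g2.length ≤ g.length := by
    have := congrArg List.length hgeq
    simp at this; omega
  have hdp : Pth adj σ Y (d :: g2) := by
    rw [hgeq] at hg; exact pth_suffix hg (by simp)
  have hg2av : ∀ x ∈ g2, ¬ nd σ (β :: bs ++ [σ y]) x := fun x hx => hav x (hg2 x hx)
  have hdav : ¬ nd σ (bs ++ [σ y]) d := H.avoid_nd h1av hd
  rcases hd with hd | hd
  · obtain ⟨ha, hb, hab⟩ := List.append_of_mem hd
    have hq : Pth adj σ Y (ha ++ d :: g2) := by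
      refine pth_splice (a := ha) ?_ hdp ?_ ?_
      · have : Seg adj σ (h1 ++ c :: h2) := hHseg
        rw [hab] at this
        exact seg_prefix (b := hb ++ c :: h2) (by simpa using this)
      · apply H.avoid_symm
        intro x hx hx'
        apply hd2 x hx
        rw [hab, nd_append]; exact Or.inl hx'
      · intro x hx; exact h1pure x (by rw [hab]; simp [hx])
    obtain ⟨q, hq1, hq2⟩ : ∃ q, ha ++ d :: g2 = σ β :: q ∧ ∀ x ∈ q, x ∈ ha ∨ x = d ∨ x ∈ g2 := by
      cases ha with
      | nil =>
        simp [hh1] at hab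
        exact ⟨g2, by simp [hab.1], by tauto⟩
      | cons z ha =>
        simp [hh1] at hab
        exact ⟨ha ++ d :: g2, by simp [hab.1], by simp; tauto⟩
    have hlen : q.length + 1 ≤ h1.length + g2.length := by
      have e1 := congrArg List.length hq1
      have e2 := congrArg List.length hab
      simp at e1 e2 ⊢; omega
    rw [hq1] at hq
    have hqav : ∀ x ∈ q, ¬ nd σ (bs ++ [σ y]) x := by
      intro x hx
      rcases hq2 x hx with h | rfl | h
      · exact h1av x (by rw [hab]; simp [h])
      · exact hdav
      · intro h'; apply hg2av x h
        rw [List.cons_append, nd_cons]; tauto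
    refine rch_mono ?_ (H.back (c := σ β) (p := q) hS hpure hq (by simp [H.inv]) ?_)
    · simp [hh1] at hlen hN ⊢; omega
    · intro x hx
      rw [List.cons_append, nd_cons]
      rintro (rfl | h1 | h1)
      · exact seg_avoid (a := [σ x]) (pth_seg hq) (σ x) (by simp) (H.nd_of_mem' hx)
      · subst h1
        rw [H.inv] at hq
        exact seg_avoid (a := [x]) (pth_seg hq) x (by simp) (Or.inl hx)
      · exact hqav x hx h1
  · obtain ⟨ha, hb, hab⟩ := List.append_of_mem hd
    set hr := (hb.map σ).reverse with hhr
    have hs0 : Seg adj σ (σ d :: hb ++ [c]) := by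
      have : Seg adj σ (h1 ++ c :: h2) := hHseg
      rw [hab] at this
      have := seg_suffix (a := ha) (b := σ d :: hb ++ c :: h2) (by simpa using this)
      exact seg_prefix (b := h2) (by simpa using this)
    have hs1 : Seg adj σ (σ c :: hr ++ [d]) := by
      have := H.seg_rev hs0
      rw [rev_eq] at this
      simpa [H.inv] using this
    have hav1 : ∀ x ∈ σ c :: hr, ¬ nd σ g2 x := by
      intro x hx
      rcases List.mem_cons.1 hx with rfl | hx
      · rw [H.nd_inv]
        refine H.avoid_nd (l := bs ++ [σ y]) (H.avoid_symm ?_) hc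
        intro x hx h'
        apply hg2av x hx; rw [List.cons_append, nd_cons]; tauto
      · refine H.avoid_nd (l := h1) (H.avoid_symm hd2) ?_
        have : nd σ hb x := by rw [← H.nd_rev]; exact Or.inl hx
        rw [hab, nd_append, nd_cons]; tauto
    have hrpure : ∀ x ∈ hr, Pure σ Y x :=
      H.pure_rev (fun x hx => h1pure x (by rw [hab]; simp [hx]))
    have hP : Pth adj σ Y (hr ++ d :: g2) :=
      pth_splice hs1.2 hdp (fun x hx => hav1 x (List.mem_cons_of_mem _ hx)) hrpure
    have hSc := seg_glue hs1 (pth_seg hdp) hav1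
    have hE : Ext adj σ (hr ++ d :: g2) (σ c) := by
      rcases hSc.1 with h | h
      · simp at h
      · exact h
    have hqav : ∀ x ∈ hr ++ d :: g2, ¬ nd σ (bs ++ [σ y]) x := by
      intro x hx
      rcases List.mem_append.1 hx with h | h
      · refine H.avoid_nd h1av ?_
        have : nd σ hb x := by rw [← H.nd_rev]; exact Or.inl h
        rw [hab, nd_append, nd_cons]; tauto
      · rcases List.mem_cons.1 h with rfl | h
        · exact hdav
        · intro h'; apply hg2av x h
          rw [List.cons_append, nd_cons]; tauto
    have hlen : hr.length + h2.length + 1 + 1 ≤ (h1' ++ c :: h2).length + 1 := by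
      have e2 := congrArg List.length hab
      simp [hh1, hhr] at e2 ⊢; omega
    have key : σ c = y → Rch adj σ Y (N + bs.length + 2) y := by
      rintro rfl
      exact ⟨_, hP, by simp at hlen hN ⊢; omega, hE⟩
    have hcases : c ∈ bs ∨ σ c ∈ bs ∨ σ c = y ∨ c = y := by
      simp only [nd, List.mem_append, List.mem_singleton] at hc
      rcases hc with (h | h) | (h | h)
      · exact Or.inl h
      · right; right; left; rw [h, H.inv]
      · exact Or.inr (Or.inl h)
      · right; right; right; rw [← H.inv c, h, H.inv]
    have hbspure : ∀ x ∈ bs, Pure σ Y x := fun x hx => hpure x (List.mem_cons_of_mem _ hx)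
    have hPc : Pure σ Y c → Pth adj σ Y (σ c :: (hr ++ d :: g2)) := fun h =>
      Or.inr ⟨H.pure_inv.2 h, hE, hP⟩
    rcases hcases with h | h | h | h
    · refine rch_mono ?_ (H.back (c := σ c) (bs := bs) hS.2 hbspure (hPc (hbspure _ h))
        (by rwa [H.inv]) hqav)
      simp at hlen hN ⊢; omega
    · obtain ⟨b1, b2, rfl⟩ := List.append_of_mem h
      have hlen2 : b2.length < n := by simp at hn; omega
      have hcH : Pth adj σ Y (σ (σ c) :: h2) := by
        rw [H.inv]; exact pth_suffix hHp (by simp)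
      refine rch_mono ?_ (IH b2.length hlen2 b2 (hr ++ d :: g2) h2 (σ c) le_rfl ?_ ?_
        (hPc (H.pure_inv.1 (hbspure _ h))) hcH ?_ ?_)
      · simp; omega
      · exact seg_suffix (a := β :: b1) (by simpa using hS)
      · intro x hx; exact hbspure x (by simp at hx ⊢; tauto)
      · simp at hlen hN ⊢; omega
      · intro x hx hx'
        apply hqav x hx
        rw [List.append_assoc, nd_append]; exact Or.inr hx'
    · exact key h
    · subst h
      have hcH : Pth adj σ Y (c :: h2) := pth_suffix hHp (by simp)
      by_cases h20 : h2 = []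
      · subst h20
        exact key (hy (pth_single hcH))
      · refine rch_mono ?_ (fwd1 hcH h20)
        simp at hN; omega

/-- Lemma Z -/
lemma lemZ {y : V} (hy : σ y ∈ Y → σ y = y) {k : ℕ} {bs p : List V}
    (hS : Seg adj σ (bs ++ [σ y])) (hb : ∀ x ∈ bs, Pure σ Y x)
    (hH : ∀ β ∈ bs, ∃ h, Pth adj σ Y (σ β :: h) ∧ h.length ≤ k)
    (hp : Pth adj σ Y p) (hav : ¬ nd σ p y) (hh : ∃ x ∈ p, nd σ bs x) :
    Rch adj σ Y (p.length + k + bs.length + 2) y := by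
  obtain ⟨p1, c, p2, rfl, hc, h2⟩ := exists_first (P := nd σ (bs ++ [σ y])) (p := p)
    (by obtain ⟨x, hx, hx'⟩ := hh; exact ⟨x, hx, by rw [nd_append]; exact Or.inl hx'⟩)
  have hcp := pth_suffix hp (by simp)
  have hcb : nd σ bs c := by
    rw [nd_append] at hc
    rcases hc with h | h
    · exact h
    · exfalso; apply hav
      simp only [nd, List.mem_singleton] at h
      rcases h with rfl | h
      · exact Or.inr (by simp)
      · left; rw [← H.inv y, ← h, H.inv]; simp
  rcases hcb with h | h
  · obtain ⟨h', hh1, hh2⟩ := hH c h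
    obtain ⟨b1, b2, rfl⟩ := List.append_of_mem h
    refine rch_mono ?_ (H.zind hy (p2.length + k) b2.length b2 p2 h' c le_rfl ?_ ?_ hcp hh1
      (by omega) ?_)
    · simp; omega
    · exact seg_suffix (a := b1) (by simpa using hS)
    · intro x hx; exact hb x (by simp at hx ⊢; tauto)
    · intro x hx hx'
      apply h2 x hx
      rw [List.append_assoc, nd_append]; exact Or.inr hx'
  · refine rch_mono ?_ (H.back hS hb hcp h h2)
    simp; omega

omit H in
variable (adj σ Y) in
/-- `x` is attached to the base `y`. -/
def Cell (k k' L : ℕ) (x y : V) : Prop :=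
  ∃ b rest, Pth adj σ Y (b ++ σ y :: rest) ∧ (b ++ σ y :: rest).length ≤ L ∧
    ((b = [] ∧ x = y) ∨ ∃ β b', b = β :: b' ∧ (β = x ∨ β = σ x)) ∧
    (∀ β ∈ b, ∃ h, Pth adj σ Y (σ β :: h) ∧ h.length ≤ k) ∧
    (∃ h, Pth adj σ Y (σ x :: h) ∧ h.length ≤ k') ∧ (σ y ∈ Y → σ y = y)

lemma mem_of_nd {q : List V} {y : V} (hq : Pth adj σ Y q) (hy : σ y ∈ Y → σ y = y)
    {N : ℕ} (hN : q.length ≤ N) (hR : ¬ Rch adj σ Y N y) (h : nd σ q y) : σ y ∈ q := by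
  rcases h with h | h
  · obtain ⟨q1, q2, rfl⟩ := List.append_of_mem h
    have hs : Pth adj σ Y (y :: q2) := pth_suffix hq (by simp)
    by_cases h2 : q2 = []
    · subst h2
      rw [hy (pth_single hs)]; exact h
    · exact absurd (rch_mono (by simp at hN; omega) (fwd1 hs h2)) hR
  · exact h

lemma dom1 {k k' L N M : ℕ} {x y : V} (hC : Cell adj σ Y k k' L x y) (hR : ¬ Rch adj σ Y N y)
    (hM : M + k + L + 2 ≤ N) {q : List V} (hq : Pth adj σ Y q) (hqM : q.length ≤ M)
    (hx : nd σ q x) : nd σ q y := by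
  obtain ⟨b, rest, hp, hL, hb, hbH, -, hy⟩ := hC
  by_contra hav
  rcases hb with ⟨_, rfl⟩ | ⟨β, b', rfl, hβ⟩
  · exact hav hx
  · apply hR
    have hS : Seg adj σ ((β :: b') ++ [σ y]) := seg_prefix (b := rest) (by simpa using pth_seg hp)
    refine rch_mono ?_ (H.lemZ hy hS (pth_pure hp (by simp)) hbH hq hav ?_)
    · simp at hL ⊢; omega
    · rw [nd_iff] at hx
      obtain ⟨z, hz, hz'⟩ := hx
      refine ⟨z, hz, ?_⟩
      have : nd σ (β :: b') x := by
        rcases hβ with rfl | rfl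
        · exact Or.inl (by simp)
        · exact Or.inr (by simp)
      rcases hz' with rfl | rfl
      · exact this
      · rwa [H.nd_inv]

lemma dom2a {k k' L N M : ℕ} {x y x' : V} (hC : Cell adj σ Y k k' L x y) (hR : ¬ Rch adj σ Y N y)
    (hM : M + 1 + k + L + 2 ≤ N) (hadj : adj x x') {q : List V}
    (hq : Pth adj σ Y (σ x' :: q)) (hqM : (σ x' :: q).length ≤ M) : nd σ (σ x' :: q) y := by
  by_contra hav
  have hx : ¬ nd σ (σ x' :: q) x := fun h => hav (H.dom1 hC hR (M := M) (by omega) hq hqM h)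
  have hE : Ext adj σ (σ x' :: q) x := ⟨by rw [H.inv]; exact H.symm _ _ hadj, hx⟩
  have hC' := hC
  obtain ⟨b, rest, hp, hL, hb, hbH, -, hy⟩ := hC'
  have hxy : x ≠ y := by
    rintro rfl
    exact hR ⟨_, hq, by omega, hE⟩
  rcases hb with ⟨_, rfl⟩ | ⟨β, b', rfl, hβ⟩
  · exact hxy rfl
  · have hbp := pth_pure hp (by simp) β (by simp)
    have hxp : Pure σ Y x := by
      rcases hβ with rfl | rfl
      · exact hbp
      · exact H.pure_inv.1 hbp
    have := H.dom1 hC hR (M := M + 1) (by omega) (q := x :: σ x' :: q) (Or.inr ⟨hxp, hE, hq⟩)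
      (by simp at hqM ⊢; omega) (Or.inl (by simp))
    rw [nd_cons] at this
    rcases this with h | h | h
    · exact hxy h.symm
    · have hav2 := seg_avoid (pth_seg hp) β (by simp)
      apply hav2
      rw [nd_cons]
      rcases hβ with rfl | rfl
      · left; exact h.symm
      · right; left; rw [H.inv]; exact h.symm
    · exact hav h

lemma dom2 {k k' L N M : ℕ} {x y x' y' : V} (hC : Cell adj σ Y k k' L x y)
    (hC' : Cell adj σ Y k k' L x' y') (hR : ¬ Rch adj σ Y N y)
    (hM : M + k + k' + L + 8 ≤ N) (hadj : adj x x') {q : List V}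
    (hq : Pth adj σ Y q) (hqM : q.length ≤ M) (hx : nd σ q x') : nd σ q y := by
  have hy : σ y ∈ Y → σ y = y := by obtain ⟨b, rest, -, -, -, -, -, hy⟩ := hC; exact hy
  rw [nd_iff] at hx
  obtain ⟨c, hcq, hc⟩ := hx
  obtain ⟨q1, q2, rfl⟩ := List.append_of_mem hcq
  suffices nd σ (c :: q2) y by rw [nd_append]; exact Or.inr this
  replace hq := pth_suffix hq (b := c :: q2) (by simp)
  have hqM' : (c :: q2).length ≤ M := by simp at hqM ⊢; omega
  rcases hc with rfl | rfl
  swap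
  · exact H.dom2a hC hR (M := M) (by omega) hadj hq hqM'
  by_cases hpure : Pure σ Y x'
  swap
  · have h1 : σ x' = x' := by
      obtain ⟨b, rest, hp, -, hb, -, -, hy'⟩ := hC'
      rcases hb with ⟨_, rfl⟩ | ⟨β, b', rfl, hβ⟩
      · rcases hq with ⟨_, h⟩ | ⟨h, _⟩
        · exact hy' h
        · exact absurd h hpure
      · have hbp := pth_pure hp (by simp) β (by simp)
        rcases hβ with rfl | rfl
        · exact absurd hbp hpure
        · exact absurd (H.pure_inv.1 hbp) hpure
    have := H.dom2a hC hR (M := M) (by omega) hadj (q := q2) (by rwa [h1]) (by rwa [h1])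
    rwa [h1] at this
  obtain ⟨-, -, -, -, -, -, ⟨h, hh, hhk⟩, -⟩ := hC'
  by_contra hav
  have h1 := H.dom2a hC hR (M := k' + 1) (by omega) hadj hh (by simp; omega)
  have h2 := H.mem_of_nd hh hy (N := N) (by simp; omega) hR h1
  have h3 : σ y ∈ h := by
    rcases List.mem_cons.1 h2 with h3 | h3
    · exfalso; apply hav
      have := congrArg σ h3
      rw [H.inv, H.inv] at this
      exact Or.inl (by simp [this])
    · exact h3
  obtain ⟨ha, hb, rfl⟩ := List.append_of_mem h3
  have hS : Seg adj σ (σ x' :: ha ++ [σ y]) := seg_prefix (b := hb) (by simpa using pth_seg hh)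
  have hPu : ∀ z ∈ σ x' :: ha, Pure σ Y z := pth_pure (b := σ y :: hb) (by simpa using hh) (by simp)
  have hlen : ha.length ≤ k' := by simp at hhk; omega
  rcases H.hit' hq hS hPu (by rwa [H.nd_inv]) ⟨x', by simp, Or.inr (by simp)⟩ with h4 | ⟨q', h4, h5, h6⟩
  · rw [H.inv] at h4
    exact hR (rch_mono (by omega) h4)
  · rw [H.nd_inv] at h6
    exact h6 (H.dom2a hC hR (M := M + k' + 2) (by omega) hadj h4 (by omega))

lemma cell_half {k k' L N : ℕ} {x y x' y' : V} (hC : Cell adj σ Y k k' L x y)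
    (hC' : Cell adj σ Y k k' L x' y') (hR : ¬ Rch adj σ Y N y) (hR' : ¬ Rch adj σ Y N y')
    (hM : 3 * L + k + k' + 8 ≤ N) (hadj : adj x x') (hne : y ≠ y') :
    ∃ b rest, Pth adj σ Y (b ++ σ y :: rest) ∧ σ y' ∈ b ∧
      (∀ β ∈ b, ∃ h, Pth adj σ Y (σ β :: h) ∧ h.length ≤ k) := by
  have hC1 := hC
  have hC2 := hC'
  obtain ⟨b, rest, hp, hL, hb, hbH, -, hy⟩ := hC1
  obtain ⟨b', rest', hp', hL', hb', hbH', -, hy'⟩ := hC2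
  refine ⟨b, rest, hp, ?_, hbH⟩
  have h1 : σ y ∈ b' ++ σ y' :: rest' := by
    refine H.mem_of_nd hp' hy (N := N) (by omega) hR ?_
    refine H.dom2 hC hC' hR (M := L) (by omega) hadj hp' hL' ?_
    rcases hb' with ⟨rfl, rfl⟩ | ⟨β, b'', rfl, rfl | rfl⟩
    · exact Or.inr (by simp)
    · exact Or.inl (by simp)
    · exact Or.inr (by simp)
  have hinj : σ y ≠ σ y' := fun h => hne (by rw [← H.inv y, h, H.inv])
  have h2 : σ y ∉ b' := by
    intro h
    obtain ⟨l, hl, hlk⟩ := hbH' _ h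
    rw [H.inv] at hl
    by_cases hl0 : l = []
    · subst hl0
      exact (pth_pure hp' (by simp) _ h).1 (pth_single hl)
    · exact hR (rch_mono (by omega) (fwd1 hl hl0))
  have h3 : σ y ∈ rest' := by
    simp only [List.mem_append, List.mem_cons] at h1
    tauto
  obtain ⟨r1, q, rfl⟩ := List.append_of_mem h3
  have hq : Pth adj σ Y (σ y :: q) :=
    pth_suffix (a := b' ++ σ y' :: r1) (by simpa using hp') (by simp)
  have hqy : ¬ nd σ q y := by
    rw [← H.nd_inv]; exact seg_avoid (a := [σ y]) (by simpa using pth_seg hq) _ (by simp)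
  have hqlen : q.length ≤ L := by simp at hL'; omega
  have hSb : Seg adj σ (b ++ [σ y]) := seg_prefix (b := rest) (by simpa using pth_seg hp)
  have hblen : b.length ≤ L := by simp at hL; omega
  have hqb : ∀ z ∈ q, ¬ nd σ b z := by
    intro z hz hz'
    have hq0 : q ≠ [] := List.ne_nil_of_mem hz
    exact hR (rch_mono (by omega) (H.lemZ hy hSb (pth_pure hp (by simp)) hbH
      (pth_suffix (a := [σ y]) (by simpa using hq) hq0) hqy ⟨z, hz, hz'⟩))
  have hP : Pth adj σ Y (b ++ σ y :: q) :=
    pth_splice hSb hq (H.avoid_symm hqb) (pth_pure hp (by simp))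
  have hlen : (b ++ σ y :: q).length ≤ 2 * L := by simp at hL hL' ⊢; omega
  have h4 : σ y' ∈ b ++ σ y :: q := by
    refine H.mem_of_nd hP hy' (N := N) (by omega) hR' ?_
    refine H.dom2 hC' hC hR' (M := 2 * L) (by omega) (H.symm _ _ hadj) hP hlen ?_
    rcases hb with ⟨rfl, rfl⟩ | ⟨β, b'', rfl, rfl | rfl⟩
    · exact Or.inr (by simp)
    · exact Or.inl (by simp)
    · exact Or.inr (by simp)
  have h5 : σ y' ∉ q := by
    intro h
    exact seg_avoid (a := b' ++ [σ y']) (b := r1 ++ σ y :: q) (by simpa using pth_seg hp') (σ y')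
      (by simp) (Or.inl (by simp [h]))
  simp only [List.mem_append, List.mem_cons] at h4
  rcases h4 with h | h | h
  · exact h
  · exact absurd h.symm hinj
  · exact absurd h h5

/-- Lemma C -/
lemma cell_eq {k k' L N : ℕ} {x y x' y' : V} (hC : Cell adj σ Y k k' L x y)
    (hC' : Cell adj σ Y k k' L x' y') (hR : ¬ Rch adj σ Y N y) (hR' : ¬ Rch adj σ Y N y')
    (hM : 3 * L + k + k' + 8 ≤ N) (hadj : adj x x') : y = y' := by
  by_contra hne
  obtain ⟨b, rest, hp, hb, hbH⟩ := H.cell_half hC hC' hR hR' hM hadj hne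
  obtain ⟨l, hl, hlk⟩ := hbH _ hb
  rw [H.inv] at hl
  by_cases hl0 : l = []
  · subst hl0
    exact (pth_pure hp (by simp) _ hb).1 (pth_single hl)
  · exact hR' (rch_mono (by omega) (fwd1 hl hl0))

end Sys
end Comb
end PaperPM

open scoped Classical
namespace PaperPM
section Comb2
variable {V : Type*} (adj : V → V → Prop) (σ : V → V) (Y : Set V)

def Bs (n : ℕ) (v : V) : Prop := ∃ l, Pth adj σ Y (v :: l) ∧ l.length ≤ n
def As (n : ℕ) : Set V := {v | Bs adj σ Y n v ∨ Bs adj σ Y n (σ v)}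
def Yp (r w : ℕ) : Set V := {y | Bs adj σ Y r (σ y) ∧ ¬ Rch adj σ Y w y}
def Zs (r w : ℕ) : Set V := {x | x ∈ As adj σ Y r ∧ x ∉ Yp adj σ Y r w ∧ σ x ∉ Yp adj σ Y r w}
def Valid (n : ℕ) : Prop := ∀ y ∈ Y, ¬ Rch adj σ Y n y

variable {adj σ Y}

lemma Valid.mono {n m : ℕ} (h : n ≤ m) (hv : Valid adj σ Y m) : Valid adj σ Y n :=
  fun y hy hr => hv y hy (Sys.rch_mono h hr)

lemma Bs.mono {n m : ℕ} (h : n ≤ m) {v : V} (hv : Bs adj σ Y n v) : Bs adj σ Y m v := by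
  obtain ⟨l, h1, h2⟩ := hv
  exact ⟨l, h1, h2.trans h⟩

lemma As.mono {n m : ℕ} (h : n ≤ m) : As adj σ Y n ⊆ As adj σ Y m := by
  rintro v (hv | hv)
  · exact Or.inl (hv.mono h)
  · exact Or.inr (hv.mono h)

lemma Yp.anti {r w w' : ℕ} (h : w ≤ w') : Yp adj σ Y r w' ⊆ Yp adj σ Y r w :=
  fun _ hy => ⟨hy.1, fun h' => hy.2 (Sys.rch_mono h h')⟩

lemma Zs.mono {r w w' : ℕ} (h : w ≤ w') : Zs adj σ Y r w ⊆ Zs adj σ Y r w' :=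
  fun _ hy => ⟨hy.1, fun h' => hy.2.1 (Yp.anti h h'), fun h' => hy.2.2 (Yp.anti h h')⟩

lemma Bs.of_rch {n : ℕ} {v : V} (hp : Pure σ Y v) (h : Rch adj σ Y n v) : Bs adj σ Y n v := by
  obtain ⟨l, h1, h2, h3⟩ := h
  exact ⟨l, Or.inr ⟨hp, h3, h1⟩, h2⟩

lemma Bs.of_mem {n : ℕ} {v : V} (h : σ v ∈ Y) : Bs adj σ Y n v :=
  ⟨[], Or.inl ⟨rfl, h⟩, by simp⟩

lemma Bs.cases {n : ℕ} {v : V} (h : Bs adj σ Y n v) : σ v ∈ Y ∨ (Pure σ Y v ∧ Rch adj σ Y n v) := by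
  obtain ⟨l, ⟨_, h1⟩ | ⟨h1, h2, h3⟩, h4⟩ := h
  · exact Or.inl h1
  · exact Or.inr ⟨h1, l, h3, h4, h2⟩

namespace Sys
variable (H : Sys adj σ Y)
include H

lemma As_inv {n : ℕ} {v : V} : σ v ∈ As adj σ Y n ↔ v ∈ As adj σ Y n := by
  simp only [As, Set.mem_setOf_eq, H.inv]; tauto

lemma Y_sub {r w : ℕ} (hv : Valid adj σ Y w) : Y ⊆ Yp adj σ Y r w :=
  fun y hy => ⟨Bs.of_mem (by rwa [H.inv]), hv y hy⟩

lemma sysYp {r w : ℕ} (hrw : r ≤ w) (hv : Valid adj σ Y w) : Sys adj σ (Yp adj σ Y r w) where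
  symm := H.symm
  inv := H.inv
  fix y hy := H.Y_sub hv (H.fix y hy)
  hY y h1 h2 := by
    have a1 : y ∈ Y := by
      rcases h1.1.cases with h | h
      · rwa [H.inv] at h
      · exact absurd (rch_mono hrw h.2) h2.2
    have a2 : σ y ∈ Y := by
      have := h2.1
      rw [H.inv] at this
      rcases this.cases with h | h
      · exact h
      · exact absurd (rch_mono hrw h.2) h1.2
    exact H.hY y a1 a2

lemma Yp_cond {r w : ℕ} (hrw : r ≤ w) (hv : Valid adj σ Y w) {y : V} (hy : y ∈ Yp adj σ Y r w) :
    σ y ∈ Y → σ y = y := fun h => (H.sysYp hrw hv).hY y hy (H.Y_sub hv h)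

lemma pure_of_Yp {r w : ℕ} (hv : Valid adj σ Y w) {x : V} (h : Pure σ (Yp adj σ Y r w) x) :
    Pure σ Y x := ⟨fun h' => h.1 (H.Y_sub hv h'), fun h' => h.2 (H.Y_sub hv h')⟩

omit H in
lemma pth_last {l : List V} (h : Pth adj σ Y l) : ∃ mid e, l = mid ++ [e] ∧ σ e ∈ Y ∧
    ∀ x ∈ mid, Pure σ Y x := by
  obtain ⟨mid, e, rfl⟩ : ∃ mid e, l = mid ++ [e] := by
    rcases List.eq_nil_or_concat l with h0 | ⟨a, b, h0⟩
    · exact absurd h0 (pth_ne h)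
    · exact ⟨a, b, by simpa using h0⟩
  refine ⟨mid, e, rfl, ?_, pth_pure h (by simp)⟩
  exact pth_single (pth_suffix h (by simp))

/-- A `Yp`-path reaching `v` gives a `Y`-path to `v`. -/
lemma Yp_rch {r w n : ℕ} (hw : r + n + 2 ≤ w) (hv : Valid adj σ Y w) {v : V}
    (hv0 : σ v ∈ Y → σ v = v) (h : Rch adj σ (Yp adj σ Y r w) n v) :
    Rch adj σ Y (r + n + 2) v := by
  obtain ⟨l, h1, h2, h3⟩ := h
  obtain ⟨mid, e, rfl, he, hmid⟩ := pth_last h1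
  have he1 := he.1
  rw [H.inv] at he1
  obtain ⟨l0, hl0, hl1⟩ := he1
  have hF : Seg adj σ (v :: mid ++ [e]) := ⟨Or.inr h3, pth_seg h1⟩
  have hlen : (e :: l0).length + (v :: mid ++ [e]).length ≤ r + n + 2 := by
    simp at h2 ⊢; omega
  rcases H.hit (p := e :: l0) hl0 rfl hF (fun x hx => H.pure_of_Yp hv (hmid x hx)) hv0
    (by
      have := H.Yp_cond (by omega) hv he
      rw [H.inv] at this; exact fun h => (this h).symm) ⟨e, by simp, Or.inl (by simp)⟩ with h | h
  · exact rch_mono hlen h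
  · exact absurd (rch_mono (hlen.trans hw) h) he.2

lemma validYp {r w n : ℕ} (hw : r + n + 2 ≤ w) (hv : Valid adj σ Y w) :
    Valid adj σ (Yp adj σ Y r w) n := fun y hy h =>
  hy.2 (rch_mono hw (H.Yp_rch hw hv (H.Yp_cond (by omega) hv hy) h))

lemma Yp_As {r w n : ℕ} (hw : r + n + 2 ≤ w) (hv : Valid adj σ Y w) :
    As adj σ (Yp adj σ Y r w) n ⊆ As adj σ Y (r + n + 2) := by
  have key : ∀ v, Bs adj σ (Yp adj σ Y r w) n v → Bs adj σ Y (r + n + 2) v := by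
    intro v h
    rcases h.cases with h1 | ⟨h1, h2⟩
    · have := h1.1
      rw [H.inv] at this
      exact this.mono (by omega)
    · have hp := H.pure_of_Yp hv h1
      exact Bs.of_rch hp (H.Yp_rch hw hv (fun h => absurd h hp.2) h2)
  rintro v (h | h)
  · exact Or.inl (key _ h)
  · exact Or.inr (key _ h)

lemma out_As {w : ℕ} {x x' : V} (h : Bs adj σ Y w (σ x)) (ha : adj x x') :
    x' ∈ As adj σ Y (w + 1) := by
  obtain ⟨l, h1, h2⟩ := h
  by_cases hn : nd σ (σ x :: l) x'
  · have key : ∀ z ∈ σ x :: l, Bs adj σ Y (w + 1) z := by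
      intro z hz
      obtain ⟨a, b, hab⟩ := List.append_of_mem hz
      rw [hab] at h1
      refine ⟨b, pth_suffix h1 (by simp), ?_⟩
      have := congrArg List.length hab
      simp at this; omega
    rcases hn with h | h
    · exact Or.inl (key _ h)
    · exact Or.inr (key _ h)
  · have hr : Rch adj σ Y (w + 1) x' := ⟨_, h1, by simpa using h2, by rwa [H.inv], hn⟩
    by_cases hp : Pure σ Y x'
    · exact Or.inl (Bs.of_rch hp hr)
    · by_cases h0 : σ x' ∈ Y
      · exact Or.inl (Bs.of_mem h0)
      · right
        apply Bs.of_mem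
        rw [H.inv]
        by_contra h3; exact hp ⟨h3, h0⟩

lemma Zs_B {r w : ℕ} (hrw : r ≤ w) (hv : Valid adj σ Y w) {x : V} (hx : x ∈ Zs adj σ Y r w) :
    Bs adj σ Y w x ∧ Bs adj σ Y w (σ x) := by
  obtain ⟨h1, h2, h3⟩ := hx
  have hp : Pure σ Y x := H.pure_of_Yp hv ⟨h2, h3⟩
  have hp' := H.pure_inv.2 hp
  rcases h1 with h | h
  · refine ⟨h.mono hrw, Bs.of_rch hp' ?_⟩
    by_contra h4
    exact h3 ⟨by rwa [H.inv], h4⟩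
  · refine ⟨Bs.of_rch hp ?_, h.mono hrw⟩
    by_contra h4
    exact h2 ⟨h, h4⟩

lemma cell_of {r w W : ℕ} (hrw : r ≤ w) (hv : Valid adj σ Y w) {x e : V} {b rest : List V}
    (hp : Pth adj σ Y (b ++ e :: rest)) (hlen : (b ++ e :: rest).length ≤ r + 1)
    (hb : ∀ β ∈ b, σ β ∉ Yp adj σ Y r w) (he : σ e ∈ Yp adj σ Y r w)
    (hb0 : b = [] → x = σ e) (hhd : ∀ β b', b = β :: b' → (β = x ∨ β = σ x))
    (hx : Bs adj σ Y W (σ x)) : Cell adj σ Y w W (r + 1) x (σ e) := by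
  refine ⟨b, rest, by rwa [H.inv], by rwa [H.inv], ?_, ?_, hx, H.Yp_cond hrw hv he⟩
  · cases b with
    | nil => exact Or.inl ⟨rfl, hb0 rfl⟩
    | cons β b' => exact Or.inr ⟨β, b', rfl, hhd β b' rfl⟩
  · intro β hβ
    have hpure := pth_pure hp (by simp) β hβ
    have hB : Bs adj σ Y r β := by
      obtain ⟨a, b1, rfl⟩ := List.append_of_mem hβ
      refine ⟨b1 ++ e :: rest, pth_suffix (a := a) (by simpa using hp) (by simp), ?_⟩
      simp at hlen ⊢; omega
    have hr : Rch adj σ Y w (σ β) := by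
      by_contra h
      exact hb β hβ ⟨by rwa [H.inv], h⟩
    exact Bs.of_rch (H.pure_inv.2 hpure) hr

end Sys
end Comb2
end PaperPM

open scoped Classical
namespace PaperPM
section Iso
variable {Γ : Type*} [Group Γ] (S : Finset Γ)

/-- number of directed edges from `P` to `Q` -/
noncomputable def ed (P Q : Finset Γ) : ℤ := ∑ a ∈ P, ∑ s ∈ S, if s * a ∈ Q then (1 : ℤ) else 0
noncomputable def bd (A : Finset Γ) : ℤ := ∑ a ∈ A, ∑ s ∈ S, if s * a ∈ A then (0 : ℤ) else 1

variable {S}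

lemma bd_eq (A : Finset Γ) : bd S A = S.card * A.card - ed S A A := by
  have : bd S A + ed S A A = S.card * A.card := by
    rw [bd, ed, ← Finset.sum_add_distrib]
    rw [Finset.sum_congr rfl (g := fun _ => (S.card : ℤ))]
    · simp [mul_comm]
    · intro a _
      rw [← Finset.sum_add_distrib, Finset.sum_congr rfl (g := fun _ => (1 : ℤ))]
      · simp
      · intro s _; split_ifs <;> simp
  linarith

lemma ed_nonneg (P Q : Finset Γ) : 0 ≤ ed S P Q := by
  refine Finset.sum_nonneg fun a _ => Finset.sum_nonneg fun s _ => ?_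
  split_ifs <;> simp

lemma ed_union_left {P P' : Finset Γ} (Q : Finset Γ) (h : Disjoint P P') :
    ed S (P ∪ P') Q = ed S P Q + ed S P' Q := Finset.sum_union h

lemma ed_union_right (P : Finset Γ) {Q Q' : Finset Γ} (h : Disjoint Q Q') :
    ed S P (Q ∪ Q') = ed S P Q + ed S P Q' := by
  simp only [ed, ← Finset.sum_add_distrib]
  refine Finset.sum_congr rfl fun a _ => Finset.sum_congr rfl fun s _ => ?_
  have : s * a ∈ Q → s * a ∉ Q' := fun h' => Finset.disjoint_left.1 h h'
  simp only [Finset.mem_union]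
  split_ifs <;> simp_all

lemma ed_symm (hS : ∀ s ∈ S, s⁻¹ ∈ S) (P Q : Finset Γ) : ed S P Q = ed S Q P := by
  have key : ∀ P Q : Finset Γ, ed S P Q = ∑ a ∈ P, ∑ b ∈ Q, if b * a⁻¹ ∈ S then (1 : ℤ) else 0 := by
    intro P Q
    refine Finset.sum_congr rfl fun a _ => ?_
    rw [← Finset.sum_filter, ← Finset.sum_filter]
    simp only [Finset.sum_const, nsmul_eq_mul, mul_one]
    norm_cast
    refine Finset.card_bij (fun s _ => s * a) ?_ ?_ ?_
    · intro s hs; simp at hs ⊢; exact ⟨hs.2, hs.1⟩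
    · intro s _ t _ h; exact mul_right_cancel h
    · intro b hb; simp at hb; exact ⟨b * a⁻¹, by simp [hb], by simp⟩
  rw [key, key, Finset.sum_comm]
  refine Finset.sum_congr rfl fun a _ => Finset.sum_congr rfl fun b _ => ?_
  have : a * b⁻¹ ∈ S ↔ b * a⁻¹ ∈ S := by
    constructor <;> intro h <;> simpa using hS _ h
  simp [this]

lemma ed_le (P Q : Finset Γ) : ed S P Q ≤ S.card * P.card := by
  calc ed S P Q ≤ ∑ a ∈ P, ∑ s ∈ S, (1 : ℤ) := by
        refine Finset.sum_le_sum fun a _ => Finset.sum_le_sum fun s _ => ?_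
        split_ifs <;> simp
    _ = _ := by simp [mul_comm]

lemma bd_decomp {P R : Finset Γ} (hS : ∀ s ∈ S, s⁻¹ ∈ S) (h : Disjoint P R) :
    bd S (P ∪ R) = bd S P + bd S R - 2 * ed S P R := by
  rw [bd_eq, bd_eq, bd_eq, ed_union_left _ h, ed_union_right _ h, ed_union_right _ h,
    ed_symm hS R P, Finset.card_union_of_disjoint h]
  push_cast; ring

lemma bd_sub (hS : ∀ s ∈ S, s⁻¹ ∈ S) (A B : Finset Γ) :
    bd S (A ∩ B) + bd S (A ∪ B) ≤ bd S A + bd S B := by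
  have d1 : Disjoint (A \ B) (A ∩ B) := Finset.disjoint_sdiff_inter A B
  have d2 : Disjoint (B \ A) (A ∩ B) := by
    rw [Finset.inter_comm]; exact Finset.disjoint_sdiff_inter B A
  have d3 : Disjoint (A \ B) (B \ A) := disjoint_sdiff_sdiff
  have d4 : Disjoint (A \ B) (B \ A ∪ A ∩ B) := by
    rw [Finset.disjoint_union_right]; exact ⟨d3, d1⟩
  have e1 : A = (A \ B) ∪ (A ∩ B) := by ext; simp; tauto
  have e2 : B = (B \ A) ∪ (A ∩ B) := by ext; simp; tauto
  have e3 : A ∪ B = (A \ B) ∪ ((B \ A) ∪ (A ∩ B)) := by ext; simp; tauto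
  have a1 := bd_decomp hS d1
  have a2 := bd_decomp hS d2
  have a3 := bd_decomp hS d4
  rw [bd_decomp hS d2, ed_union_right _ d2] at a3
  rw [← e1] at a1
  rw [← e2] at a2
  rw [← e3] at a3
  have := ed_nonneg (S := S) (A \ B) (B \ A)
  linarith

lemma bd_posi (hS : ∀ s ∈ S, s⁻¹ ∈ S) (A B : Finset Γ) :
    bd S (A \ B) + bd S (B \ A) ≤ bd S A + bd S B := by
  have d1 : Disjoint (A \ B) (A ∩ B) := Finset.disjoint_sdiff_inter A B
  have d2 : Disjoint (B \ A) (A ∩ B) := by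
    rw [Finset.inter_comm]; exact Finset.disjoint_sdiff_inter B A
  have d3 : Disjoint (A \ B) (B \ A) := disjoint_sdiff_sdiff
  have d4 : Disjoint (A \ B ∪ B \ A) (A ∩ B) := by
    rw [Finset.disjoint_union_left]; exact ⟨d1, d2⟩
  have e1 : A = (A \ B) ∪ (A ∩ B) := by ext; simp; tauto
  have e2 : B = (B \ A) ∪ (A ∩ B) := by ext; simp; tauto
  have a1 := bd_decomp hS d1
  have a2 := bd_decomp hS d2
  rw [← e1] at a1
  rw [← e2] at a2
  have a4 := ed_le (S := S) (A ∩ B) ((A \ B ∪ B \ A) ∪ (A ∩ B))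
  rw [ed_union_right _ d4, ed_union_right _ d3, ed_symm hS (A ∩ B) (A \ B),
    ed_symm hS (A ∩ B) (B \ A)] at a4
  have a5 := bd_eq (S := S) (A ∩ B)
  linarith

lemma bd_trans (A : Finset Γ) (g : Γ) : bd S (A.map (mulRightEmbedding g)) = bd S A := by
  simp only [bd, Finset.sum_map, mulRightEmbedding_apply]
  refine Finset.sum_congr rfl fun a _ => Finset.sum_congr rfl fun s _ => ?_
  have : s * (a * g) ∈ A.map (mulRightEmbedding g) ↔ s * a ∈ A := by
    simp [← mul_assoc]
  simp only [this]

lemma bd_single (h1 : (1 : Γ) ∉ S) (g : Γ) : bd S {g} = S.card := by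
  simp only [bd, Finset.sum_singleton, Finset.mem_singleton, mul_eq_right]
  rw [Finset.sum_congr rfl (g := fun _ => (1 : ℤ))]
  · simp
  · intro s hs
    have : s ≠ 1 := fun h => h1 (h ▸ hs)
    simp [this]

/-- Atoms argument: if `T` is a right-translation-invariant family whose minimal members are
disjoint or equal, a minimal member containing `1` is a subgroup. -/
lemma atom_sub {A : Finset Γ} (hA1 : (1 : Γ) ∈ A)
    (hA : ∀ g : Γ, (1 : Γ) ∈ A.map (mulRightEmbedding g) → A.map (mulRightEmbedding g) = A) :
    (∀ a ∈ A, ∀ b ∈ A, b * a⁻¹ ∈ A) ∧ bd S A = A.card * ((S.filter (· ∉ A)).card : ℤ) ∧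
      (∀ a ∈ A, a⁻¹ ∈ A) := by
  have h1 : ∀ a ∈ A, ∀ b ∈ A, b * a⁻¹ ∈ A := by
    intro a ha b hb
    rw [← hA a⁻¹ (Finset.mem_map.2 ⟨a, ha, by simp⟩)]
    simp [hb]
  have h2 : ∀ a ∈ A, a⁻¹ ∈ A := fun a ha => by simpa using h1 a ha 1 hA1
  refine ⟨h1, ?_, h2⟩
  rw [bd, Finset.sum_congr rfl (g := fun _ => ((S.filter (· ∉ A)).card : ℤ))]
  · simp
  · intro a ha
    rw [Finset.card_filter]
    push_cast
    refine Finset.sum_congr rfl fun s _ => ?_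
    have : s * a ∈ A ↔ s ∈ A := by
      constructor
      · intro h; simpa using h1 a ha _ h
      · intro h; simpa using h1 a⁻¹ (h2 a ha) s h
    by_cases h : s ∈ A <;> simp [this, h]

lemma card_bound (h1 : (1 : Γ) ∉ S) {A : Finset Γ} (hA1 : (1 : Γ) ∈ A) :
    (S.card : ℤ) - (S.filter (· ∉ A)).card + 1 ≤ A.card := by
  have e : S.card = (S.filter (· ∈ A)).card + (S.filter (· ∉ A)).card :=
    (Finset.card_filter_add_card_filter_not (s := S) (· ∈ A)).symm
  have : (S.filter (· ∈ A)).card < A.card := by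
    apply Finset.card_lt_card
    refine ⟨fun x hx => (Finset.mem_filter.1 hx).2, fun h => h1 (Finset.mem_filter.1 (h hA1)).1⟩
  omega

lemma bd_ge (hS : ∀ s ∈ S, s⁻¹ ∈ S) (h1 : (1 : Γ) ∉ S)
    (hpos : ∀ A : Finset Γ, A.Nonempty → 0 < bd S A) (A : Finset Γ) (hA : A.Nonempty) :
    (S.card : ℤ) ≤ bd S A := by
  by_contra hlt
  push Not at hlt
  -- minimal cut value
  have hex : ∃ k : ℕ, ∃ A : Finset Γ, A.Nonempty ∧ bd S A = k :=
    ⟨(bd S A).toNat, A, hA, by rw [Int.toNat_of_nonneg (hpos A hA).le]⟩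
  obtain ⟨A1, hA1, hk⟩ := Nat.find_spec hex
  set k := Nat.find hex with hkdef
  have hmin : ∀ B : Finset Γ, B.Nonempty → (k : ℤ) ≤ bd S B := by
    intro B hB
    have := Nat.find_min' hex ⟨B, hB, (Int.toNat_of_nonneg (hpos B hB).le).symm⟩
    have h0 := (hpos B hB).le
    omega
  have hex2 : ∃ n : ℕ, ∃ A : Finset Γ, A.Nonempty ∧ bd S A = k ∧ A.card = n := ⟨_, A1, hA1, hk, rfl⟩
  obtain ⟨A2, hA2, hk2, hn⟩ := Nat.find_spec hex2
  have hmin2 : ∀ B : Finset Γ, B.Nonempty → bd S B = k → A2.card ≤ B.card := by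
    intro B hB hBk
    rw [hn]; exact Nat.find_min' hex2 ⟨B, hB, hBk, rfl⟩
  obtain ⟨a, ha⟩ := hA2
  set H := A2.map (mulRightEmbedding a⁻¹) with hH
  have hH1 : (1 : Γ) ∈ H := Finset.mem_map.2 ⟨a, ha, by simp⟩
  have hHk : bd S H = k := by rw [hH, bd_trans, hk2]
  have hHc : H.card = A2.card := by simp [hH]
  obtain ⟨-, g2, -⟩ := atom_sub (S := S) hH1 (by
    intro g hg
    set B := H.map (mulRightEmbedding g) with hB
    have hBk : bd S B = k := by rw [hB, bd_trans, hHk]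
    have hBc : B.card = A2.card := by rw [hB, Finset.card_map, hHc]
    have hI : (B ∩ H).Nonempty := ⟨1, by simp [hg, hH1]⟩
    have hs := bd_sub hS B H
    have m1 := hmin _ hI
    have m2 := hmin (B ∪ H) ⟨1, by simp [hg]⟩
    have m3 := hmin2 _ hI (by omega)
    have e1 : B ∩ H = B := Finset.eq_of_subset_of_card_le Finset.inter_subset_left (by omega)
    have e2 : B ∩ H = H := Finset.eq_of_subset_of_card_le Finset.inter_subset_right (by omega)
    rw [← e1, e2])
  have g3 := card_bound h1 hH1
  have g4 : k < S.card := by have := hmin A hA; omega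
  have g5 : 0 < bd S H := hpos H ⟨1, hH1⟩
  set p : ℤ := ((S.filter (· ∉ H)).card : ℤ)
  have hp : 0 < p := by
    by_contra h
    have : p = 0 := le_antisymm (by omega) (Int.natCast_nonneg _)
    rw [g2, this, mul_zero] at g5; exact lt_irrefl _ g5
  have hp2 : p ≤ S.card := by
    simp only [p]; exact_mod_cast Finset.card_filter_le _ _
  nlinarith

lemma bd_gt (hS : ∀ s ∈ S, s⁻¹ ∈ S) (h1 : (1 : Γ) ∉ S) (hinv : ∀ s ∈ S, s⁻¹ ≠ s)
    (hd : 3 ≤ S.card)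
    (hpos : ∀ A : Finset Γ, A.Nonempty → 0 < bd S A) (A : Finset Γ) (hA : 2 ≤ A.card) :
    (S.card : ℤ) + 1 ≤ bd S A := by
  have hge := bd_ge hS h1 hpos
  have hne : ∀ B : Finset Γ, 2 ≤ B.card → B.Nonempty := fun B hB => by
    rw [← Finset.card_pos]; omega
  by_contra hlt
  have hAt : bd S A = S.card := by have := hge A (hne A hA); omega
  have hex2 : ∃ n : ℕ, ∃ A : Finset Γ, 2 ≤ A.card ∧ bd S A = S.card ∧ A.card = n :=
    ⟨_, A, hA, hAt, rfl⟩
  obtain ⟨A2, hA2, hk2, hn⟩ := Nat.find_spec hex2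
  have hmin2 : ∀ B : Finset Γ, 2 ≤ B.card → bd S B = S.card → A2.card ≤ B.card := by
    intro B hB hBk
    rw [hn]; exact Nat.find_min' hex2 ⟨B, hB, hBk, rfl⟩
  have hc3 : 3 ≤ A2.card := by
    by_contra hcon
    have : A2.card = 2 := by omega
    obtain ⟨a, b, hab, rfl⟩ := Finset.card_eq_two.1 this
    have hdis : Disjoint ({a} : Finset Γ) {b} := by simpa using hab
    have e1 : ({a, b} : Finset Γ) = {a} ∪ {b} := rfl
    rw [e1, bd_decomp hS hdis, bd_single h1, bd_single h1] at hk2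
    have : ed S {a} {b} ≤ 1 := by
      simp only [ed, Finset.sum_singleton, Finset.mem_singleton]
      rw [← Finset.sum_filter, Finset.sum_const]
      simp only [nsmul_eq_mul, mul_one]
      norm_cast
      rw [Finset.card_le_one]
      intro x hx y hy
      simp at hx hy
      exact mul_right_cancel (hx.2.trans hy.2.symm)
    omega
  obtain ⟨a, ha⟩ := hne A2 hA2
  set H := A2.map (mulRightEmbedding a⁻¹) with hH
  have hH1 : (1 : Γ) ∈ H := Finset.mem_map.2 ⟨a, ha, by simp⟩
  have hHk : bd S H = S.card := by rw [hH, bd_trans, hk2]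
  have hHc : H.card = A2.card := by simp [hH]
  obtain ⟨-, g2, g6⟩ := atom_sub (S := S) hH1 (by
    intro g hg
    set B := H.map (mulRightEmbedding g) with hB
    have hBk : bd S B = S.card := by rw [hB, bd_trans, hHk]
    have hBc : B.card = A2.card := by rw [hB, Finset.card_map, hHc]
    by_contra hBH
    have hI : (B ∩ H).Nonempty := ⟨1, by simp [hg, hH1]⟩
    have hs := bd_sub hS B H
    have m1 := hge _ hI
    have m2 := hge (B ∪ H) ⟨1, by simp [hg]⟩
    have c1 : (B ∩ H).card < 2 := by
      by_contra hc
      have m3 := hmin2 (B ∩ H) (by omega) (by omega)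
      have e1 : B ∩ H = B := Finset.eq_of_subset_of_card_le Finset.inter_subset_left (by omega)
      have e2 : B ∩ H = H := Finset.eq_of_subset_of_card_le Finset.inter_subset_right (by omega)
      exact hBH (by rw [← e1, e2])
    have c0 : 1 ≤ (B ∩ H).card := Finset.card_pos.2 hI
    have c2 : (B \ H).card + (B ∩ H).card = B.card := Finset.card_sdiff_add_card_inter B H
    have c3 : (H \ B).card + (H ∩ B).card = H.card := Finset.card_sdiff_add_card_inter H B
    rw [Finset.inter_comm] at c3
    have hq := bd_posi hS B H
    have m4 := hge (B \ H) (hne _ (by omega))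
    have m5 := hge (H \ B) (hne _ (by omega))
    have := hmin2 (B \ H) (by omega) (by omega)
    omega)
  have g3 := card_bound h1 hH1
  have g5 : 0 < bd S H := hpos H ⟨1, hH1⟩
  have hp1 : (S.filter (· ∉ H)).card = 1 := by
    have hp2 : ((S.filter (· ∉ H)).card : ℤ) ≤ S.card := by
      exact_mod_cast Finset.card_filter_le _ _
    have hcc : (3 : ℤ) ≤ H.card := by exact_mod_cast hHc ▸ hc3
    set p : ℤ := ((S.filter (· ∉ H)).card : ℤ) with hpdef
    have hp : 0 < p := by
      by_contra h
      have : p = 0 := le_antisymm (by omega) (Int.natCast_nonneg _)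
      rw [g2, this, mul_zero] at g5; exact lt_irrefl _ g5
    have : p = 1 := by
      by_contra hp'
      have h2 : 2 ≤ p := by omega
      rw [hHk] at g2
      rcases hp2.lt_or_eq with h | h
      · nlinarith
      · rw [← h] at g2; nlinarith
    omega
  obtain ⟨s, hs⟩ := Finset.card_eq_one.1 hp1
  have hsm : s ∈ S.filter (· ∉ H) := by rw [hs]; simp
  have hsm' : s⁻¹ ∈ S.filter (· ∉ H) := by
    rw [Finset.mem_filter] at hsm ⊢
    exact ⟨hS _ hsm.1, fun h => hsm.2 (by simpa using g6 _ h)⟩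
  rw [hs, Finset.mem_singleton] at hsm'
  exact hinv s (Finset.mem_filter.1 hsm).1 hsm'

lemma card_ge_three (hS : ∀ s ∈ S, s⁻¹ ∈ S) (h1 : (1 : Γ) ∉ S) {c0 : ℝ} (hc0 : 0 < c0)
    (hna : ∀ A : Finset Γ, A.Nonempty → c0 * A.card ≤ bd S A) : 3 ≤ S.card := by
  by_contra hd
  have hbd : ∀ n : ℕ, ∃ A : Finset Γ, A.card = n + 1 ∧ bd S A ≤ 2 := by
    intro n
    induction n with
    | zero => exact ⟨{1}, rfl, by rw [bd_single h1]; omega⟩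
    | succ n ih =>
      obtain ⟨A, hA, hA2⟩ := ih
      have hne : A.Nonempty := by rw [← Finset.card_pos]; omega
      have hpos : 0 < bd S A := by
        have := hna A hne
        have h2 : 0 < c0 * A.card := by
          have : (0 : ℝ) < A.card := by exact_mod_cast (by omega : 0 < A.card)
          positivity
        exact_mod_cast h2.trans_le this
      obtain ⟨a, ha, s, hs, has⟩ : ∃ a ∈ A, ∃ s ∈ S, s * a ∉ A := by
        by_contra hcon
        push Not at hcon
        have : bd S A = 0 := Finset.sum_eq_zero fun a ha => Finset.sum_eq_zero fun s hs => by
          simp [hcon a ha s hs]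
        omega
      have hdis : Disjoint A {s * a} := by simpa using has
      refine ⟨A ∪ {s * a}, by rw [Finset.card_union_of_disjoint hdis]; simp [hA], ?_⟩
      rw [bd_decomp hS hdis, bd_single h1]
      have : 1 ≤ ed S A {s * a} := by
        rw [ed]
        refine le_trans ?_ (Finset.single_le_sum (f := fun a' => ∑ s' ∈ S,
          if s' * a' ∈ ({s * a} : Finset Γ) then (1 : ℤ) else 0)
          (fun i _ => Finset.sum_nonneg fun s _ => by split_ifs <;> simp) ha)
        refine le_trans ?_ (Finset.single_le_sum (f := fun s' =>
          if s' * a ∈ ({s * a} : Finset Γ) then (1 : ℤ) else 0)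
          (fun i _ => by split_ifs <;> simp) hs)
        simp
      omega
  obtain ⟨n, hn⟩ := exists_nat_gt (2 / c0)
  obtain ⟨A, hA, hA2⟩ := hbd n
  have := hna A (by rw [← Finset.card_pos]; omega)
  rw [div_lt_iff₀ hc0] at hn
  have h3 : (bd S A : ℝ) ≤ 2 := by exact_mod_cast hA2
  rw [hA] at this
  push_cast at this
  nlinarith

theorem iso (hS : ∀ s ∈ S, s⁻¹ ∈ S) (h1 : (1 : Γ) ∉ S) (hinv : ∀ s ∈ S, s⁻¹ ≠ s)
    {c0 : ℝ} (hc0 : 0 < c0) (hna : ∀ A : Finset Γ, A.Nonempty → c0 * A.card ≤ bd S A) :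
    ∃ c : ℝ, 0 < c ∧ ∀ A : Finset Γ, A.Nonempty → (S.card : ℝ) + c * (A.card - 1) ≤ bd S A := by
  have hd := card_ge_three hS h1 hc0 hna
  have hpos : ∀ A : Finset Γ, A.Nonempty → 0 < bd S A := by
    intro A hA
    have h2 : 0 < c0 * A.card := by
      have : (0 : ℝ) < A.card := by exact_mod_cast hA.card_pos
      positivity
    exact_mod_cast h2.trans_le (hna A hA)
  have hd' : (3 : ℝ) ≤ S.card := by exact_mod_cast hd
  refine ⟨c0 / (2 * S.card), by positivity, fun A hA => ?_⟩
  have hA1 : (1 : ℝ) ≤ A.card := by exact_mod_cast hA.card_pos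
  have hcd : c0 / (2 * S.card) * (2 * S.card) = c0 := by field_simp
  set c := c0 / (2 * S.card)
  have hc : 0 < c := by positivity
  rcases Nat.lt_or_ge A.card 2 with h | h
  · have hA' : A.card = 1 := by have := hA.card_pos; omega
    have := bd_ge hS h1 hpos A hA
    rw [hA']
    have h2 : (S.card : ℝ) ≤ bd S A := by exact_mod_cast this
    simpa using h2
  · have h3 : (S.card : ℝ) + 1 ≤ bd S A := by exact_mod_cast bd_gt hS h1 hinv hd hpos A h
    have h4 := hna A hA
    by_cases h5 : c * (A.card - 1) ≤ 1
    · linarith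
    · push Not at h5
      have h6 : 1 < c * A.card := by nlinarith
      have : c0 * A.card = (c * A.card) * (2 * S.card) := by rw [← hcd]; ring
      nlinarith
end Iso
end PaperPM

open scoped Classical
namespace PaperPM
section Spec
set_option linter.unusedSectionVars false
variable {Γ : Type*} [Group Γ] {S : Finset Γ}

abbrev FS (f : Γ → ℝ) : Prop := (Function.support f).Finite

lemma FS.summ {f : Γ → ℝ} (h : FS f) : Summable f := summable_of_hasFiniteSupport h

lemma FS.of {f g : Γ → ℝ} (h : FS f) (h' : ∀ x, f x = 0 → g x = 0) : FS g :=
  h.subset fun x hx hf => hx (h' x hf)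

lemma FS.of₂ {f f' g : Γ → ℝ} (h : FS f) (hf : FS f') (h' : ∀ x, f x = 0 → f' x = 0 → g x = 0) :
    FS g := (h.union hf).subset fun x hx => by
  by_contra hc
  simp only [Set.mem_union, Function.mem_support, not_or, not_not] at hc
  exact hx (h' x hc.1 hc.2)

lemma FS.sh {f : Γ → ℝ} (h : FS f) (s : Γ) : FS (fun x => f (s * x)) := by
  have : (Function.support fun x => f (s * x)) = (fun x => s * x) ⁻¹' Function.support f := by
    ext; simp
  rw [FS, this]
  exact h.preimage (mul_right_injective s).injOn

lemma tsum_sh (f : Γ → ℝ) (s : Γ) : ∑' x, f (s * x) = ∑' x, f x :=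
  (Equiv.mulLeft s).tsum_eq f

/-- L1 isoperimetry -/
lemma cheeger1 {c0 : ℝ} (hna : ∀ A : Finset Γ, A.Nonempty → c0 * A.card ≤ bd S A) :
    ∀ (n : ℕ) (f : Γ → ℝ) (hf : FS f), hf.toFinset.card = n → (∀ x, 0 ≤ f x) →
      c0 * ∑' x, f x ≤ ∑ s ∈ S, ∑' x, max (f x - f (s * x)) 0 := by
  intro n
  induction n using Nat.strong_induction_on with
  | _ n ih =>
  intro f hf hn h0
  rcases Finset.eq_empty_or_nonempty hf.toFinset with he | he
  · have : f = 0 := by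
      have : Function.support f = ∅ := by simpa using he
      simpa using this
    subst this; simp
  obtain ⟨a, ha, hmin⟩ := Finset.exists_min_image hf.toFinset f he
  set A := hf.toFinset with hA
  have hAm : ∀ x, x ∈ A ↔ f x ≠ 0 := fun x => by simp [hA]
  set m := f a
  have hm : 0 ≤ m := h0 a
  set f' : Γ → ℝ := fun x => f x - (if x ∈ A then m else 0) with hf'd
  have hf' : FS f' := hf.of fun x hx => by simp [hf'd, hAm, hx]
  have hI : FS (fun x => if x ∈ A then m else 0) := hf.of fun x hx => by simp [hAm, hx]
  have hlt : hf'.toFinset.card < n := by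
    rw [← hn]
    apply Finset.card_lt_card
    refine ⟨fun x hx => ?_, fun hsub => ?_⟩
    · simp only [Set.Finite.mem_toFinset, Function.mem_support] at hx
      rw [hAm]; intro hx0; exact hx (by simp [hf'd, hAm, hx0])
    · have := hsub ha
      simp only [Set.Finite.mem_toFinset, Function.mem_support] at this
      exact this (by simp [hf'd, ha, m])
  have key := ih _ hlt f' hf' rfl (fun x => by
    by_cases hx : x ∈ A
    · simp only [hf'd, hx, if_true]; linarith [hmin x hx]
    · simp [hf'd, hx, h0])
  have e1 : ∑' x, f x = ∑' x, f' x + m * A.card := by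
    have : ∑' x, (if x ∈ A then m else 0) = m * A.card := by
      rw [tsum_eq_sum (s := A) (fun x hx => by simp [hx])]
      simp [mul_comm]
    rw [← this, ← hf'.summ.tsum_add hI.summ]
    simp [hf'd]
  have e2 : ∑ s ∈ S, ∑' x, max (f x - f (s * x)) 0
      = ∑ s ∈ S, ∑' x, max (f' x - f' (s * x)) 0 + m * bd S A := by
    have hbd : (bd S A : ℝ) = ∑ s ∈ S, ∑ x ∈ A, if s * x ∈ A then (0:ℝ) else 1 := by
      rw [bd, Finset.sum_comm]; push_cast; rfl
    rw [hbd, Finset.mul_sum, ← Finset.sum_add_distrib]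
    refine Finset.sum_congr rfl fun s _ => ?_
    have : m * ∑ x ∈ A, (if s * x ∈ A then (0:ℝ) else 1)
        = ∑' x, if x ∈ A then (if s * x ∈ A then 0 else m) else 0 := by
      rw [tsum_eq_sum (s := A) (fun x hx => by simp [hx]), Finset.mul_sum]
      refine Finset.sum_congr rfl fun x hx => ?_
      simp only [hx, if_true]; split_ifs <;> simp
    rw [this, ← Summable.tsum_add]
    · congr 1; ext x
      by_cases hx : x ∈ A
      · by_cases hsx : s * x ∈ A
        · simp [hf'd, hx, hsx]
        · have h1 : f (s * x) = 0 := by by_contra h; exact hsx ((hAm _).2 h)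
          have h2 := hmin x hx
          simp only [hf'd, hx, hsx, if_true, if_false, h1]
          rw [max_eq_left (by linarith [h0 x]), max_eq_left (by simp; linarith)]; ring
      · have h1 : f x = 0 := by by_contra h; exact hx ((hAm _).2 h)
        have h3 : 0 ≤ f' (s * x) := by
          by_cases hsx : s * x ∈ A
          · simp only [hf'd, hsx, if_true]; linarith [hmin _ hsx]
          · simp [hf'd, hsx, h0]
        have h4 : f' x = 0 := by simp [hf'd, hx, h1]
        simp only [hx, if_false, h1, h4]
        rw [max_eq_right (by linarith [h0 (s * x)]), max_eq_right (by linarith)]; simp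
    · exact (hf'.of₂ (hf'.sh s) fun x h1 h2 => by simp [h1, h2]).summ
    · exact (hf.of fun x h1 => by simp [hAm, h1]).summ
  rw [e1, e2, mul_add]
  have := mul_le_mul_of_nonneg_left (hna A he) hm
  nlinarith

/-- ρ-bound constants. `Q = ∑ s, ∑ x φ x φ (s x)`. -/
lemma cheeger2 {c0 : ℝ} (hc0 : 0 < c0) (hS0 : S.Nonempty)
    (hna : ∀ A : Finset Γ, A.Nonempty → c0 * A.card ≤ bd S A) (φ : Γ → ℝ) (hφ : FS φ) :
    |∑ s ∈ S, ∑' x, φ x * φ (s * x)| ≤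
      (1 - c0 ^ 2 / (8 * (S.card : ℝ) ^ 2)) * S.card * ∑' x, φ x ^ 2 := by
  set n := ∑' x, φ x ^ 2 with hn
  set Q := ∑ s ∈ S, ∑' x, φ x * φ (s * x) with hQ
  set d : ℝ := (S.card : ℝ) with hd
  have hdpos : 0 < d := by simp [hd, hS0.card_pos]
  have hsq : FS (fun x => φ x ^ 2) := hφ.of fun x hx => by simp [hx]
  have hsq' : ∀ s, FS (fun x => φ (s * x) ^ 2) := fun s => (hφ.sh s).of fun x hx => by simp [hx]
  have hpr : ∀ s, FS (fun x => φ x * φ (s * x)) := fun s => hφ.of fun x hx => by simp [hx]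
  have hnn : 0 ≤ n := tsum_nonneg fun x => sq_nonneg _
  have expand : ∀ t u : ℝ, ∑ s ∈ S, ∑' x, (t * (φ x - φ (s * x)) ^ 2 + u * (φ x + φ (s * x)) ^ 2)
      = 2 * t * (d * n - Q) + 2 * u * (d * n + Q) := by
    intro t u
    have : ∀ s ∈ S, ∑' x, (t * (φ x - φ (s * x)) ^ 2 + u * (φ x + φ (s * x)) ^ 2)
        = 2 * (t + u) * n + 2 * (u - t) * ∑' x, φ x * φ (s * x) := by
      intro s _
      have e : ∀ x, t * (φ x - φ (s * x)) ^ 2 + u * (φ x + φ (s * x)) ^ 2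
        = (t + u) * φ x ^ 2 + (t + u) * φ (s * x) ^ 2 + 2 * (u - t) * (φ x * φ (s * x)) := by
        intro x; ring
      simp_rw [e]
      rw [Summable.tsum_add, Summable.tsum_add, tsum_mul_left, tsum_mul_left, tsum_mul_left,
        tsum_sh (fun x => φ x ^ 2) s]
      · ring
      · exact hsq.summ.mul_left _
      · exact (hsq' s).summ.mul_left _
      · exact (hsq.summ.mul_left _).add ((hsq' s).summ.mul_left _)
      · exact (hpr s).summ.mul_left _
    rw [Finset.sum_congr rfl this, Finset.sum_add_distrib, ← Finset.mul_sum, ← Finset.mul_sum, ← hQ]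
    simp only [Finset.sum_const, nsmul_eq_mul]
    rw [← hd]; ring
  have h1 : 0 ≤ d * n - Q := by
    have := expand 1 0
    have h : 0 ≤ ∑ s ∈ S, ∑' x, ((1:ℝ) * (φ x - φ (s * x)) ^ 2 + 0 * (φ x + φ (s * x)) ^ 2) :=
      Finset.sum_nonneg fun s _ => tsum_nonneg fun x => by positivity
    rw [this] at h; linarith
  have h2 : 0 ≤ d * n + Q := by
    have := expand 0 1
    have h : 0 ≤ ∑ s ∈ S, ∑' x, ((0:ℝ) * (φ x - φ (s * x)) ^ 2 + 1 * (φ x + φ (s * x)) ^ 2) :=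
      Finset.sum_nonneg fun s _ => tsum_nonneg fun x => by positivity
    rw [this] at h; linarith
  have main : ∀ t : ℝ, 0 < t → c0 * n ≤ t * (d * n - Q) + t⁻¹ * (d * n + Q) := by
    intro t ht
    have h := cheeger1 hna _ _ hsq rfl (fun x => sq_nonneg _)
    have e := expand (t / 2) (t⁻¹ / 2)
    have : 2 * (t / 2) * (d * n - Q) + 2 * (t⁻¹ / 2) * (d * n + Q) =
      t * (d * n - Q) + t⁻¹ * (d * n + Q) := by ring
    rw [← this, ← e]
    refine h.trans (Finset.sum_le_sum fun s _ => ?_)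
    refine Summable.tsum_le_tsum (fun x => ?_)
      (hsq.of₂ (hsq' s) fun x h1 h2 => by simp [h1, h2]).summ
      (hφ.of₂ (hφ.sh s) fun x h1 h2 => by simp [h1, h2]).summ
    set a := φ x
    set b := φ (s * x)
    have ht' : t * t⁻¹ = 1 := mul_inv_cancel₀ ht.ne'
    have hti : 0 < t⁻¹ := by positivity
    apply max_le
    · have : 0 ≤ t⁻¹ * (t * (a - b) - (a + b)) ^ 2 := by positivity
      have e : t⁻¹ * (t * (a - b) - (a + b)) ^ 2 = t * (t * t⁻¹) * (a - b) ^ 2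
        - 2 * (t * t⁻¹) * (a ^ 2 - b ^ 2) + t⁻¹ * (a + b) ^ 2 := by ring
      rw [e, ht'] at this
      linarith
    · positivity
  have hc2 : c0 ^ 2 / (8 * d ^ 2) * d * n = c0 ^ 2 * n / (8 * d) := by field_simp
  have hm1 := main (4 * d / c0) (by positivity)
  have hm2 := main (c0 / (4 * d)) (by positivity)
  have i1 : (4 * d / c0)⁻¹ = c0 / (4 * d) := by rw [inv_div]
  have i2 : (c0 / (4 * d))⁻¹ = 4 * d / c0 := by rw [inv_div]
  rw [i1] at hm1
  rw [i2] at hm2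
  have j1 : 4 * d / c0 * (c0 / (4 * d)) = 1 := by field_simp
  set τ := c0 / (4 * d) with hτ
  have hτp : 0 < τ := by positivity
  have k0 : τ * d = c0 / 4 := by rw [hτ]; field_simp
  have k1 : c0 ^ 2 * n / (8 * d) = τ * c0 * n / 2 := by rw [hτ]; ring
  rw [sub_mul, sub_mul, one_mul, hc2, k1, abs_le]
  have m1 := mul_le_mul_of_nonneg_left hm1 hτp.le
  have m2 := mul_le_mul_of_nonneg_left hm2 hτp.le
  have l1 : τ * (4 * d / c0 * (d * n - Q) + τ * (d * n + Q)) =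
    (4 * d / c0 * τ) * (d * n - Q) + τ ^ 2 * (d * n + Q) := by ring
  have l2 : τ * (τ * (d * n - Q) + 4 * d / c0 * (d * n + Q)) =
    (4 * d / c0 * τ) * (d * n + Q) + τ ^ 2 * (d * n - Q) := by ring
  rw [l1, j1] at m1
  rw [l2, j1] at m2
  have l3 : τ ^ 2 * (2 * d * n) = τ * c0 * n / 2 := by
    rw [show τ ^ 2 * (2 * d * n) = τ * (τ * d) * 2 * n by ring, k0]; ring
  have t2 : 0 ≤ τ ^ 2 := sq_nonneg _
  constructor
  · nlinarith
  · nlinarith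

/-- averaging operator on functions on `Γ` -/
noncomputable def avg (S : Finset Γ) (φ : Γ → ℝ) : Γ → ℝ := fun x => (∑ s ∈ S, φ (s * x)) / S.card

lemma FS.avg {φ : Γ → ℝ} (h : FS φ) : FS (avg S φ) := by
  refine (S.finite_toSet.biUnion (t := fun s => Function.support fun x => φ (s * x))
    (fun s _ => h.sh s)).subset fun x hx => ?_
  by_contra hc
  simp only [Set.mem_iUnion, Function.mem_support, not_exists, not_not, Finset.mem_coe] at hc
  apply hx
  simp only [PaperPM.avg]
  rw [Finset.sum_eq_zero hc, zero_div]

lemma avg_norm {c0 : ℝ} (hc0 : 0 < c0) (hS0 : S.Nonempty) (hS : ∀ s ∈ S, s⁻¹ ∈ S)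
    (hna : ∀ A : Finset Γ, A.Nonempty → c0 * A.card ≤ bd S A) :
    ∃ ρ : ℝ, 0 < ρ ∧ ρ < 1 ∧ ∀ φ : Γ → ℝ, FS φ →
      ∑' x, (avg S φ x) ^ 2 ≤ ρ ^ 2 * ∑' x, φ x ^ 2 := by
  have hdpos : (0:ℝ) < S.card := by simp [hS0.card_pos]
  set ρ : ℝ := max (1 - c0 ^ 2 / (8 * (S.card : ℝ) ^ 2)) (1 / 2)
  have hρ0 : 0 < ρ := lt_max_of_lt_right (by norm_num)
  refine ⟨ρ, hρ0, max_lt (by simp; positivity) (by norm_num), fun φ hφ => ?_⟩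
  set B : (Γ → ℝ) → (Γ → ℝ) → ℝ := fun f g => ∑' x, f x * avg S g x with hB
  have hquad : ∀ f, FS f → |B f f| ≤ ρ * ∑' x, f x ^ 2 := by
    intro f hf
    have h := cheeger2 hc0 hS0 hna f hf
    have e : B f f = (∑ s ∈ S, ∑' x, f x * f (s * x)) / S.card := by
      rw [← Summable.tsum_finsetSum
        (fun s _ => (hf.of (g := fun x => f x * f (s * x)) fun x hx => by simp [hx]).summ),
        ← tsum_div_const]
      simp only [hB, avg, ← mul_div_assoc, Finset.mul_sum]
    rw [e, abs_div, abs_of_pos hdpos, div_le_iff₀ hdpos]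
    refine h.trans ?_
    have : 0 ≤ ∑' x, f x ^ 2 := tsum_nonneg fun x => sq_nonneg _
    have h2 : 1 - c0 ^ 2 / (8 * (S.card : ℝ) ^ 2) ≤ ρ := le_max_left _ _
    nlinarith [mul_nonneg this hdpos.le]
  have hBs : ∀ f g, FS f → FS g → B f g = B g f := by
    intro f g hf hg
    have e : ∀ f g, FS f → FS g → B f g = (∑ s ∈ S, ∑' x, f x * g (s * x)) / S.card := by
      intro f g hf hg
      rw [← Summable.tsum_finsetSum
        (fun s _ => (hf.of (g := fun x => f x * g (s * x)) fun x hx => by simp [hx]).summ),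
        ← tsum_div_const]
      simp only [hB, avg, ← mul_div_assoc, Finset.mul_sum]
    rw [e f g hf hg, e g f hg hf]
    congr 1
    refine Finset.sum_bij (fun s _ => s⁻¹) (fun s hs => hS s hs) (fun a _ b _ h => inv_injective h)
      (fun b hb => ⟨b⁻¹, hS b hb, by simp⟩) fun s _ => ?_
    rw [← tsum_sh (fun x => g x * f (s⁻¹ * x)) s]
    refine tsum_congr fun x => ?_
    rw [inv_mul_cancel_left, mul_comm]
  set ψ : Γ → ℝ := fun x => avg S φ x / ρ with hψ
  have hψF : FS ψ := (hφ.avg (S := S)).of fun x hx => by simp [hψ, hx]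
  have hs1 : FS (fun x => φ x + ψ x) := hφ.of₂ hψF fun x h1 h2 => by simp [h1, h2]
  have hs2 : FS (fun x => φ x - ψ x) := hφ.of₂ hψF fun x h1 h2 => by simp [h1, h2]
  have hadd : ∀ f g h, FS f → FS g → B (fun x => f x + g x) h = B f h + B g h := by
    intro f g h hf hg
    simp only [hB]
    rw [← Summable.tsum_add]
    · simp only [add_mul]
    · exact (hf.of fun x hx => by simp [hx]).summ
    · exact (hg.of fun x hx => by simp [hx]).summ
  have hneg : ∀ f h, B (fun x => - f x) h = - B f h := by
    intro f h; simp only [hB, ← tsum_neg, neg_mul]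
  have hnegF : FS (fun x => - ψ x) := hψF.of fun x hx => by simp [hx]
  have b1 : B (fun x => φ x + ψ x) (fun x => φ x + ψ x) = B φ φ + 2 * B ψ φ + B ψ ψ := by
    rw [hadd φ ψ _ hφ hψF, hBs φ _ hφ hs1, hBs ψ _ hψF hs1, hadd φ ψ _ hφ hψF, hadd φ ψ _ hφ hψF,
      hBs φ ψ hφ hψF]; ring
  have b2 : B (fun x => φ x - ψ x) (fun x => φ x - ψ x) = B φ φ - 2 * B ψ φ + B ψ ψ := by
    have hs2' : FS (fun x => φ x + -ψ x) := by simpa [sub_eq_add_neg] using hs2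
    simp only [sub_eq_add_neg]
    rw [hadd φ (fun x => - ψ x) _ hφ hnegF, hneg, hBs φ _ hφ hs2', hBs ψ _ hψF hs2',
      hadd φ _ _ hφ hnegF, hadd φ _ _ hφ hnegF, hneg, hneg, hBs φ ψ hφ hψF]; ring
  have q1 := hquad _ hs1
  have q2 := hquad _ hs2
  set N := ∑' x, (avg S φ x) ^ 2 with hN
  have hNs : FS (fun x => avg S φ x ^ 2) := (hφ.avg (S := S)).of fun x hx => by simp [hx]
  have e3 : B ψ φ = N / ρ := by
    rw [hN, ← tsum_div_const]
    refine tsum_congr fun x => ?_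
    simp only [hψ]; ring
  have e4 : ∑' x, ψ x ^ 2 = N / ρ ^ 2 := by
    rw [hN, ← tsum_div_const]
    refine tsum_congr fun x => ?_
    simp only [hψ]; ring
  have hφ2 : FS (fun x => φ x ^ 2) := hφ.of fun x hx => by simp [hx]
  have hψ2 : FS (fun x => ψ x ^ 2) := hψF.of fun x hx => by simp [hx]
  have e5 : ∑' x, (φ x + ψ x) ^ 2 + ∑' x, (φ x - ψ x) ^ 2 = 2 * ∑' x, φ x ^ 2 + 2 * (N / ρ ^ 2) := by
    rw [← e4, ← tsum_mul_left, ← tsum_mul_left, ← Summable.tsum_add, ← Summable.tsum_add]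
    · refine tsum_congr fun x => by ring
    · exact hφ2.summ.mul_left _
    · exact hψ2.summ.mul_left _
    · exact (hs1.of fun x hx => by simp [hx]).summ
    · exact (hs2.of fun x hx => by simp [hx]).summ
  have q3 := (abs_le.1 q1).2
  have q4 := (abs_le.1 q2).1
  rw [b1] at q3
  rw [b2] at q4
  have q5 : 4 * (N / ρ) ≤ ρ * (2 * ∑' x, φ x ^ 2 + 2 * (N / ρ ^ 2)) := by
    rw [← e5, ← e3]; linarith
  have q6 := mul_le_mul_of_nonneg_left q5 hρ0.le
  have r1 : ρ * (4 * (N / ρ)) = 4 * N := by field_simp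
  have r2 : ρ * (ρ * (2 * ∑' x, φ x ^ 2 + 2 * (N / ρ ^ 2))) = 2 * (ρ ^ 2 * ∑' x, φ x ^ 2) + 2 * N := by
    field_simp
  rw [r1, r2] at q6
  linarith
end Spec
end PaperPM

open scoped Classical
open MeasureTheory
namespace PaperPM
section Spec2
variable {Γ : Type*} [Group Γ] {S : Finset Γ} {X : Type*} [MeasurableSpace X] [MulAction Γ X]
  {μ : Measure X} [IsProbabilityMeasure μ]
set_option linter.unusedSectionVars false

def BM (f : X → ℝ) : Prop := Measurable f ∧ ∃ C, ∀ x, |f x| ≤ C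

lemma BM.int {f : X → ℝ} (h : BM f) : Integrable f μ := by
  obtain ⟨h1, C, h2⟩ := h
  exact Integrable.of_bound h1.aestronglyMeasurable C (Filter.Eventually.of_forall h2)

lemma BM.mul {f g : X → ℝ} (h : BM f) (h' : BM g) : BM (fun x => f x * g x) := by
  obtain ⟨h1, C, h2⟩ := h
  obtain ⟨h1', C', h2'⟩ := h'
  refine ⟨h1.mul h1', C * C', fun x => ?_⟩
  rw [abs_mul]
  exact mul_le_mul (h2 x) (h2' x) (abs_nonneg _) ((abs_nonneg _).trans (h2 x))

lemma BM.sub {f g : X → ℝ} (h : BM f) (h' : BM g) : BM (fun x => f x - g x) := by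
  obtain ⟨h1, C, h2⟩ := h
  obtain ⟨h1', C', h2'⟩ := h'
  exact ⟨h1.sub h1', C + C', fun x => (abs_sub _ _).trans (add_le_add (h2 x) (h2' x))⟩

lemma BM.const (c : ℝ) : BM (fun _ : X => c) := ⟨measurable_const, |c|, fun _ => le_rfl⟩

lemma BM.ind {D : Set X} (hD : MeasurableSet D) : BM (D.indicator fun _ => (1:ℝ)) := by
  refine ⟨measurable_const.indicator hD, 1, fun x => ?_⟩
  by_cases h : x ∈ D <;> simp [h]

lemma BM.sm (hm : ∀ g : Γ, MeasurePreserving (fun x : X => g • x) μ μ) {f : X → ℝ} (h : BM f)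
    (g : Γ) : BM (fun x => f (g • x)) :=
  ⟨h.1.comp (hm g).measurable, h.2.imp fun _ hc x => hc _⟩

lemma int_sm (hm : ∀ g : Γ, MeasurePreserving (fun x : X => g • x) μ μ) {f : X → ℝ} (h : BM f)
    (g : Γ) : ∫ x, f (g • x) ∂μ = ∫ x, f x ∂μ := by
  have := integral_map (μ := μ) (hm g).measurable.aemeasurable (f := f)
    h.1.aestronglyMeasurable
  rw [(hm g).map_eq] at this
  exact this.symm

noncomputable def Mop (S : Finset Γ) (f : X → ℝ) : X → ℝ := fun x => (∑ s ∈ S, f (s • x)) / S.card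

lemma BM.Mop (hm : ∀ g : Γ, MeasurePreserving (fun x : X => g • x) μ μ) {f : X → ℝ} (h : BM f) :
    BM (Mop S f) := by
  refine ⟨(Finset.measurable_fun_sum _ fun s _ => (h.sm hm s).1).div_const _, ?_⟩
  obtain ⟨C, hC⟩ := h.2
  refine ⟨(∑ s ∈ S, C) / S.card, fun x => ?_⟩
  rw [PaperPM.Mop, abs_div, Nat.abs_cast]
  gcongr
  exact (Finset.abs_sum_le_sum_abs _ _).trans (Finset.sum_le_sum fun s _ => hC _)

lemma cs {f g : X → ℝ} (hf : BM f) (hg : BM g) :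
    (∫ x, f x * g x ∂μ) ^ 2 ≤ (∫ x, f x * f x ∂μ) * ∫ x, g x * g x ∂μ := by
  have : ∀ t : ℝ, 0 ≤ (∫ x, g x * g x ∂μ) * (t * t) + (-2 * ∫ x, f x * g x ∂μ) * t
      + ∫ x, f x * f x ∂μ := by
    intro t
    have h : 0 ≤ ∫ x, (f x - t * g x) * (f x - t * g x) ∂μ := integral_nonneg fun x => mul_self_nonneg _
    have e : ∀ x, (f x - t * g x) * (f x - t * g x)
      = f x * f x - (2 * t) * (f x * g x) + (t * t) * (g x * g x) := fun x => by ring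
    simp_rw [e] at h
    rw [integral_add, integral_sub, integral_const_mul, integral_const_mul] at h
    · linarith
    · exact (hf.mul hf).int
    · exact (hf.mul hg).int.const_mul _
    · exact (hf.mul hf).int.sub ((hf.mul hg).int.const_mul _)
    · exact (hg.mul hg).int.const_mul _
  have := discrim_le_zero this
  rw [discrim] at this
  nlinarith

lemma Mop_int (hm : ∀ g : Γ, MeasurePreserving (fun x : X => g • x) μ μ) {f h : X → ℝ}
    (hf : BM f) (hh : BM h) :
    ∫ x, f x * Mop S h x ∂μ = (∑ s ∈ S, ∫ x, f x * h (s • x) ∂μ) / S.card := by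
  rw [← integral_finsetSum _ (fun s _ => (hf.mul (hh.sm hm s)).int), ← integral_div]
  simp only [Mop, ← mul_div_assoc, Finset.mul_sum]

lemma Mop_symm (hm : ∀ g : Γ, MeasurePreserving (fun x : X => g • x) μ μ) (hS : ∀ s ∈ S, s⁻¹ ∈ S)
    {f h : X → ℝ} (hf : BM f) (hh : BM h) :
    ∫ x, f x * Mop S h x ∂μ = ∫ x, Mop S f x * h x ∂μ := by
  have : ∀ x, Mop S f x * h x = h x * Mop S f x := fun x => mul_comm _ _
  simp_rw [this]
  rw [Mop_int hm hf hh, Mop_int hm hh hf]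
  congr 1
  refine Finset.sum_bij (fun s _ => s⁻¹) (fun s hs => hS s hs) (fun a _ b _ h => inv_injective h)
      (fun b hb => ⟨b⁻¹, hS b hb, by simp⟩) fun s _ => ?_
  rw [← int_sm hm (f := fun x => h x * f (s⁻¹ • x)) (hh.mul (hf.sm hm _)) s]
  simp only [inv_smul_smul, mul_comm]

lemma logconv {a : ℕ → ℝ} {ρ C : ℝ} (hρ : 0 < ρ) (h0 : ∀ n, 0 ≤ a n)
    (hl : ∀ n, a (n + 1) ^ 2 ≤ a n * a (n + 2)) (hb : ∀ n, a n ≤ C * ρ ^ n) : a 1 ≤ ρ * a 0 := by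
  by_contra hc
  push Not at hc
  have ha1 : 0 < a 1 := lt_of_le_of_lt (mul_nonneg hρ.le (h0 0)) hc
  have hpos : ∀ n, 0 < a n ∧ 0 < a (n + 1) := by
    intro n
    induction n with
    | zero =>
      refine ⟨lt_of_le_of_ne (h0 0) fun h => ?_, ha1⟩
      have := hl 0
      rw [← h] at this
      simp at this; nlinarith
    | succ n ih =>
      refine ⟨ih.2, lt_of_le_of_ne (h0 _) fun h => ?_⟩
      have := hl n
      rw [show n + 1 + 1 = n + 2 by ring] at h
      rw [← h] at this
      nlinarith [ih.2]
  set q := a 1 / a 0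
  have hq : ρ < q := by rw [lt_div_iff₀ (hpos 0).1]; exact hc
  have hqp : 0 < q := hρ.trans hq
  have hr : ∀ n, q * a n ≤ a (n + 1) := by
    intro n
    induction n with
    | zero => simp only [q]; rw [div_mul_cancel₀ _ (hpos 0).1.ne']
    | succ n ih =>
      have h1 := hl n
      have h2 : q * a n * a (n + 1) ≤ a n * a (n + 2) := by nlinarith [(hpos n).2]
      have := (hpos n).1
      nlinarith
  have hg : ∀ n, a 0 * q ^ n ≤ a n := by
    intro n
    induction n with
    | zero => simp
    | succ n ih => rw [pow_succ]; nlinarith [hr n]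
  have hbd : ∀ n : ℕ, (q / ρ) ^ n ≤ C / a 0 := by
    intro n
    rw [div_pow, div_le_div_iff₀ (by positivity) (hpos 0).1]
    nlinarith [hg n, hb n]
  obtain ⟨n, hn⟩ := pow_unbounded_of_one_lt (C / a 0) (show 1 < q / ρ by rwa [one_lt_div hρ])
  exact absurd (hbd n) (not_le.2 hn)

lemma Mop_gap (hm : ∀ g : Γ, MeasurePreserving (fun x : X => g • x) μ μ) (hS : ∀ s ∈ S, s⁻¹ ∈ S)
    {ρ : ℝ} (hρ0 : 0 < ρ) (hρ : ∀ φ : Γ → ℝ, FS φ → ∑' x, (avg S φ x) ^ 2 ≤ ρ ^ 2 * ∑' x, φ x ^ 2)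
    {f : X → ℝ} (hf : BM f) (hc : FS (fun g : Γ => ∫ x, f x * f (g • x) ∂μ)) :
    ∫ x, Mop S f x * Mop S f x ∂μ ≤ ρ ^ 2 * ∫ x, f x * f x ∂μ := by
  set F : ℕ → X → ℝ := fun n => (Mop S)^[n] f with hF
  have F0 : F 0 = f := rfl
  have Fs : ∀ n, F (n + 1) = Mop S (F n) := fun n => by simp only [hF, Function.iterate_succ_apply']
  have hFB : ∀ n, BM (F n) := by
    intro n
    induction n with
    | zero => exact hf
    | succ n ih => rw [Fs]; exact ih.Mop hm
  set c : Γ → ℝ := fun g : Γ => ∫ x, f x * f (g • x) ∂μ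
  set P : ℕ → Γ → ℝ := fun n => (avg S)^[n] c with hP
  have Ps : ∀ n, P (n + 1) = avg S (P n) := fun n => by simp only [hP, Function.iterate_succ_apply']
  have hPF : ∀ n, FS (P n) := by
    intro n
    induction n with
    | zero => exact hc
    | succ n ih => rw [Ps]; exact ih.avg
  have hPn : ∀ n, ∑' x, P n x ^ 2 ≤ (ρ ^ 2) ^ n * ∑' x, c x ^ 2 := by
    intro n
    induction n with
    | zero => simp [hP]
    | succ n ih =>
      rw [Ps]
      refine (hρ _ (hPF n)).trans ?_
      rw [pow_succ' (ρ ^ 2) n, mul_assoc (ρ ^ 2)]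
      exact mul_le_mul_of_nonneg_left ih (sq_nonneg _)
  have hPe : ∀ n g, ∫ x, f x * F n (g • x) ∂μ = P n g := by
    intro n
    induction n with
    | zero => intro g; rfl
    | succ n ih =>
      intro g
      rw [Ps, avg]
      simp_rw [Fs, Mop, ← ih, mul_smul]
      rw [← integral_finsetSum _ (fun s _ => ?_), ← integral_div]
      · simp only [← mul_div_assoc, Finset.mul_sum]
      · exact (hf.mul (((hFB n).sm hm s).sm hm g)).int
  have hshift : ∀ m n, ∫ x, F m x * F n x ∂μ = ∫ x, f x * F (m + n) x ∂μ := by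
    intro m
    induction m with
    | zero => intro n; simp [F0]
    | succ m ih =>
      intro n
      rw [show m + 1 + n = m + (n + 1) by ring, ← ih, Fs m, Fs n, ← Mop_symm hm hS (hFB m) (hFB n)]
  have key := logconv (a := fun n => ∫ x, F n x * F n x ∂μ) (ρ := ρ ^ 2)
    (C := Real.sqrt (∑' x, c x ^ 2)) (by positivity)
    (fun n => integral_nonneg fun x => mul_self_nonneg _) ?_ ?_
  · simpa [Fs, F0] using key
  · intro n
    have := cs (μ := μ) (hFB n) (hFB (n + 2))
    rwa [hshift n (n + 2), show n + (n + 2) = (n + 1) + (n + 1) by ring, ← hshift] at this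
  · intro n
    have e : ∫ x, F n x * F n x ∂μ = P (n + n) 1 := by
      rw [hshift, ← hPe]; simp
    simp only [e]
    have h1 : P (n + n) 1 ^ 2 ≤ (ρ ^ 2) ^ (n + n) * ∑' x, c x ^ 2 := by
      refine le_trans ?_ (hPn _)
      exact ((hPF (n+n)).of (g := fun x => P (n + n) x ^ 2) fun x hx => by simp [hx]).summ.le_tsum 1
        fun j _ => sq_nonneg _
    have h2 := Real.abs_le_sqrt h1
    refine (le_abs_self _).trans (h2.trans_eq ?_)
    rw [show (ρ ^ 2) ^ (n + n) = ((ρ ^ 2) ^ n) ^ 2 by ring, Real.sqrt_mul (sq_nonneg _),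
      Real.sqrt_sq (by positivity), mul_comm]

def Nb (S : Finset Γ) (D : Set X) : Set X := {x | ∃ s ∈ S, s • x ∈ D}

lemma Nb_meas (hm : ∀ g : Γ, MeasurePreserving (fun x : X => g • x) μ μ) {D : Set X}
    (hD : MeasurableSet D) : MeasurableSet (Nb S D) := by
  have : Nb S D = ⋃ s ∈ S, (fun x => s • x) ⁻¹' D := by ext; simp [Nb]
  rw [this]
  exact Finset.measurableSet_biUnion _ fun s _ => (hm s).measurable hD

lemma ind_int {D : Set X} (hD : MeasurableSet D) : ∫ x, D.indicator (fun _ => (1:ℝ)) x ∂μ = μ.real D := by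
  rw [integral_indicator hD]; simp

lemma ind_mul (C D : Set X) (x : X) : C.indicator (fun _ => (1:ℝ)) x * D.indicator (fun _ => (1:ℝ)) x
    = (C ∩ D).indicator (fun _ => (1:ℝ)) x := by
  by_cases h : x ∈ C <;> by_cases h' : x ∈ D <;> simp [h, h']

lemma real_diff_le {A B C D : Set X} (h : A ⊆ B ∪ (C ∪ D)) : μ.real A ≤ μ.real B + (μ.real C + μ.real D) :=
  (measureReal_mono h).trans ((measureReal_union_le _ _).trans (add_le_add le_rfl (measureReal_union_le _ _)))

theorem expn {c0 : ℝ} (hc0 : 0 < c0) (hS0 : S.Nonempty) (hS : ∀ s ∈ S, s⁻¹ ∈ S)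
    (hna : ∀ A : Finset Γ, A.Nonempty → c0 * A.card ≤ bd S A)
    (hm : ∀ g : Γ, MeasurePreserving (fun x : X => g • x) μ μ)
    (mix : ∀ D : Set X, MeasurableSet D → ∀ ε : ℝ, 0 < ε → ∃ C : Set X, MeasurableSet C ∧
      μ.real (D \ C) ≤ ε ∧ μ.real (C \ D) ≤ ε ∧
      {g : Γ | μ.real (C ∩ (fun x => g • x) ⁻¹' C) ≠ μ.real C ^ 2}.Finite) :
    ∃ κ : ℝ, 0 < κ ∧ κ < 1 ∧ ∀ D : Set X, MeasurableSet D →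
      μ.real D ≤ μ.real (Nb S D) * (μ.real D + κ * (1 - μ.real D)) := by
  obtain ⟨ρ, hρ0, hρ1, hρ⟩ := avg_norm hc0 hS0 hS hna
  have hd : (0:ℝ) < S.card := by simp [hS0.card_pos]
  refine ⟨ρ ^ 2, by positivity, by nlinarith, fun D hD => ?_⟩
  set Q : Set X → ℝ := fun D => ∑ s ∈ S, ∑ t ∈ S, μ.real ((fun x => s • x) ⁻¹' D ∩ (fun x => t • x) ⁻¹' D)
    with hQ
  have hMi : ∀ D : Set X, MeasurableSet D → ∫ x, Mop S (D.indicator fun _ => (1:ℝ)) x ∂μ = μ.real D := by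
    intro D hD
    have := Mop_int (S := S) hm (BM.const (X := X) 1) (BM.ind hD)
    simp only [one_mul] at this
    rw [this, Finset.sum_congr rfl fun s _ => int_sm hm (BM.ind hD) s]
    simp only [ind_int hD, Finset.sum_const, nsmul_eq_mul]
    field_simp
  have hMM : ∀ D : Set X, MeasurableSet D → ∫ x, Mop S (D.indicator fun _ => (1:ℝ)) x *
      Mop S (D.indicator fun _ => (1:ℝ)) x ∂μ = Q D / S.card ^ 2 := by
    intro D hD
    rw [Mop_int hm ((BM.ind hD).Mop hm) (BM.ind hD), sq, ← div_div, hQ]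
    congr 1
    rw [Finset.sum_div]
    refine Finset.sum_congr rfl fun s _ => ?_
    have : ∀ x, Mop S (D.indicator fun _ => (1:ℝ)) x * D.indicator (fun _ => (1:ℝ)) (s • x) =
      D.indicator (fun _ => (1:ℝ)) (s • x) * Mop S (D.indicator fun _ => (1:ℝ)) x := fun x => mul_comm _ _
    simp_rw [this]
    rw [Mop_int hm ((BM.ind hD).sm hm s) (BM.ind hD)]
    congr 1
    refine Finset.sum_congr rfl fun t _ => ?_
    rw [← ind_int (((hm s).measurable hD).inter ((hm t).measurable hD))]
    refine integral_congr_ae (Filter.Eventually.of_forall fun x => ?_)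
    simp only [← ind_mul]; rfl
  have hcyl : ∀ C : Set X, MeasurableSet C →
      {g : Γ | μ.real (C ∩ (fun x => g • x) ⁻¹' C) ≠ μ.real C ^ 2}.Finite →
      Q C / S.card ^ 2 ≤ μ.real C ^ 2 + ρ ^ 2 * (μ.real C - μ.real C ^ 2) := by
    intro C hC hfin
    set m := μ.real C with hmC
    set i : X → ℝ := C.indicator fun _ => (1:ℝ) with hi
    have hiB : BM i := BM.ind hC
    set f : X → ℝ := fun x => i x - m with hfd
    have hfB : BM f := hiB.sub (BM.const m)
    have hii : ∫ x, i x ∂μ = m := ind_int hC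
    have hcg : ∀ g : Γ, ∫ x, f x * f (g • x) ∂μ = μ.real (C ∩ (fun x => g • x) ⁻¹' C) - m ^ 2 := by
      intro g
      have e : ∀ x, f x * f (g • x) = i x * i (g • x) - m * i x - (m * i (g • x) - m ^ 2) := by
        intro x; simp only [hfd]; ring
      simp_rw [e]
      have k1 : ∫ x, i x * i (g • x) ∂μ = μ.real (C ∩ (fun x => g • x) ⁻¹' C) := by
        rw [← ind_int (hC.inter ((hm g).measurable hC))]
        refine integral_congr_ae (Filter.Eventually.of_forall fun x => ?_)
        simp only [← ind_mul]; rfl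
      have b1 := hiB.mul (hiB.sm hm g)
      have b2 := (BM.const (X := X) m).mul hiB
      have b3 := (BM.const (X := X) m).mul (hiB.sm hm g)
      rw [integral_sub (b1.sub b2).int (b3.sub (BM.const _)).int, integral_sub b1.int b2.int,
        integral_sub b3.int (BM.const _).int, integral_const_mul, integral_const_mul,
        int_sm hm hiB g, hii, k1]
      simp; ring
    have h := Mop_gap hm hS hρ0 hρ hfB (by
      refine hfin.subset fun g hg => ?_
      simp only [Function.mem_support, hcg] at hg
      exact fun h => hg (by rw [h]; ring))
    have h1 := hcg 1
    simp only [one_smul] at h1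
    rw [h1] at h
    have hMf : ∀ x, Mop S f x = Mop S i x - m := by
      intro x
      simp only [Mop, hfd, Finset.sum_sub_distrib, Finset.sum_const, nsmul_eq_mul]
      field_simp
    have hMB := hiB.Mop (S := S) hm
    have e : ∀ x, Mop S f x * Mop S f x = Mop S i x * Mop S i x - (2 * m * Mop S i x - m ^ 2) := by
      intro x; rw [hMf]; ring
    have b3 := (BM.const (X := X) (2 * m)).mul hMB
    simp_rw [e] at h
    rw [integral_sub (hMB.mul hMB).int (b3.sub (BM.const _)).int, integral_sub b3.int (BM.const _).int,
      integral_const_mul, hMi C hC, hMM C hC] at h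
    simp only [Set.preimage_id', Set.inter_self] at h
    simp at h
    nlinarith
  have happ : Q D / S.card ^ 2 ≤ μ.real D ^ 2 + ρ ^ 2 * (μ.real D - μ.real D ^ 2) := by
    refine le_of_forall_pos_le_add fun ε hε => ?_
    obtain ⟨C, hC, h1, h2, h3⟩ := mix D hD (ε / 10) (by positivity)
    have h4 := hcyl C hC h3
    set δ := ε / 10
    have q1 : Q D ≤ Q C + S.card ^ 2 * (2 * δ) := by
      have : Q C + S.card ^ 2 * (2 * δ) = ∑ s ∈ S, ∑ t ∈ S,
          (μ.real ((fun x => s • x) ⁻¹' C ∩ (fun x => t • x) ⁻¹' C) + (δ + δ)) := by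
        simp only [hQ, Finset.sum_add_distrib, Finset.sum_const, nsmul_eq_mul]; ring
      rw [this]
      refine Finset.sum_le_sum fun s _ => Finset.sum_le_sum fun t _ => ?_
      have hp : ∀ s : Γ, μ.real ((fun x => s • x) ⁻¹' (D \ C)) ≤ δ := by
        intro s
        rw [(hm s).measureReal_preimage (hD.diff hC).nullMeasurableSet]; exact h1
      refine (real_diff_le (C := (fun x => s • x) ⁻¹' (D \ C)) (D := (fun x => t • x) ⁻¹' (D \ C))
        ?_).trans (add_le_add le_rfl (add_le_add (hp s) (hp t)))
      rintro x ⟨hx1, hx2⟩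
      simp only [Set.mem_union, Set.mem_inter_iff, Set.mem_preimage, Set.mem_diff] at *
      tauto
    have q2 : μ.real C ≤ μ.real D + δ := (measureReal_mono (show C ⊆ D ∪ (C \ D) by simp)).trans
      ((measureReal_union_le _ _).trans (add_le_add le_rfl h2))
    have q3 : μ.real D ≤ μ.real C + δ := (measureReal_mono (show D ⊆ C ∪ (D \ C) by simp)).trans
      ((measureReal_union_le _ _).trans (add_le_add le_rfl h1))
    have q4 : Q D / S.card ^ 2 ≤ Q C / S.card ^ 2 + 2 * δ := by
      rw [div_add' _ _ _ (by positivity)]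
      gcongr
      linarith
    have c1 : μ.real C ≤ 1 := measureReal_le_one
    have c2 : μ.real D ≤ 1 := measureReal_le_one
    have c3 : 0 ≤ μ.real C := measureReal_nonneg
    have c4 : 0 ≤ μ.real D := measureReal_nonneg
    have hρ2 : ρ ^ 2 ≤ 1 := by nlinarith
    have hδ : δ * 10 = ε := by simp only [δ]; ring
    have d1 : (1 - ρ ^ 2) * μ.real C ^ 2 ≤ (1 - ρ ^ 2) * μ.real D ^ 2 + 2 * δ := by
      have : μ.real C ^ 2 ≤ μ.real D ^ 2 + 2 * δ := by nlinarith
      nlinarith [mul_le_mul_of_nonneg_left this (by linarith : 0 ≤ 1 - ρ ^ 2), sq_nonneg ρ]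
    nlinarith
  have hN := Nb_meas (S := S) hm hD
  have hcs := cs (μ := μ) ((BM.ind hD).Mop (S := S) hm) (BM.ind hN)
  have e1 : ∀ x, Mop S (D.indicator fun _ => (1:ℝ)) x * (Nb S D).indicator (fun _ => (1:ℝ)) x
      = Mop S (D.indicator fun _ => (1:ℝ)) x := by
    intro x
    by_cases hx : x ∈ Nb S D
    · simp [hx]
    · have : Mop S (D.indicator fun _ => (1:ℝ)) x = 0 := by
        rw [Mop, Finset.sum_eq_zero, zero_div]
        intro s hs
        rw [Set.indicator_of_notMem]
        exact fun h => hx ⟨s, hs, h⟩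
      simp [this]
  simp_rw [e1, ind_mul, Set.inter_self] at hcs
  rw [hMi D hD, hMM D hD, ind_int hN] at hcs
  have hD0 : 0 ≤ μ.real D := measureReal_nonneg
  have hN0 : 0 ≤ μ.real (Nb S D) := measureReal_nonneg
  rcases hD0.eq_or_lt with h | h
  · rw [← h]; simp; positivity
  · have : μ.real D ^ 2 ≤ (μ.real D ^ 2 + ρ ^ 2 * (μ.real D - μ.real D ^ 2)) * μ.real (Nb S D) :=
      hcs.trans (mul_le_mul_of_nonneg_right happ hN0)
    have e : (μ.real D ^ 2 + ρ ^ 2 * (μ.real D - μ.real D ^ 2)) * μ.real (Nb S D)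
      = μ.real D * (μ.real (Nb S D) * (μ.real D + ρ ^ 2 * (1 - μ.real D))) := by ring
    rw [e, sq] at this
    exact le_of_mul_le_mul_left this h
end Spec2
end PaperPM

open scoped Classical
open MeasureTheory
namespace PaperPM
section Dyn
variable {Γ : Type*} [Group Γ] {X : Type*} [MeasurableSpace X] [MulAction Γ X]
set_option linter.unusedSectionVars false

structure Bse (S : Finset Γ) (μ : Measure X) (c κ : ℝ) : Prop where
  sym : ∀ s ∈ S, s⁻¹ ∈ S
  ne : S.Nonempty
  mp : ∀ g : Γ, MeasurePreserving (fun x : X => g • x) μ μ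
  free : ∀ (g : Γ) (x : X), g • x = x → g = 1
  c0 : 0 < c
  iso : ∀ A : Finset Γ, A.Nonempty → (S.card : ℝ) + c * (A.card - 1) ≤ bd S A
  k0 : 0 < κ
  k1 : κ < 1
  exp : ∀ D : Set X, MeasurableSet D →
      μ.real D ≤ μ.real (Nb S D) * (μ.real D + κ * (1 - μ.real D))

variable {S : Finset Γ} {μ : Measure X} [IsProbabilityMeasure μ] {c κ : ℝ}

/-- edge measure -/
noncomputable def em (S : Finset Γ) (μ : Measure X) (P Q : Set X) : ℝ :=
  ∑ s ∈ S, μ.real (P ∩ (fun x => s • x) ⁻¹' Q)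

namespace Bse
variable (B : Bse S μ c κ)
include B

lemma em_symm {P Q : Set X} (hP : MeasurableSet P) (hQ : MeasurableSet Q) :
    em S μ P Q = em S μ Q P := by
  refine Finset.sum_bij (fun s _ => s⁻¹) (fun s hs => B.sym s hs) (fun a _ b _ h => inv_injective h)
      (fun b hb => ⟨b⁻¹, B.sym b hb, by simp⟩) fun s _ => ?_
  rw [← (B.mp s).measureReal_preimage (hQ.inter ((B.mp s⁻¹).measurable hP)).nullMeasurableSet]
  congr 1
  ext x; simp [and_comm]

omit B [IsProbabilityMeasure μ] in
lemma em_nonneg (P Q : Set X) : 0 ≤ em S μ P Q := Finset.sum_nonneg fun _ _ => measureReal_nonneg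

lemma em_add {P Q R : Set X} (hP : MeasurableSet P) (hR : MeasurableSet R) (h : Disjoint Q R) :
    em S μ P (Q ∪ R) = em S μ P Q + em S μ P R := by
  rw [em, em, em, ← Finset.sum_add_distrib]
  refine Finset.sum_congr rfl fun s _ => ?_
  rw [Set.preimage_union, Set.inter_union_distrib_left, measureReal_union]
  · exact (h.preimage _).mono Set.inter_subset_right Set.inter_subset_right
  · exact hP.inter ((B.mp s).measurable hR)

omit B [IsProbabilityMeasure μ] in
lemma em_univ (P : Set X) : em S μ P Set.univ = S.card * μ.real P := by
  simp [em]

/-- vertices of `P` having a neighbour in `Q` -/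
lemma em_ge {P Q : Set X} : μ.real (P ∩ Nb S Q) ≤ em S μ P Q := by
  have : P ∩ Nb S Q = ⋃ s ∈ S, P ∩ (fun x => s • x) ⁻¹' Q := by
    ext x; simp [Nb]
  rw [this]
  exact measureReal_biUnion_finset_le _ _

lemma mtp {F : Set X} (hF : MeasurableSet F) {β : X → Γ} (hβ : ∀ γ, MeasurableSet {x | β x = γ})
    {Bf : Finset Γ} (hB : ∀ x ∈ F, β x ∈ Bf) :
    (∀ b, MeasurableSet {y | b⁻¹ • y ∈ F ∧ β (b⁻¹ • y) = b}) ∧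
    ∑ b ∈ Bf, μ.real {y | b⁻¹ • y ∈ F ∧ β (b⁻¹ • y) = b} = μ.real F := by
  have hme : ∀ b, MeasurableSet (F ∩ {x | β x = b}) := fun b => hF.inter (hβ b)
  have h1 : ∀ b, {y | b⁻¹ • y ∈ F ∧ β (b⁻¹ • y) = b} = (fun x => b⁻¹ • x) ⁻¹' (F ∩ {x | β x = b}) := by
    intro b; rfl
  refine ⟨fun b => by rw [h1]; exact (B.mp _).measurable (hme b), ?_⟩
  have h2 : F = ⋃ b ∈ Bf, F ∩ {x | β x = b} := by
    ext x; simp only [Set.mem_iUnion, Set.mem_inter_iff]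
    exact ⟨fun h => ⟨β x, hB x h, h, rfl⟩, fun ⟨_, _, h, _⟩ => h⟩
  conv_rhs => rw [h2]
  rw [measureReal_biUnion_finset]
  · refine Finset.sum_congr rfl fun b _ => ?_
    rw [h1, (B.mp _).measureReal_preimage (hme b).nullMeasurableSet]
  · intro b _ b' _ hbb
    rw [Function.onFun, Set.disjoint_left]
    rintro x ⟨_, hx⟩ ⟨_, hx'⟩
    exact hbb (hx.symm.trans hx')
  · exact fun b _ => hme b

lemma cell_ineq {E Yq : Set X} (hE : MeasurableSet E) (hY : MeasurableSet Yq) (hsub : Yq ⊆ E)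
    {β : X → Γ} (hβ : ∀ γ, MeasurableSet {x | β x = γ}) {Bf : Finset Γ} (hB : ∀ x ∈ E, β x ∈ Bf)
    (hbase : ∀ x ∈ E, β x • x ∈ Yq) (h1 : ∀ y ∈ Yq, β y = 1) :
    S.card * μ.real Yq + c * (μ.real E - μ.real Yq) ≤
      ∑ s ∈ S, μ.real {x | x ∈ E ∧ ¬ (s • x ∈ E ∧ β (s • x) * s = β x)} := by
  set Fs : Γ → Set X := fun s => {x | x ∈ E ∧ ¬ (s • x ∈ E ∧ β (s • x) * s = β x)} with hFs
  have hFm : ∀ s, MeasurableSet (Fs s) := by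
    intro s
    have : Fs s = E \ ⋃ b ∈ Bf, ({x | β x = b} ∩ (fun x => s • x) ⁻¹' (E ∩ {x | β x = b * s⁻¹})) := by
      ext x
      simp only [hFs, Set.mem_setOf_eq, Set.mem_diff, Set.mem_iUnion, Set.mem_inter_iff,
        Set.mem_preimage, exists_prop]
      refine and_congr_right fun hx => not_congr ⟨fun ⟨h, h'⟩ => ⟨β x, hB x hx, rfl, h, ?_⟩, ?_⟩
      · rw [← h']; group
      · rintro ⟨b, _, h2, h3, h4⟩
        exact ⟨h3, by rw [h2, h4]; group⟩
    rw [this]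
    exact hE.diff (Finset.measurableSet_biUnion _ fun b _ => (hβ b).inter
      ((B.mp s).measurable (hE.inter (hβ _))))
  set G : Set X → Γ → Set X := fun F b => {y | b⁻¹ • y ∈ F ∧ β (b⁻¹ • y) = b} with hG
  have key : ∀ F : Set X, MeasurableSet F → F ⊆ E →
      Integrable (fun y => ∑ b ∈ Bf, (G F b).indicator (fun _ => (1:ℝ)) y) μ ∧
      ∫ y, ∑ b ∈ Bf, (G F b).indicator (fun _ => (1:ℝ)) y ∂μ = μ.real F := by
    intro F hF hFE
    obtain ⟨m1, m2⟩ := B.mtp hF hβ (fun x hx => hB x (hFE hx))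
    refine ⟨integrable_finsetSum _ fun b _ => (BM.ind (m1 b)).int, ?_⟩
    rw [integral_finsetSum _ fun b _ => (BM.ind (m1 b)).int, ← m2]
    exact Finset.sum_congr rfl fun b _ => ind_int (m1 b)
  have kE := key E hE le_rfl
  have kF := fun s => key (Fs s) (hFm s) (fun x hx => hx.1)
  have iY := (BM.ind hY).int (μ := μ)
  have pw : ∀ y, S.card * Yq.indicator (fun _ => (1:ℝ)) y + c * (∑ b ∈ Bf, (G E b).indicator (fun _ => (1:ℝ)) y
      - Yq.indicator (fun _ => (1:ℝ)) y) ≤ ∑ s ∈ S, ∑ b ∈ Bf, (G (Fs s) b).indicator (fun _ => (1:ℝ)) y := by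
    intro y
    have hr0 : 0 ≤ ∑ s ∈ S, ∑ b ∈ Bf, (G (Fs s) b).indicator (fun _ => (1:ℝ)) y :=
      Finset.sum_nonneg fun s _ => Finset.sum_nonneg fun b _ => Set.indicator_nonneg (fun _ _ => zero_le_one) _
    by_cases hy : y ∈ Yq
    · set Cf := Bf.filter (fun b => y ∈ G E b) with hCf
      have e1 : ∑ b ∈ Bf, (G E b).indicator (fun _ => (1:ℝ)) y = Cf.card := by
        simp only [Set.indicator_apply]; rw [Finset.sum_boole, hCf]
      have hmem : (1 : Γ) ∈ Cf := by
        simp only [hCf, Finset.mem_filter, hG, Set.mem_setOf_eq, inv_one, one_smul]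
        exact ⟨h1 y hy ▸ hB y (hsub hy), hsub hy, h1 y hy⟩
      set C := Cf.image (·⁻¹) with hC
      have hCc : C.card = Cf.card := Finset.card_image_of_injective _ inv_injective
      have hiso := B.iso C ⟨1, by rw [hC, Finset.mem_image]; exact ⟨1, hmem, inv_one⟩⟩
      have hmC : ∀ a, a ∈ C ↔ (a • y ∈ E ∧ β (a • y) = a⁻¹) := by
        intro a
        simp only [hC, hCf, Finset.mem_image, Finset.mem_filter, hG, Set.mem_setOf_eq]
        constructor
        · rintro ⟨b, ⟨_, h2, h3⟩, rfl⟩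
          exact ⟨h2, by rw [h3, inv_inv]⟩
        · rintro ⟨h2, h3⟩
          refine ⟨a⁻¹, ⟨h3 ▸ hB _ h2, ?_, ?_⟩, inv_inv a⟩ <;> rw [inv_inv] <;> assumption
      have e2 : (bd S C : ℝ) = ∑ s ∈ S, ∑ b ∈ Bf, (G (Fs s) b).indicator (fun _ => (1:ℝ)) y := by
        rw [bd, Finset.sum_comm]
        push_cast
        refine Finset.sum_congr rfl fun s hs => ?_
        rw [hC, Finset.sum_image inv_injective.injOn, hCf, Finset.sum_filter]
        refine Finset.sum_congr rfl fun b _ => ?_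
        rw [← hCf, ← hC]
        simp only [Set.indicator_apply]
        by_cases hb : y ∈ G E b
        · rw [if_pos hb]
          have hb2 : β (b⁻¹ • y) = b := hb.2
          have hx : y ∈ G (Fs s) b ↔ ¬ (s * b⁻¹ ∈ C) := by
            rw [hmC]
            simp only [hG, hFs, Set.mem_setOf_eq, hb.1, hb2, true_and, and_true, mul_smul]
            refine not_congr (and_congr_right fun _ => ?_)
            rw [mul_inv_rev, inv_inv, ← eq_mul_inv_iff_mul_eq]
          by_cases h : s * b⁻¹ ∈ C <;> simp [hx, h]
        · rw [if_neg hb, if_neg]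
          exact fun h => hb ⟨h.1.1, h.2⟩
      rw [e1, ← e2, Set.indicator_of_mem hy, ← hCc, mul_one]
      exact hiso
    · have hz : ∑ b ∈ Bf, (G E b).indicator (fun _ => (1:ℝ)) y = 0 := by
        refine Finset.sum_eq_zero fun b _ => Set.indicator_of_notMem (fun h => hy ?_) _
        have := hbase _ h.1
        rwa [h.2, smul_inv_smul] at this
      rw [hz, Set.indicator_of_notMem hy]
      simpa using hr0
  have iA : Integrable (fun y => (S.card : ℝ) * Yq.indicator (fun _ => (1:ℝ)) y) μ := iY.const_mul _
  have iB : Integrable (fun y => ∑ b ∈ Bf, (G E b).indicator (fun _ => (1:ℝ)) y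
      - Yq.indicator (fun _ => (1:ℝ)) y) μ := kE.1.sub iY
  have := integral_mono (iA.add (iB.const_mul c)) (integrable_finsetSum _ fun s _ => (kF s).1) pw
  rw [integral_add' iA (iB.const_mul c), integral_const_mul, integral_const_mul,
    integral_finsetSum _ fun s _ => (kF s).1, integral_sub kE.1 iY, kE.2, ind_int hY,
    Finset.sum_congr rfl fun s _ => (kF s).2] at this
  exact this

lemma exp' {D : Set X} (hD : MeasurableSet D) :
    (1 - κ) * (1 - μ.real D) * μ.real D ≤ μ.real (Nb S D) - μ.real D := by
  have h := B.exp D hD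
  have h0 : 0 ≤ μ.real D := measureReal_nonneg
  have h1 : μ.real D ≤ 1 := measureReal_le_one
  have h2 : 0 ≤ μ.real (Nb S D) := measureReal_nonneg
  have k0 := B.k0
  have k1 := B.k1
  set D' := μ.real D
  set N := μ.real (Nb S D)
  set u := (1 - κ) * (1 - D') with hu
  have hu0 : 0 ≤ u := by have : 0 ≤ 1 - κ := by linarith
                         have : 0 ≤ 1 - D' := by linarith
                         positivity
  have hu1 : u ≤ 1 := by nlinarith
  have h' : D' ≤ N * (1 - u) := by
    have : 1 - u = D' + κ * (1 - D') := by rw [hu]; ring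
    rwa [this]
  have : D' * (1 + u) ≤ N * (1 - u) * (1 + u) := by nlinarith
  nlinarith [mul_nonneg h2 (sq_nonneg u)]

lemma lower (c' : ℝ) (hc' : 0 < c') : ∃ η : ℝ, 0 < η ∧ ∀ A Yq Z O : Set X, MeasurableSet A →
    MeasurableSet O → μ.real A = μ.real Yq + μ.real Z + μ.real O → μ.real O ≤ μ.real Yq →
    η * μ.real A ≤ S.card * (μ.real Yq - μ.real O) + c' * μ.real Z + em S μ O O + em S μ A Aᶜ := by
  have k0 := B.k0
  have k1 := B.k1
  have hd : (1:ℝ) ≤ S.card := by exact_mod_cast B.ne.card_pos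
  set θ : ℝ := (1 - κ) / 20 with hθ
  have hθ0 : 0 < θ := by rw [hθ]; linarith
  set η := min (min ((1 - κ) * θ) (c' * θ)) (min θ ((1 - κ) / 10))
  have hη : 0 < η := by
    refine lt_min (lt_min (mul_pos (by linarith) hθ0) (by positivity)) (lt_min hθ0 (by linarith))
  have l1 : η ≤ (1 - κ) * θ := (min_le_left _ _).trans (min_le_left _ _)
  have l2 : η ≤ c' * θ := (min_le_left _ _).trans (min_le_right _ _)
  have l3 : η ≤ θ := (min_le_right _ _).trans (min_le_left _ _)
  have l4 : η ≤ (1 - κ) / 10 := (min_le_right _ _).trans (min_le_right _ _)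
  refine ⟨η, hη, fun A Yq Z O hA hO hsum hOY => ?_⟩
  have a1 : μ.real A ≤ 1 := measureReal_le_one
  have a0 : 0 ≤ μ.real A := measureReal_nonneg
  have z0 : 0 ≤ μ.real Z := measureReal_nonneg
  have o0 : 0 ≤ μ.real O := measureReal_nonneg
  have e0 : 0 ≤ em S μ O O := em_nonneg _ _
  have e1 : 0 ≤ em S μ A Aᶜ := em_nonneg _ _
  have t1 : 0 ≤ S.card * (μ.real Yq - μ.real O) := mul_nonneg (by linarith) (by linarith)
  have t2 : 0 ≤ c' * μ.real Z := by positivity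
  by_cases g1 : θ ≤ 1 - μ.real A
  · have : (1 - κ) * (1 - μ.real A) * μ.real A ≤ em S μ A Aᶜ := by
      rw [B.em_symm hA hA.compl]
      refine le_trans ?_ B.em_ge
      refine (B.exp' hA).trans ?_
      have : μ.real (Nb S A) ≤ μ.real A + μ.real (Aᶜ ∩ Nb S A) :=
        (measureReal_mono (fun x hx => by by_cases h : x ∈ A <;> simp [h, hx])).trans
          (measureReal_union_le _ _)
      linarith
    have h2 : η * μ.real A ≤ (1 - κ) * (1 - μ.real A) * μ.real A := by
      apply mul_le_mul_of_nonneg_right _ a0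
      nlinarith
    linarith
  by_cases g2 : θ ≤ μ.real Z
  · have : η * μ.real A ≤ c' * μ.real Z := by nlinarith
    linarith
  by_cases g3 : θ ≤ μ.real Yq - μ.real O
  · have : η * μ.real A ≤ S.card * (μ.real Yq - μ.real O) := by nlinarith
    linarith
  push Not at g1 g2 g3
  have ho1 : μ.real O ≤ 1 / 2 := by linarith
  have ho2 : 1 / 2 - 3 / 2 * θ ≤ μ.real O := by linarith
  have hN := B.exp O hO
  have hN2 : μ.real (Nb S O) ≤ em S μ O O + (1 - μ.real O) := by
    rw [← probReal_compl_eq_one_sub hO]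
    refine le_trans ?_ (add_le_add_left B.em_ge _)
    exact (measureReal_mono (fun x hx => by by_cases h : x ∈ O <;> simp [h, hx])).trans
          (measureReal_union_le _ _)
  have h5 : μ.real O + κ * (1 - μ.real O) ≤ (1 + κ) / 2 := by nlinarith
  have h6 : μ.real O ≤ (em S μ O O + (1 - μ.real O)) * ((1 + κ) / 2) := by
    refine hN.trans (mul_le_mul hN2 h5 (by nlinarith) (by linarith))
  have h7 : (1 - κ) / 10 ≤ em S μ O O := by
    by_contra hc
    push Not at hc
    nlinarith
  nlinarith
end Bse
end Dyn
end PaperPM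

open scoped Classical Pointwise
open MeasureTheory
namespace PaperPM
section Dyn2
variable {Γ : Type*} [Group Γ] [Countable Γ] {X : Type*} [MeasurableSpace X] [MulAction Γ X]
set_option linter.unusedSectionVars false

def CM {ι : Type*} (f : X → ι) : Prop := ∀ i, MeasurableSet {x | f x = i}

lemma CM.mem {ι : Type*} [Countable ι] {f : X → ι} (hf : CM f) {G : ι → Set X}
    (hG : ∀ i, MeasurableSet (G i)) : MeasurableSet {x | x ∈ G (f x)} := by
  have : {x | x ∈ G (f x)} = ⋃ i, {x | f x = i} ∩ G i := by
    ext x; simp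
  rw [this]
  exact MeasurableSet.iUnion fun i => (hf i).inter (hG i)

lemma CM.bind {ι κ : Type*} [Countable ι] {f : X → ι} (hf : CM f) {g : ι → X → κ}
    (hg : ∀ i, CM (g i)) : CM (fun x => g (f x) x) :=
  fun k => hf.mem (G := fun i => {x | g i x = k}) fun i => hg i k

lemma msel {ι : Type*} [Countable ι] [Nonempty ι] (G : ι → Set X) (hG : ∀ i, MeasurableSet (G i)) :
    ∃ f : X → ι, CM f ∧ ∀ x, (∃ i, x ∈ G i) → x ∈ G (f x) := by
  obtain ⟨e, he⟩ := exists_injective_nat ι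
  let i0 : ι := Classical.arbitrary ι
  have hP : ∀ x, (∃ i, x ∈ G i) → ∃ n, ∃ i, e i = n ∧ x ∈ G i := fun x ⟨i, hi⟩ => ⟨e i, i, rfl, hi⟩
  let f : X → ι := fun x => if h : ∃ i, x ∈ G i then (Nat.find_spec (hP x h)).choose else i0
  have hf : ∀ x (h : ∃ i, x ∈ G i), e (f x) = Nat.find (hP x h) ∧ x ∈ G (f x) := by
    intro x h
    simp only [f, dif_pos h]
    exact (Nat.find_spec (hP x h)).choose_spec
  refine ⟨f, fun i => ?_, fun x h => (hf x h).2⟩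
  have : {x | f x = i} = (G i ∩ ⋂ j ∈ {j | e j < e i}, (G j)ᶜ) ∪
      (if i = i0 then (⋂ j, (G j)ᶜ) else ∅) := by
    ext x
    by_cases h : ∃ i, x ∈ G i
    · obtain ⟨h1, h2⟩ := hf x h
      have hno : x ∉ (if i = i0 then (⋂ j, (G j)ᶜ) else ∅) := by
        split_ifs
        · simpa using h
        · simp
      simp only [Set.mem_setOf_eq, Set.mem_union, hno, or_false, Set.mem_inter_iff, Set.mem_iInter,
        Set.mem_compl_iff]
      constructor
      · rintro rfl
        exact ⟨h2, fun j hj hxj => Nat.find_min (hP x h) (h1 ▸ hj) ⟨j, rfl, hxj⟩⟩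
      · rintro ⟨h3, h4⟩
        apply he
        refine le_antisymm ?_ ?_
        · rw [h1]; exact Nat.find_min' (hP x h) ⟨i, rfl, h3⟩
        · by_contra hlt; push Not at hlt
          exact h4 (f x) hlt h2
    · have h' : ∀ j, x ∉ G j := fun j hj => h ⟨j, hj⟩
      have : f x = i0 := by simp only [f, dif_neg h]
      simp only [Set.mem_setOf_eq, this, Set.mem_union, Set.mem_inter_iff, h' i, false_and, false_or]
      split_ifs with hi
      · simp [hi, h']
      · simpa using fun h => hi h.symm
  rw [this]
  refine ((hG i).inter (MeasurableSet.biInter (Set.to_countable _) fun j _ => (hG j).compl)).union ?_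
  split_ifs
  · exact MeasurableSet.iInter fun j => (hG j).compl
  · exact MeasurableSet.empty

def adjX (S : Finset Γ) (X0 : Set X) (x y : X) : Prop := x ∈ X0 ∧ ∃ s ∈ S, s • x = y

structure Mtc (S : Finset Γ) (μ : Measure X) (X0 : Set X) (σ : X → X) (τ : X → Γ) : Prop where
  st : ∀ x, σ x = τ x • x
  inv : ∀ x, σ (σ x) = x
  ts : ∀ x, τ x = 1 ∨ τ x ∈ S
  tm : CM τ
  X0m : MeasurableSet X0
  X0i : ∀ (g : Γ) x, g • x ∈ X0 ↔ x ∈ X0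
  X0n : μ X0ᶜ = 0

variable {S : Finset Γ} {μ : Measure X} [IsProbabilityMeasure μ] {c κ : ℝ} {X0 : Set X}
  {σ : X → X} {τ : X → Γ} {Y : Set X}

lemma adj_symm (B : Bse S μ c κ) (M : Mtc S μ X0 σ τ) : ∀ a b : X, adjX S X0 a b → adjX S X0 b a := by
  rintro a b ⟨h, s, hs, rfl⟩
  exact ⟨(M.X0i _ _).2 h, s⁻¹, B.sym s hs, by simp⟩

namespace Mtc
variable (B : Bse S μ c κ) (M : Mtc S μ X0 σ τ)
include B M

lemma free' {a b : Γ} {x : X} : a • x = b • x ↔ a = b := by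
  constructor
  · intro h
    have := B.free (b⁻¹ * a) x (by rw [mul_smul, h, inv_smul_smul])
    rwa [inv_mul_eq_one, eq_comm] at this
  · rintro rfl; rfl

lemma gm {D : Set X} (hD : MeasurableSet D) (g : Γ) : MeasurableSet {x | g • x ∈ D} :=
  (B.mp g).measurable hD

lemma tmg (g k : Γ) : MeasurableSet {x | τ (g • x) = k} := M.gm B (M.tm k) g

lemma sm {D : Set X} (hD : MeasurableSet D) : MeasurableSet {x | σ x ∈ D} := by
  have : {x | σ x ∈ D} = {x | x ∈ (fun γ : Γ => {x | γ • x ∈ D}) (τ x)} := by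
    ext x; simp [M.st]
  rw [this]
  exact M.tm.mem fun γ => M.gm B hD γ

lemma sgm {D : Set X} (hD : MeasurableSet D) (g : Γ) : MeasurableSet {x | σ (g • x) ∈ D} :=
  M.gm B (M.sm B hD) g

lemma mp : MeasurePreserving σ μ μ := by
  have hms : Measurable σ := fun D hD => M.sm B hD
  refine ⟨hms, Measure.ext fun D hD => ?_⟩
  rw [Measure.map_apply hms hD]
  have e1 : σ ⁻¹' D = ⋃ γ : Γ, ({x | τ x = γ} ∩ {x | γ • x ∈ D}) := by
    ext x; simp [M.st]
  have hd : ∀ x γ, τ x = γ → τ (γ • x) = γ⁻¹ := by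
    intro x γ h
    have := M.inv x
    rw [M.st (σ x), M.st x, h, ← mul_smul] at this
    exact eq_inv_of_mul_eq_one_left (B.free _ _ this)
  have e2 : D = ⋃ γ : Γ, (D ∩ {x | τ x = γ⁻¹}) := by
    ext x
    simp only [Set.mem_iUnion, Set.mem_inter_iff, Set.mem_setOf_eq, exists_and_left]
    exact ⟨fun h => ⟨h, (τ x)⁻¹, by simp⟩, fun h => h.1⟩
  have dj : Pairwise (Function.onFun Disjoint fun γ : Γ => {x | τ x = γ} ∩ {x | γ • x ∈ D}) := by
    intro γ γ' h
    rw [Function.onFun, Set.disjoint_left]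
    rintro x ⟨h1, _⟩ ⟨h2, _⟩
    exact h (h1.symm.trans h2)
  have dj2 : Pairwise (Function.onFun Disjoint fun γ : Γ => D ∩ {x | τ x = γ⁻¹}) := by
    intro γ γ' h
    rw [Function.onFun, Set.disjoint_left]
    rintro x ⟨_, h1⟩ ⟨_, h2⟩
    exact h (inv_injective (h1.symm.trans h2))
  rw [e1, measure_iUnion dj fun γ => (M.tm γ).inter (M.gm B hD γ)]
  conv_rhs => rw [e2]
  rw [measure_iUnion dj2 fun γ => hD.inter (M.tm _)]
  refine tsum_congr fun γ => ?_
  rw [← (B.mp γ).measure_preimage (hD.inter (M.tm γ⁻¹)).nullMeasurableSet]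
  congr 1
  ext x
  simp only [Set.mem_inter_iff, Set.mem_setOf_eq, Set.mem_preimage]
  constructor
  · rintro ⟨h1, h2⟩; exact ⟨h2, hd x γ h1⟩
  · rintro ⟨h1, h2⟩
    refine ⟨?_, h1⟩
    have := hd (γ • x) γ⁻¹ h2
    simpa using this

lemma m_const (p : Prop) : MeasurableSet {_x : X | p} := MeasurableSet.const p

lemma m_mem (ws : List Γ) (a : Γ) : MeasurableSet {x : X | a • x ∈ ws.map (· • x)} := by
  have : {x : X | a • x ∈ ws.map (· • x)} = {x | a ∈ ws} := by
    ext x; simp [M.free' B]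
  rw [this]; exact m_const B M _

lemma m_smem (ws : List Γ) (a : Γ) : MeasurableSet {x : X | σ (a • x) ∈ ws.map (· • x)} := by
  have : {x : X | σ (a • x) ∈ ws.map (· • x)} = ⋃ k : Γ, {x | τ (a • x) = k} ∩ {x | k * a ∈ ws} := by
    ext x; simp [M.st, ← mul_smul, M.free' B]
  rw [this]; exact MeasurableSet.iUnion fun k => (M.tmg B a k).inter (m_const B M _)

lemma m_ext (ws : List Γ) (a : Γ) : MeasurableSet {x : X | Ext (adjX S X0) σ (ws.map (· • x)) (a • x)} := by
  cases ws with
  | nil => simp [Ext]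
  | cons b ws =>
    have h1 : MeasurableSet {x : X | adjX S X0 (σ (b • x)) (a • x)} := by
      have : {x : X | adjX S X0 (σ (b • x)) (a • x)} =
          X0 ∩ ⋃ k : Γ, {x | τ (b • x) = k} ∩ {x | ∃ s ∈ S, s * (k * b) = a} := by
        ext x; simp [adjX, M.st, M.X0i, ← mul_smul, M.free' B]
      rw [this]
      exact M.X0m.inter (MeasurableSet.iUnion fun k => (M.tmg B b k).inter (m_const B M _))
    exact h1.inter ((M.m_mem B (b :: ws) a).union (M.m_smem B (b :: ws) a)).compl

lemma m_pth (hYm : MeasurableSet Y) (ws : List Γ) :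
    MeasurableSet {x : X | Pth (adjX S X0) σ Y (ws.map (· • x))} := by
  induction ws with
  | nil => simp [Pth]
  | cons a ws ih =>
    have : {x : X | Pth (adjX S X0) σ Y ((a :: ws).map (· • x))} =
        ({x | ws = []} ∩ {x | σ (a • x) ∈ Y}) ∪ (({x | a • x ∈ Y}ᶜ ∩ {x | σ (a • x) ∈ Y}ᶜ) ∩
          ({x | Ext (adjX S X0) σ (ws.map (· • x)) (a • x)} ∩
          {x | Pth (adjX S X0) σ Y (ws.map (· • x))})) := by
      ext x; simp [Pth, Pure]
    rw [this]
    exact ((m_const B M _).inter (M.sgm B hYm a)).union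
      (((M.gm B hYm a).compl.inter (M.sgm B hYm a).compl).inter ((M.m_ext B ws a).inter ih))

lemma tinv {x : X} : (τ x)⁻¹ ∈ insert 1 S := by
  rcases M.ts x with h | h
  · simp [h]
  · exact Finset.mem_insert_of_mem (B.sym _ h)

lemma adj_back {a b : X} (h : adjX S X0 (σ b) a) : ∃ k ∈ (insert 1 S) ^ 2, b = k • a := by
  obtain ⟨_, s, hs, h⟩ := h
  refine ⟨(τ b)⁻¹ * s⁻¹, ?_, ?_⟩
  · rw [sq]; exact Finset.mul_mem_mul (M.tinv B) (Finset.mem_insert_of_mem (B.sym _ hs))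
  · rw [← h, M.st, mul_smul, inv_smul_smul, inv_smul_smul]

lemma ball_mono {n m : ℕ} (h : n ≤ m) : (insert 1 S : Finset Γ) ^ n ⊆ (insert 1 S) ^ m :=
  Finset.pow_subset_pow_right (by simp) h

lemma words {x : X} : ∀ (l : List X) (n : ℕ) (g : Γ), Pth (adjX S X0) σ Y (g • x :: l) →
    g ∈ (insert 1 S : Finset Γ) ^ n →
    ∃ ws : List Γ, l = ws.map (· • x) ∧ ∀ ω ∈ ws, ω ∈ (insert 1 S : Finset Γ) ^ (n + 2 * l.length) := by
  intro l
  induction l with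
  | nil => intro n g _ _; exact ⟨[], rfl, by simp⟩
  | cons b l ih =>
    intro n g h hg
    rcases h with ⟨h, _⟩ | ⟨_, h2, h3⟩
    · simp at h
    · obtain ⟨k, hk, rfl⟩ := M.adj_back B h2.1
      rw [← mul_smul] at h3 ⊢
      have hkg : k * g ∈ (insert 1 S : Finset Γ) ^ (n + 2) := by
        rw [add_comm, pow_add]; exact Finset.mul_mem_mul hk hg
      obtain ⟨ws, h4, h5⟩ := ih (n + 2) (k * g) h3 hkg
      refine ⟨k * g :: ws, by simp [h4], ?_⟩
      intro ω hω
      rcases List.mem_cons.1 hω with rfl | hω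
      · exact M.ball_mono B (by simp only [List.length_cons]; omega) hkg
      · exact M.ball_mono B (by simp only [List.length_cons]; omega) (h5 ω hω)

lemma m_Bs (hYm : MeasurableSet Y) (n : ℕ) : MeasurableSet {x | Bs (adjX S X0) σ Y n x} := by
  have : {x | Bs (adjX S X0) σ Y n x} = ⋃ ws : List Γ, {x | ws.length ≤ n} ∩
      {x | Pth (adjX S X0) σ Y ((1 :: ws).map (· • x))} := by
    ext x
    simp only [Set.mem_iUnion, Set.mem_inter_iff, Set.mem_setOf_eq, List.map_cons, one_smul]
    constructor
    · rintro ⟨l, h1, h2⟩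
      obtain ⟨ws, rfl, _⟩ := M.words B (x := x) l 0 1 (by simpa using h1) (by simp)
      exact ⟨ws, by simpa using h2, h1⟩
    · rintro ⟨ws, h1, h2⟩
      exact ⟨_, h2, by simpa using h1⟩
  rw [this]
  exact MeasurableSet.iUnion fun ws => (m_const B M _).inter (M.m_pth B hYm _)

lemma m_Rch (hYm : MeasurableSet Y) (n : ℕ) : MeasurableSet {x | Rch (adjX S X0) σ Y n x} := by
  have : {x | Rch (adjX S X0) σ Y n x} = ⋃ ws : List Γ, {x | ws.length ≤ n} ∩
      ({x | Pth (adjX S X0) σ Y (ws.map (· • x))} ∩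
      {x | Ext (adjX S X0) σ (ws.map (· • x)) ((1:Γ) • x)}) := by
    ext x
    simp only [Set.mem_iUnion, Set.mem_inter_iff, Set.mem_setOf_eq, one_smul]
    constructor
    · rintro ⟨l, h1, h2, h3⟩
      cases l with
      | nil => exact h1.elim
      | cons b l =>
        obtain ⟨k, hk, rfl⟩ := M.adj_back B h3.1
        obtain ⟨ws, rfl, _⟩ := M.words B (x := x) l 2 k h1 hk
        exact ⟨k :: ws, by simpa using h2, h1, h3⟩
    · rintro ⟨ws, h1, h2, h3⟩
      exact ⟨_, h2, by simpa using h1, h3⟩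
  rw [this]
  exact MeasurableSet.iUnion fun ws => (m_const B M _).inter ((M.m_pth B hYm _).inter (M.m_ext B _ _))

lemma m_As (hYm : MeasurableSet Y) (n : ℕ) : MeasurableSet (As (adjX S X0) σ Y n) :=
  (M.m_Bs B hYm n).union (M.sm B (M.m_Bs B hYm n))

lemma m_Yp (hYm : MeasurableSet Y) (r w : ℕ) : MeasurableSet (Yp (adjX S X0) σ Y r w) :=
  (M.sm B (M.m_Bs B hYm r)).inter (M.m_Rch B hYm w).compl

lemma m_Zs (hYm : MeasurableSet Y) (r w : ℕ) : MeasurableSet (Zs (adjX S X0) σ Y r w) :=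
  (M.m_As B hYm r).inter ((M.m_Yp B hYm r w).compl.inter (M.sm B (M.m_Yp B hYm r w)).compl)

/-- chosen path -/
lemma psel (hYm : MeasurableSet Y) (r : ℕ) : ∃ P : X → List Γ, CM P ∧
    ∀ x ∈ As (adjX S X0) σ Y r, Pth (adjX S X0) σ Y ((P x).map (· • x)) ∧ (P x).length ≤ r + 1 ∧
      (∀ ω ∈ P x, ω ∈ (insert 1 S : Finset Γ) ^ (2 * r + 1)) ∧
      ∃ g ws, P x = g :: ws ∧ (g • x = σ x ∨ (g • x = x ∧ ¬ Bs (adjX S X0) σ Y r (σ x))) := by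
  set G : List Γ → Set X := fun ws => {x | Pth (adjX S X0) σ Y (ws.map (· • x))} ∩
    ({_x | ws.length ≤ r + 1 ∧ (∀ ω ∈ ws, ω ∈ (insert 1 S : Finset Γ) ^ (2 * r + 1))} ∩
    ({x | σ ((1:Γ) • x) ∈ (ws.take 1).map (· • x)} ∪ ({_x | 1 ∈ ws.take 1} ∩ {x | Bs (adjX S X0) σ Y r (σ x)}ᶜ)))
    with hG
  obtain ⟨P, hP, hP2⟩ := msel G (fun ws => (M.m_pth B hYm ws).inter ((m_const B M _).inter
    ((M.m_smem B _ _).union ((m_const B M _).inter (M.sm B (M.m_Bs B hYm r)).compl))))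
  refine ⟨P, hP, fun x hx => ?_⟩
  have hex : ∃ ws, x ∈ G ws := by
    have key : ∀ g : Γ, g ∈ (insert 1 S : Finset Γ) → Bs (adjX S X0) σ Y r (g • x) → ∃ ws : List Γ,
        Pth (adjX S X0) σ Y ((g :: ws).map (· • x)) ∧ (g :: ws).length ≤ r + 1 ∧
        ∀ ω ∈ g :: ws, ω ∈ (insert 1 S : Finset Γ) ^ (2 * r + 1) := by
      rintro g hg ⟨l, h1, h2⟩
      have hg1 : g ∈ (insert 1 S : Finset Γ) ^ 1 := by simpa using hg
      obtain ⟨ws, rfl, h3⟩ := M.words B (x := x) l 1 g h1 hg1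
      refine ⟨ws, h1, by simpa using h2, ?_⟩
      intro ω hω
      simp only [List.length_map] at h2 h3
      rcases List.mem_cons.1 hω with rfl | hω
      · exact M.ball_mono B (by omega) hg1
      · exact M.ball_mono B (by omega) (h3 ω hω)
    by_cases hb : Bs (adjX S X0) σ Y r (σ x)
    · obtain ⟨ws, h1, h2, h3⟩ := key (τ x) (by have := M.ts x; simpa using this) (by rwa [← M.st])
      exact ⟨τ x :: ws, h1, ⟨h2, h3⟩, Or.inl (by simp [M.st])⟩
    · have hb' : Bs (adjX S X0) σ Y r x := hx.resolve_right hb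
      obtain ⟨ws, h1, h2, h3⟩ := key 1 (by simp) (by rwa [one_smul])
      exact ⟨1 :: ws, h1, ⟨h2, h3⟩, Or.inr ⟨by simp, hb⟩⟩
  obtain ⟨h1, ⟨h2, h3⟩, h4⟩ := hP2 x hex
  refine ⟨h1, h2, h3, ?_⟩
  cases hPx : P x with
  | nil => rw [hPx] at h1; exact h1.elim
  | cons g ws =>
    rw [hPx] at h4
    refine ⟨g, ws, rfl, ?_⟩
    rcases h4 with h | ⟨h, h'⟩
    · left; simpa [eq_comm] using h
    · right
      have : (1:Γ) = g := by simpa using h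
      exact ⟨by rw [← this, one_smul], h'⟩
end Mtc

/-- base of a point along a word -/
noncomputable def bsf (σ : X → X) (τ : X → Γ) (Yq : Set X) : List Γ → X → Γ
  | [], _ => 1
  | g :: ws, x => if σ (g • x) ∈ Yq then τ (g • x) * g else bsf σ τ Yq ws x

noncomputable def ixf (σ : X → X) (Yq : Set X) : List Γ → X → ℕ
  | [], _ => 0
  | g :: ws, x => if σ (g • x) ∈ Yq then 0 else ixf σ Yq ws x + 1

lemma bsf_spec {Yq : Set X} {x : X} {ws : List Γ} (h : ∃ g ∈ ws, σ (g • x) ∈ Yq) :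
    ∃ b g rest, ws = b ++ g :: rest ∧ (∀ β ∈ b, σ (β • x) ∉ Yq) ∧ σ (g • x) ∈ Yq ∧
      bsf σ τ Yq ws x = τ (g • x) * g := by
  induction ws with
  | nil => simp at h
  | cons a ws ih =>
    by_cases ha : σ (a • x) ∈ Yq
    · exact ⟨[], a, ws, rfl, by simp, ha, by simp [bsf, ha]⟩
    · obtain ⟨b, g, rest, h1, h2, h3, h4⟩ := ih (by simpa [ha] using h)
      exact ⟨a :: b, g, rest, by simp [h1], by simpa [ha] using h2, h3, by simp [bsf, ha, h4]⟩

lemma ixf_le {Yq : Set X} {x : X} (ws : List Γ) : ixf σ Yq ws x ≤ ws.length := by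
  induction ws with
  | nil => simp [ixf]
  | cons a ws ih => simp only [ixf, List.length_cons]; split_ifs <;> omega

lemma ixf_mono {Yq Yq' : Set X} (h : Yq' ⊆ Yq) {x : X} (ws : List Γ) :
    ixf σ Yq ws x ≤ ixf σ Yq' ws x := by
  induction ws with
  | nil => simp [ixf]
  | cons a ws ih =>
    simp only [ixf]
    by_cases h1 : σ (a • x) ∈ Yq
    · simp [h1]
    · rw [if_neg h1, if_neg (fun h2 => h1 (h h2))]; omega

lemma ixf_lt (B : Bse S μ c κ) (M : Mtc S μ X0 σ τ) {Yq Yq' : Set X} (h : Yq' ⊆ Yq) {x : X}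
    {ws : List Γ} (hex : ∃ g ∈ ws, σ (g • x) ∈ Yq) (hb : bsf σ τ Yq ws x • x ∉ Yq') :
    ixf σ Yq ws x + 1 ≤ ixf σ Yq' ws x := by
  induction ws with
  | nil => simp at hex
  | cons a ws ih =>
    simp only [ixf, bsf] at *
    by_cases h1 : σ (a • x) ∈ Yq
    · rw [if_pos h1, mul_smul, ← M.st] at hb
      rw [if_pos h1, if_neg hb]; omega
    · rw [if_neg h1] at hb
      rw [if_neg h1, if_neg (fun h2 => h1 (h h2))]
      have := ih (by simpa [h1] using hex) hb
      omega

lemma bsf_cm (B : Bse S μ c κ) (M : Mtc S μ X0 σ τ) {Yq : Set X} (hY : MeasurableSet Yq)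
    (ws : List Γ) : CM (bsf σ τ Yq ws) := by
  induction ws with
  | nil => intro i; simp only [bsf]; exact MeasurableSet.const _
  | cons a ws ih =>
    intro i
    have : {x | bsf σ τ Yq (a :: ws) x = i} = ({x | σ (a • x) ∈ Yq} ∩ {x | τ (a • x) = i * a⁻¹}) ∪
        ({x | σ (a • x) ∈ Yq}ᶜ ∩ {x | bsf σ τ Yq ws x = i}) := by
      ext x
      by_cases h : σ (a • x) ∈ Yq <;> simp [bsf, h, eq_mul_inv_iff_mul_eq]
    rw [this]
    exact ((M.sgm B hY a).inter (M.tmg B a _)).union ((M.sgm B hY a).compl.inter (ih i))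
end Dyn2
end PaperPM

open scoped Classical Pointwise
open MeasureTheory
namespace PaperPM
section StepI
variable {Γ : Type*} [Group Γ] [Countable Γ] {X : Type*} [MeasurableSpace X] [MulAction Γ X]
set_option linter.unusedSectionVars false
set_option linter.deprecated false
variable {S : Finset Γ} {μ : Measure X} [IsProbabilityMeasure μ] {c κ : ℝ} {X0 : Set X}
  {σ : X → X} {τ : X → Γ} {Y : Set X}

def GoodP (S : Finset Γ) (X0 : Set X) (σ : X → X) (Y : Set X) (r : ℕ) (P : X → List Γ) : Prop :=
  ∀ x ∈ As (adjX S X0) σ Y r, Pth (adjX S X0) σ Y ((P x).map (· • x)) ∧ (P x).length ≤ r + 1 ∧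
      (∀ ω ∈ P x, ω ∈ (insert 1 S : Finset Γ) ^ (2 * r + 1)) ∧
      ∃ g ws, P x = g :: ws ∧ (g • x = σ x ∨ (g • x = x ∧ ¬ Bs (adjX S X0) σ Y r (σ x)))

namespace Mtc
variable (B : Bse S μ c κ) (M : Mtc S μ X0 σ τ)
include B M

lemma hexP (H : Sys (adjX S X0) σ Y) {r w : ℕ} {P : X → List Γ} (hP : GoodP S X0 σ Y r P)
    (hv : Valid (adjX S X0) σ Y w) {x : X} (hx : x ∈ As (adjX S X0) σ Y r) :
    ∃ g ∈ P x, σ (g • x) ∈ Yp (adjX S X0) σ Y r w := by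
  obtain ⟨mid, e, h1, h2, _⟩ := Sys.pth_last (hP x hx).1
  have : e ∈ (P x).map (· • x) := by rw [h1]; simp
  obtain ⟨g, hg, rfl⟩ := List.mem_map.1 this
  exact ⟨g, hg, H.Y_sub hv h2⟩

lemma part (H : Sys (adjX S X0) σ Y) (hYm : MeasurableSet Y) (r w : ℕ) :
    μ.real (As (adjX S X0) σ Y r) = μ.real (Yp (adjX S X0) σ Y r w) + μ.real (Zs (adjX S X0) σ Y r w) +
      μ.real {x | σ x ∈ Yp (adjX S X0) σ Y r w ∧ x ∉ Yp (adjX S X0) σ Y r w} ∧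
    As (adjX S X0) σ Y r = (Zs (adjX S X0) σ Y r w ∪ Yp (adjX S X0) σ Y r w) ∪
      {x | σ x ∈ Yp (adjX S X0) σ Y r w ∧ x ∉ Yp (adjX S X0) σ Y r w} ∧
    Disjoint (Zs (adjX S X0) σ Y r w ∪ Yp (adjX S X0) σ Y r w)
      {x | σ x ∈ Yp (adjX S X0) σ Y r w ∧ x ∉ Yp (adjX S X0) σ Y r w} ∧
    Disjoint (Zs (adjX S X0) σ Y r w) (Yp (adjX S X0) σ Y r w) := by
  have hYA : ∀ y ∈ Yp (adjX S X0) σ Y r w, y ∈ As (adjX S X0) σ Y r := fun y hy => Or.inr hy.1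
  have e1 : As (adjX S X0) σ Y r = (Zs (adjX S X0) σ Y r w ∪ Yp (adjX S X0) σ Y r w) ∪
      {x | σ x ∈ Yp (adjX S X0) σ Y r w ∧ x ∉ Yp (adjX S X0) σ Y r w} := by
    ext x
    constructor
    · intro h
      by_cases h1 : x ∈ Yp (adjX S X0) σ Y r w
      · exact Or.inl (Or.inr h1)
      · by_cases h2 : σ x ∈ Yp (adjX S X0) σ Y r w
        · exact Or.inr ⟨h2, h1⟩
        · exact Or.inl (Or.inl ⟨h, h1, h2⟩)
    · rintro ((h | h) | h)
      · exact h.1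
      · exact hYA _ h
      · exact H.As_inv.1 (hYA _ h.1)
  have d1 : Disjoint (Zs (adjX S X0) σ Y r w ∪ Yp (adjX S X0) σ Y r w)
      {x | σ x ∈ Yp (adjX S X0) σ Y r w ∧ x ∉ Yp (adjX S X0) σ Y r w} := by
    rw [Set.disjoint_left]
    rintro x (h | h) h'
    · exact h.2.2 h'.1
    · exact h'.2 h
  have d2 : Disjoint (Zs (adjX S X0) σ Y r w) (Yp (adjX S X0) σ Y r w) := by
    rw [Set.disjoint_left]
    exact fun x h h' => h.2.1 h'
  refine ⟨?_, e1, d1, d2⟩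
  have hm := M.m_Yp B hYm r w
  have hO : MeasurableSet {x | σ x ∈ Yp (adjX S X0) σ Y r w ∧ x ∉ Yp (adjX S X0) σ Y r w} :=
    (M.sm B hm).inter hm.compl
  rw [e1, measureReal_union d1 hO, measureReal_union d2 hm]
  ring

lemma crossing (H : Sys (adjX S X0) σ Y) {r W0 w N : ℕ} {P : X → List Γ}
    (hP : GoodP S X0 σ Y r P) (h1 : r ≤ W0) (h2 : W0 ≤ w) (h3 : w + W0 + 3 * r + 11 ≤ N)
    (hv : Valid (adjX S X0) σ Y N) {s : Γ} (hs : s ∈ S) {x : X} (hx0 : x ∈ X0)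
    (hx : x ∈ Zs (adjX S X0) σ Y r w ∪ Yp (adjX S X0) σ Y r w)
    (hx' : s • x ∈ Zs (adjX S X0) σ Y r w ∪ Yp (adjX S X0) σ Y r w)
    (hb : bsf σ τ (Yp (adjX S X0) σ Y r w) (P x) x • x ∈ Yp (adjX S X0) σ Y r N)
    (hb' : bsf σ τ (Yp (adjX S X0) σ Y r w) (P (s • x)) (s • x) • s • x ∈ Yp (adjX S X0) σ Y r N)
    (hz : x ∈ Zs (adjX S X0) σ Y r w → x ∈ Zs (adjX S X0) σ Y r W0)
    (hz' : s • x ∈ Zs (adjX S X0) σ Y r w → s • x ∈ Zs (adjX S X0) σ Y r W0) :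
    bsf σ τ (Yp (adjX S X0) σ Y r w) (P (s • x)) (s • x) * s =
      bsf σ τ (Yp (adjX S X0) σ Y r w) (P x) x := by
  have hvw : Valid (adjX S X0) σ Y w := hv.mono (by omega)
  have key : ∀ z, z ∈ Zs (adjX S X0) σ Y r w ∪ Yp (adjX S X0) σ Y r w →
      (z ∈ Zs (adjX S X0) σ Y r w → z ∈ Zs (adjX S X0) σ Y r W0) →
      Sys.Cell (adjX S X0) σ Y w W0 (r + 1) z (bsf σ τ (Yp (adjX S X0) σ Y r w) (P z) z • z) := by
    intro z hz hz0
    have hzA : z ∈ As (adjX S X0) σ Y r := by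
      rcases hz with h | h
      · exact h.1
      · exact Or.inr h.1
    obtain ⟨b, g, rest, q1, q2, q3, q4⟩ := bsf_spec (τ := τ) (M.hexP B H hP hvw hzA)
    obtain ⟨p1, p2, _, g0, ws, p4, p5⟩ := hP z hzA
    rw [q4, mul_smul, ← M.st]
    rw [q1] at p1 p2 p4
    refine H.cell_of (b := b.map (· • z)) (rest := rest.map (· • z)) (by omega) hvw (by simpa using p1)
      (by simpa using p2) (by simpa using q2) q3 ?_ ?_ ?_
    · intro hb
      have hb : b = [] := by simpa using hb
      subst hb
      simp only [List.nil_append, List.cons.injEq] at p4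
      obtain ⟨rfl, _⟩ := p4
      rcases p5 with h | ⟨h, h'⟩
      · rw [h, M.inv]
      · rw [h] at q3
        rcases hz with hz | hz
        · exact absurd q3 hz.2.2
        · exact absurd hz.1 h'
    · intro β b' hb
      cases b with
      | nil => simp at hb
      | cons a b =>
        simp only [List.cons_append, List.cons.injEq, List.map_cons] at p4 hb
        obtain ⟨rfl, _⟩ := p4
        obtain ⟨rfl, _⟩ := hb
        rcases p5 with h | h
        · exact Or.inr h
        · exact Or.inl h.1
    · rcases hz with hz | hz
      · exact (H.Zs_B h1 (hv.mono (by omega)) (hz0 hz)).2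
      · exact hz.1.mono h1
  have := H.cell_eq (key x hx hz) (key _ hx' hz') hb.2 hb'.2 (by omega) ⟨hx0, s, hs, rfl⟩
  rw [← M.free' B (x := x), mul_smul, this]

lemma stepI (H : Sys (adjX S X0) σ Y) (hYm : MeasurableSet Y) {r W0 w N : ℕ} {P : X → List Γ}
    (hPm : CM P) (hP : GoodP S X0 σ Y r P) (h1 : r ≤ W0) (h2 : W0 ≤ w)
    (h3 : w + W0 + 3 * r + 11 ≤ N) (hv : Valid (adjX S X0) σ Y N) {η : ℝ}
    (hη : ∀ A Yq Z O : Set X, MeasurableSet A →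
      MeasurableSet O → μ.real A = μ.real Yq + μ.real Z + μ.real O → μ.real O ≤ μ.real Yq →
      η * μ.real A ≤ S.card * (μ.real Yq - μ.real O) + c * μ.real Z + em S μ O O + em S μ A Aᶜ) :
    η * μ.real (As (adjX S X0) σ Y r) ≤
      2 * S.card * (μ.real (As (adjX S X0) σ Y (w + 1)) - μ.real (As (adjX S X0) σ Y r)) +
      2 * S.card * (μ.real {x | x ∈ As (adjX S X0) σ Y r ∧
          bsf σ τ (Yp (adjX S X0) σ Y r w) (P x) x • x ∉ Yp (adjX S X0) σ Y r N} +
        (μ.real (Zs (adjX S X0) σ Y r w) - μ.real (Zs (adjX S X0) σ Y r W0))) := by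
  have hvw : Valid (adjX S X0) σ Y w := hv.mono (by omega)
  obtain ⟨pt1, pt2, pt3, pt4⟩ := M.part B H hYm r w
  have hmA := M.m_As B hYm r
  have hmA1 := M.m_As B hYm (w + 1)
  have hmY := M.m_Yp B hYm r w
  have hmZ := M.m_Zs B hYm r w
  have hmZ0 := M.m_Zs B hYm r W0
  have hmN := M.m_Yp B hYm r N
  have hAA : As (adjX S X0) σ Y r ⊆ As (adjX S X0) σ Y (w + 1) := As.mono (by omega)
  have hZ0 : Zs (adjX S X0) σ Y r W0 ⊆ Zs (adjX S X0) σ Y r w := Zs.mono h2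
  have hBw : ∀ x ∈ Zs (adjX S X0) σ Y r w ∪ Yp (adjX S X0) σ Y r w, Bs (adjX S X0) σ Y w (σ x) := by
    rintro x (h | h)
    · exact (H.Zs_B (by omega) hvw h).2
    · exact h.1.mono (by omega)
  have hcross := fun {s : Γ} (hs : s ∈ S) {x : X} => M.crossing B H hP h1 h2 h3 hv hs (x := x)
  have hoA : ∀ s ∈ S, ∀ x ∈ X0, x ∈ Zs (adjX S X0) σ Y r w ∪ Yp (adjX S X0) σ Y r w →
      s • x ∈ As (adjX S X0) σ Y (w + 1) := fun s hs x hx0 hx => H.out_As (hBw x hx) ⟨hx0, s, hs, rfl⟩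
  have hβ1 : ∀ x ∈ As (adjX S X0) σ Y r,
      bsf σ τ (Yp (adjX S X0) σ Y r w) (P x) x • x ∈ Yp (adjX S X0) σ Y r w ∧
      bsf σ τ (Yp (adjX S X0) σ Y r w) (P x) x ∈ (insert 1 S : Finset Γ) ^ (2 * r + 2) := by
    intro x hx
    obtain ⟨b, g, rest, q1, q2, q3, q4⟩ := bsf_spec (τ := τ) (M.hexP B H hP hvw hx)
    rw [q4]
    refine ⟨by rwa [mul_smul, ← M.st], ?_⟩
    rw [pow_succ']
    exact Finset.mul_mem_mul (by have := M.ts (g • x); simpa using this)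
      ((hP x hx).2.2.1 g (by rw [q1]; simp))
  have hβ2 : ∀ y ∈ Yp (adjX S X0) σ Y r w, bsf σ τ (Yp (adjX S X0) σ Y r w) (P y) y = 1 := by
    intro y hy
    obtain ⟨_, _, _, g, ws, p4, p5⟩ := hP y (Or.inr hy.1)
    have hg : g • y = σ y := p5.resolve_right fun h => h.2 hy.1
    apply B.free _ y
    rw [p4, bsf, if_pos (by rwa [hg, M.inv]), mul_smul, ← M.st, hg, M.inv]
  have hβm : CM (fun x => bsf σ τ (Yp (adjX S X0) σ Y r w) (P x) x) :=
    hPm.bind fun ws => bsf_cm B M hmY ws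
  have hb1 : MeasurableSet {x | x ∈ As (adjX S X0) σ Y r ∧
          bsf σ τ (Yp (adjX S X0) σ Y r w) (P x) x • x ∉ Yp (adjX S X0) σ Y r N} :=
    hmA.inter (hβm.mem (G := fun g => {x | g • x ∈ Yp (adjX S X0) σ Y r N}) fun g => M.gm B hmN g).compl
  have hOY : μ.real {x | σ x ∈ Yp (adjX S X0) σ Y r w ∧ x ∉ Yp (adjX S X0) σ Y r w} ≤
      μ.real (Yp (adjX S X0) σ Y r w) := by
    rw [← (M.mp B).measureReal_preimage hmY.nullMeasurableSet]
    exact measureReal_mono fun x hx => hx.1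
  have hmO : MeasurableSet {x | σ x ∈ Yp (adjX S X0) σ Y r w ∧ x ∉ Yp (adjX S X0) σ Y r w} :=
    (M.sm B hmY).inter hmY.compl
  have hbZ : μ.real (Zs (adjX S X0) σ Y r w \ Zs (adjX S X0) σ Y r W0) =
      μ.real (Zs (adjX S X0) σ Y r w) - μ.real (Zs (adjX S X0) σ Y r W0) :=
    measureReal_sdiff hZ0 hmZ0
  have hbA : μ.real (As (adjX S X0) σ Y (w + 1) \ As (adjX S X0) σ Y r) =
      μ.real (As (adjX S X0) σ Y (w + 1)) - μ.real (As (adjX S X0) σ Y r) :=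
    measureReal_sdiff hAA hmA
  have hlow := hη _ _ _ _ hmA hmO pt1 hOY
  rw [← hbZ, ← hbA]
  generalize hEb : {x | x ∈ As (adjX S X0) σ Y r ∧
          bsf σ τ (Yp (adjX S X0) σ Y r w) (P x) x • x ∉ Yp (adjX S X0) σ Y r N} = Bad1 at *
  generalize hE2 : Zs (adjX S X0) σ Y r w \ Zs (adjX S X0) σ Y r W0 = Bad2 at *
  generalize hEA : As (adjX S X0) σ Y (w + 1) \ As (adjX S X0) σ Y r = DA at *
  have hmB2 : MeasurableSet Bad2 := hE2 ▸ hmZ.diff hmZ0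
  have hmDA : MeasurableSet DA := hEA ▸ hmA1.diff hmA
  set O := {x | σ x ∈ Yp (adjX S X0) σ Y r w ∧ x ∉ Yp (adjX S X0) σ Y r w} with hO
  set A := As (adjX S X0) σ Y r with hA
  set E := Zs (adjX S X0) σ Y r w ∪ Yp (adjX S X0) σ Y r w with hE
  have hEm : MeasurableSet E := hmZ.union hmY
  have hEr : μ.real E = μ.real (Zs (adjX S X0) σ Y r w) + μ.real (Yp (adjX S X0) σ Y r w) :=
    measureReal_union pt4 hmY
  have hEA' : E ⊆ A := by rw [pt2]; exact Set.subset_union_left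
  have hci := B.cell_ineq hEm hmY Set.subset_union_right hβm (Bf := (insert 1 S : Finset Γ) ^ (2 * r + 2))
    (fun x hx => (hβ1 x (hEA' hx)).2) (fun x hx => (hβ1 x (hEA' hx)).1) hβ2
  have hX0 : μ.real X0ᶜ = 0 := by simp [measureReal_def, M.X0n]
  have pres : ∀ (s : Γ) {D : Set X}, MeasurableSet D → μ.real ((fun x => s • x) ⁻¹' D) = μ.real D :=
    fun s D hD => (B.mp s).measureReal_preimage hD.nullMeasurableSet
  have hup : ∑ s ∈ S, μ.real {x | x ∈ E ∧ ¬ (s • x ∈ E ∧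
      bsf σ τ (Yp (adjX S X0) σ Y r w) (P (s • x)) (s • x) * s =
      bsf σ τ (Yp (adjX S X0) σ Y r w) (P x) x)} ≤ em S μ E O + em S μ E Aᶜ +
      S.card * (2 * (μ.real Bad1 + μ.real Bad2)) := by
    rw [em, em, ← Finset.sum_add_distrib, ← nsmul_eq_mul, ← Finset.sum_const, ← Finset.sum_add_distrib]
    refine Finset.sum_le_sum fun s hs => ?_
    have hsub : {x | x ∈ E ∧ ¬ (s • x ∈ E ∧
      bsf σ τ (Yp (adjX S X0) σ Y r w) (P (s • x)) (s • x) * s =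
      bsf σ τ (Yp (adjX S X0) σ Y r w) (P x) x)} ⊆ ((E ∩ (fun x => s • x) ⁻¹' O) ∪
        (E ∩ (fun x => s • x) ⁻¹' Aᶜ)) ∪ (((Bad1 ∪ Bad2) ∪ (fun x => s • x) ⁻¹' (Bad1 ∪ Bad2)) ∪ X0ᶜ) := by
      rintro x ⟨hx, hx2⟩
      by_contra hno
      simp only [Set.mem_union, Set.mem_inter_iff, Set.mem_preimage, Set.mem_compl_iff, not_or, not_and,
        not_not] at hno
      obtain ⟨⟨n1, n2⟩, ⟨⟨n3, n4⟩, n5, n6⟩, n7⟩ := hno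
      have hsE : s • x ∈ E := by
        have h := n2 hx
        rw [pt2] at h
        exact h.resolve_right (n1 hx)
      rw [← hEb] at n3 n5
      rw [← hE2] at n4 n6
      apply hx2
      refine ⟨hsE, hcross hs n7 hx hsE ?_ ?_ ?_ ?_⟩
      · by_contra h; exact n3 ⟨hEA' hx, h⟩
      · by_contra h; exact n5 ⟨hEA' hsE, h⟩
      · intro h; by_contra h'; exact n4 ⟨h, h'⟩
      · intro h; by_contra h'; exact n6 ⟨h, h'⟩
    have u1 := measureReal_mono (μ := μ) hsub
    have u2 := measureReal_union_le (μ := μ) ((E ∩ (fun x => s • x) ⁻¹' O) ∪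
        (E ∩ (fun x => s • x) ⁻¹' Aᶜ)) (((Bad1 ∪ Bad2) ∪ (fun x => s • x) ⁻¹' (Bad1 ∪ Bad2)) ∪ X0ᶜ)
    have u3 := measureReal_union_le (μ := μ) (E ∩ (fun x => s • x) ⁻¹' O) (E ∩ (fun x => s • x) ⁻¹' Aᶜ)
    have u4 := measureReal_union_le (μ := μ) ((Bad1 ∪ Bad2) ∪ (fun x => s • x) ⁻¹' (Bad1 ∪ Bad2)) X0ᶜ
    have u5 := measureReal_union_le (μ := μ) (Bad1 ∪ Bad2) ((fun x => s • x) ⁻¹' (Bad1 ∪ Bad2))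
    rw [pres s (hb1.union hmB2)] at u5
    have u6 := measureReal_union_le (μ := μ) Bad1 Bad2
    linarith
  have hEout : em S μ E Aᶜ ≤ S.card * μ.real DA := by
    rw [em, ← nsmul_eq_mul, ← Finset.sum_const]
    refine Finset.sum_le_sum fun s hs => ?_
    have hsub : E ∩ (fun x => s • x) ⁻¹' Aᶜ ⊆ (fun x => s • x) ⁻¹' DA ∪ X0ᶜ := by
      rintro x ⟨hx, hx2⟩
      by_cases hx0 : x ∈ X0
      · left; rw [← hEA]; exact ⟨hoA s hs x hx0 hx, hx2⟩
      · exact Or.inr hx0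
    have u1 := measureReal_mono (μ := μ) hsub
    have u2 := measureReal_union_le (μ := μ) ((fun x => s • x) ⁻¹' DA) X0ᶜ
    rw [pres s hmDA] at u2
    linarith
  have s1 := B.em_symm hEm hmO
  have s2 := B.em_symm hmA hmA.compl
  have s3 := B.em_symm hEm hmA.compl
  have s4 := B.em_symm hmO hmA.compl
  have s5 := B.em_add hmA.compl hmO pt3
  rw [← pt2] at s5
  have s6 := Bse.em_univ (S := S) (μ := μ) O
  have s7 := B.em_add hmO hmO pt3
  have s8 := B.em_add hmO hmA.compl (disjoint_compl_right (a := A))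
  rw [Set.union_compl_self] at s8
  rw [← pt2] at s7
  have : c * (μ.real E - μ.real (Yp (adjX S X0) σ Y r w)) = c * μ.real (Zs (adjX S X0) σ Y r w) := by
    rw [hEr]; ring
  linarith
end Mtc
end StepI
end PaperPM

open scoped Classical Pointwise
open MeasureTheory
namespace PaperPM
section GrowI
variable {Γ : Type*} [Group Γ] [Countable Γ] {X : Type*} [MeasurableSpace X] [MulAction Γ X]
set_option linter.unusedSectionVars false
set_option linter.deprecated false
variable {S : Finset Γ} {μ : Measure X} [IsProbabilityMeasure μ] {c κ : ℝ} {X0 : Set X}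
  {σ : X → X} {τ : X → Γ} {Y : Set X}

lemma pig (f : ℕ → ℝ) {n : ℕ} (hn : 1 ≤ n) {a : ℝ} (h : f n - f 0 ≤ n * a) :
    ∃ i < n, f (i + 1) - f i ≤ a := by
  have : ∑ i ∈ Finset.range n, (f (i + 1) - f i) ≤ ∑ i ∈ Finset.range n, a := by
    rw [Finset.sum_range_sub]; simpa using h
  obtain ⟨i, hi, h2⟩ := Finset.exists_le_of_sum_le (by simp; omega) this
  exact ⟨i, by simpa using hi, h2⟩

lemma pig2 {A : Set X} (hA : MeasurableSet A) (D : ℕ → Set X) (hD : ∀ j, MeasurableSet (D j))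
    (n m : ℕ) (hn : 1 ≤ n) (hc : ∀ x, ∑ j ∈ Finset.range n, (D j).indicator (fun _ => (1:ℝ)) x ≤
      m * A.indicator (fun _ => (1:ℝ)) x) {a : ℝ} (ha : m * μ.real A ≤ n * a) :
    ∃ j < n, μ.real (D j) ≤ a := by
  have h1 : ∑ j ∈ Finset.range n, μ.real (D j) ≤ m * μ.real A := by
    have e : ∀ {D : Set X}, MeasurableSet D → ∫ x, D.indicator (fun _ => (1:ℝ)) x ∂μ = μ.real D := by
      intro D hD; simp [integral_indicator hD]
    rw [← e hA, ← integral_const_mul]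
    simp_rw [← e (hD _)]
    rw [← integral_finsetSum _ fun j _ => (integrable_const _).indicator (hD j)]
    exact integral_mono (integrable_finset_sum _ fun j _ => (integrable_const _).indicator (hD j))
      (((integrable_const _).indicator hA).const_mul _) hc
  have : ∑ i ∈ Finset.range n, μ.real (D i) ≤ ∑ i ∈ Finset.range n, a := by
    simpa using h1.trans ha
  obtain ⟨i, hi, h2⟩ := Finset.exists_le_of_sum_le (by simp; omega) this
  exact ⟨i, by simpa using hi, h2⟩

lemma growI (B : Bse S μ c κ) : ∃ η : ℝ, 0 < η ∧ ∃ C K : ℕ, 1 ≤ C ∧ 1 ≤ K ∧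
    ∀ (X0 : Set X) (σ : X → X) (τ : X → Γ) (Y : Set X) (r : ℕ), Mtc S μ X0 σ τ →
    Sys (adjX S X0) σ Y → MeasurableSet Y → Valid (adjX S X0) σ Y (C * (r + 1) ^ K) →
    (1 + η) * μ.real (As (adjX S X0) σ Y r) ≤ μ.real (As (adjX S X0) σ Y (C * (r + 1) ^ K)) := by
  obtain ⟨η1, h1, hη⟩ := B.lower c B.c0
  have hd : (1:ℝ) ≤ S.card := by exact_mod_cast B.ne.card_pos
  obtain ⟨M', hM'⟩ := exists_nat_ge (8 * S.card / η1)
  have hM1 : 8 * S.card ≤ M' * η1 := by rwa [div_le_iff₀ h1] at hM'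
  have hM0 : 1 ≤ M' := by
    rcases Nat.eq_zero_or_pos M' with h | h
    · subst h; simp at hM1; linarith
    · exact h
  refine ⟨η1 / (4 * S.card), by positivity, 11 * (M' + 1) ^ M', M' + 1, ?_, by omega, ?_⟩
  · have : 1 ≤ (M' + 1) ^ M' := Nat.one_le_pow _ _ (by omega)
    omega
  intro X0 σ τ Y r M H hYm hv
  set T := 11 * (M' + 1) ^ M' * (r + 1) ^ (M' + 1) with hT
  set J := (r + 1) * M' with hJ
  have hJ1 : 1 ≤ J := Nat.mul_pos (by omega) hM0
  have hge : ∀ i, 4 * r + 11 ≤ (J + 1) ^ i * (4 * r + 11) := fun i =>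
    Nat.le_mul_of_pos_left _ (by positivity)
  set W : ℕ → ℕ := fun i => (J + 1) ^ i * (4 * r + 11) - (3 * r + 11) with hWd
  have hW : ∀ i, W i + (3 * r + 11) = (J + 1) ^ i * (4 * r + 11) := fun i => by
    have := hge i
    simp only [hWd]; omega
  have hWr : ∀ i, r ≤ W i := fun i => by have := hge i; have := hW i; omega
  have hWs : ∀ i, W (i + 1) = W i + J * (W i + 3 * r + 11) := fun i => by
    have a := hW i; have b := hW (i + 1)
    rw [pow_succ, mul_right_comm, ← a] at b
    nlinarith
  have hWm : Monotone W := monotone_nat_of_le_succ fun i => by rw [hWs]; omega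
  have hWT : W M' + 1 ≤ T := by
    have a := hW M'
    have b : (J + 1) ^ M' * (4 * r + 11) ≤ T := by
      have b1 : J + 1 ≤ (M' + 1) * (r + 1) := by rw [hJ]; nlinarith
      calc (J + 1) ^ M' * (4 * r + 11) ≤ ((M' + 1) * (r + 1)) ^ M' * (11 * (r + 1)) :=
            Nat.mul_le_mul (Nat.pow_le_pow_left b1 _) (by omega)
        _ = T := by rw [hT, mul_pow, pow_succ]; ring
    omega
  obtain ⟨P, hPm, hP⟩ := M.psel B hYm r
  set η' : ℝ := η1 / (8 * S.card) with hη'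
  have hη'0 : 0 < η' := by positivity
  have hMη : 1 ≤ M' * η' := by
    rw [hη', ← mul_div_assoc, le_div_iff₀ (by positivity)]; linarith
  set A := As (adjX S X0) σ Y r with hA
  have hA0 : 0 ≤ μ.real A := measureReal_nonneg
  obtain ⟨i, hi, hi2⟩ := pig (fun i => μ.real (Zs (adjX S X0) σ Y r (W i))) hM0 (a := η' * μ.real A) (by
    have u : μ.real (Zs (adjX S X0) σ Y r (W M')) ≤ μ.real A := measureReal_mono fun x hx => hx.1
    have v : 0 ≤ μ.real (Zs (adjX S X0) σ Y r (W 0)) := measureReal_nonneg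
    nlinarith)
  set w : ℕ → ℕ := fun j => W i + j * (W i + 3 * r + 11) with hw
  have hws : ∀ j, w (j + 1) = w j + (W i + 3 * r + 11) := fun j => by simp only [hw]; ring
  have hwm : Monotone w := monotone_nat_of_le_succ fun i => by rw [hws]; omega
  have hwJ : w J = W (i + 1) := by rw [hWs]
  have hw0 : ∀ j, W i ≤ w j := fun j => by simp only [hw]; omega
  have hWi : W (i + 1) ≤ W M' := hWm hi
  have hvw : ∀ j ≤ J, Valid (adjX S X0) σ Y (w j) := fun j hj => hv.mono (by
    have := hwm hj; omega)
  set D : ℕ → Set X := fun j => {x | x ∈ A ∧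
      bsf σ τ (Yp (adjX S X0) σ Y r (w j)) (P x) x • x ∉ Yp (adjX S X0) σ Y r (w (j + 1))} with hD
  have hmA := M.m_As B hYm r
  have hDm : ∀ j, MeasurableSet (D j) := fun j =>
    hmA.inter ((hPm.bind fun ws => bsf_cm B M (M.m_Yp B hYm r (w j)) ws).mem
      (G := fun g => {x | g • x ∈ Yp (adjX S X0) σ Y r (w (j + 1))})
      fun g => M.gm B (M.m_Yp B hYm r _) g).compl
  have hcount : ∀ x ∈ A, ∀ n ≤ J, ∑ j ∈ Finset.range n, (D j).indicator (fun _ => (1:ℝ)) x ≤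
      (ixf σ (Yp (adjX S X0) σ Y r (w n)) (P x) x : ℕ) := by
    intro x hx n
    induction n with
    | zero => intro _; simp
    | succ n ih =>
      intro hn
      rw [Finset.sum_range_succ]
      have ih := ih (by omega)
      have hsub : Yp (adjX S X0) σ Y r (w (n + 1)) ⊆ Yp (adjX S X0) σ Y r (w n) :=
        Yp.anti (hwm (by omega))
      by_cases hxD : x ∈ D n
      · rw [Set.indicator_of_mem hxD]
        have := ixf_lt B M hsub (M.hexP B H hP (hvw n (by omega)) hx) hxD.2
        have : ((ixf σ (Yp (adjX S X0) σ Y r (w n)) (P x) x : ℕ) : ℝ) + 1 ≤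
          (ixf σ (Yp (adjX S X0) σ Y r (w (n + 1))) (P x) x : ℕ) := by exact_mod_cast this
        linarith
      · rw [Set.indicator_of_notMem hxD]
        have : ((ixf σ (Yp (adjX S X0) σ Y r (w n)) (P x) x : ℕ) : ℝ) ≤
          (ixf σ (Yp (adjX S X0) σ Y r (w (n + 1))) (P x) x : ℕ) := by
          exact_mod_cast ixf_mono hsub (P x)
        linarith
  obtain ⟨j, hj, hj2⟩ := pig2 (μ := μ) hmA D hDm J (r + 1) hJ1 (a := η' * μ.real A) (by
    intro x
    by_cases hx : x ∈ A
    · rw [Set.indicator_of_mem hx, mul_one]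
      refine (hcount x hx J le_rfl).trans ?_
      have h2 := (hP x hx).2.1
      have h3 := ixf_le (σ := σ) (Yq := Yp (adjX S X0) σ Y r (w J)) (x := x) (P x)
      exact_mod_cast h3.trans h2
    · rw [Set.indicator_of_notMem hx, mul_zero]
      refine (Finset.sum_eq_zero fun j _ => Set.indicator_of_notMem (fun h => hx h.1) _).le) (by
    rw [hJ]; push_cast
    have : 0 ≤ ((r:ℝ) + 1) * μ.real A := by positivity
    nlinarith)
  have hst := M.stepI B H hYm hPm hP (hWr i) (hw0 j) (N := w (j + 1)) (by rw [hws]; omega)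
    (hvw _ hj) hη
  have hwjJ : w (j + 1) ≤ W (i + 1) := hwJ ▸ hwm hj
  have e1 : μ.real (Zs (adjX S X0) σ Y r (w j)) ≤ μ.real (Zs (adjX S X0) σ Y r (W (i + 1))) :=
    measureReal_mono (Zs.mono (by have := hws j; omega))
  have e2 : μ.real (As (adjX S X0) σ Y (w j + 1)) ≤ μ.real (As (adjX S X0) σ Y T) :=
    measureReal_mono (As.mono (by have := hws j; omega))
  have e3 : 2 * (S.card:ℝ) * (η' * μ.real A + η' * μ.real A) = η1 / 2 * μ.real A := by
    rw [hη']; field_simp; ring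
  have e4 : 2 * (S.card:ℝ) * (μ.real (D j) +
        (μ.real (Zs (adjX S X0) σ Y r (w j)) - μ.real (Zs (adjX S X0) σ Y r (W i)))) ≤
      2 * (S.card:ℝ) * (η' * μ.real A + η' * μ.real A) := by
    apply mul_le_mul_of_nonneg_left _ (by positivity); linarith
  have e5 : η1 / 2 * μ.real A ≤ 2 * S.card * (μ.real (As (adjX S X0) σ Y (w j + 1)) - μ.real A) := by
    simp only [hD] at e4; linarith
  have e6 : η1 / (4 * S.card) * μ.real A ≤ μ.real (As (adjX S X0) σ Y (w j + 1)) - μ.real A := by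
    rw [div_mul_eq_mul_div, div_le_iff₀ (by positivity)]; linarith
  linarith
end GrowI
end PaperPM

open scoped Classical Pointwise
open MeasureTheory
namespace PaperPM
section GrowII
variable {Γ : Type*} [Group Γ] [Countable Γ] {X : Type*} [MeasurableSpace X] [MulAction Γ X]
set_option linter.unusedSectionVars false
set_option linter.deprecated false
variable {S : Finset Γ} {μ : Measure X} [IsProbabilityMeasure μ] {c κ : ℝ} {X0 : Set X}
  {σ : X → X} {τ : X → Γ} {Y : Set X}

lemma As0 (H : Sys (adjX S X0) σ Y) : Y ⊆ As (adjX S X0) σ Y 0 :=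
  fun y hy => Or.inr (Bs.of_mem (by rwa [H.inv]))

lemma growIter {C K : ℕ} {η : ℝ} (hη : 0 < η) (H : Sys (adjX S X0) σ Y) {R : ℕ → ℕ} (hR0 : R 0 = 0)
    (hR : ∀ k, R (k + 1) = C * (R k + 1) ^ K) (hRm : Monotone R)
    (hg : ∀ r, Valid (adjX S X0) σ Y (C * (r + 1) ^ K) →
      (1 + η) * μ.real (As (adjX S X0) σ Y r) ≤ μ.real (As (adjX S X0) σ Y (C * (r + 1) ^ K))) (m : ℕ)
    (hv : Valid (adjX S X0) σ Y (R m)) : (1 + η) ^ m * μ.real Y ≤ μ.real (As (adjX S X0) σ Y (R m)) := by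
  induction m with
  | zero => rw [hR0, pow_zero, one_mul]; exact measureReal_mono (As0 H)
  | succ m ih =>
    have h1 := ih (hv.mono (hRm (by omega)))
    rw [hR] at hv ⊢
    have h2 := hg _ hv
    rw [pow_succ', mul_assoc]
    exact (mul_le_mul_of_nonneg_left h1 (by linarith)).trans h2

lemma Bse.growII (B : Bse S μ c κ) {η : ℝ} (hη : 0 < η) {C K : ℕ} (hC : 1 ≤ C) (hK : 1 ≤ K)
    (hg : ∀ (X0 : Set X) (σ : X → X) (τ : X → Γ) (Y : Set X) (r : ℕ), Mtc S μ X0 σ τ →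
    Sys (adjX S X0) σ Y → MeasurableSet Y → Valid (adjX S X0) σ Y (C * (r + 1) ^ K) →
    (1 + η) * μ.real (As (adjX S X0) σ Y r) ≤ μ.real (As (adjX S X0) σ Y (C * (r + 1) ^ K)))
    {θ : ℝ} (hθ : 0 < θ) : ∃ (T : ℕ) (η2 : ℝ), 0 < η2 ∧
    ∀ (X0 : Set X) (σ : X → X) (τ : X → Γ) (Y : Set X) (t : ℕ), Mtc S μ X0 σ τ →
    Sys (adjX S X0) σ Y → MeasurableSet Y → Valid (adjX S X0) σ Y (t + T) →
    μ.real (As (adjX S X0) σ Y t) ≤ 1 - θ →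
    (1 + η2) * μ.real (As (adjX S X0) σ Y t) ≤ μ.real (As (adjX S X0) σ Y (t + T)) := by
  have k1 := B.k1
  have hd : (1:ℝ) ≤ S.card := by exact_mod_cast B.ne.card_pos
  set κ1 : ℝ := (1 - κ) * θ / (2 * S.card) with hκ1
  have hκ1p : 0 < κ1 := by
    have : 0 < 1 - κ := by linarith
    positivity
  obtain ⟨m, hm⟩ := pow_unbounded_of_one_lt (2 / κ1) (show 1 < 1 + η by linarith)
  set R : ℕ → ℕ := fun k => Nat.rec 0 (fun _ p => C * (p + 1) ^ K) k with hRd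
  have hR0 : R 0 = 0 := rfl
  have hR : ∀ k, R (k + 1) = C * (R k + 1) ^ K := fun k => rfl
  have hRm : Monotone R := monotone_nat_of_le_succ fun k => by
    rw [hR]
    calc R k ≤ R k + 1 := by omega
      _ = (R k + 1) ^ 1 := by simp
      _ ≤ (R k + 1) ^ K := Nat.pow_le_pow_right (by omega) hK
      _ ≤ C * (R k + 1) ^ K := Nat.le_mul_of_pos_left _ (by omega)
  refine ⟨R m + 3, min 1 ((1 - κ) * θ / 2), lt_min one_pos (by
    have : 0 < 1 - κ := by linarith
    positivity), ?_⟩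
  intro X0 σ τ Y t M H hYm hv ht
  set w := t + R m + 2 with hw
  have hvw : Valid (adjX S X0) σ Y w := hv.mono (by omega)
  set Y' := Yp (adjX S X0) σ Y t w with hY'
  have hY'm : MeasurableSet Y' := M.m_Yp B hYm t w
  have H' : Sys (adjX S X0) σ Y' := H.sysYp (by omega) hvw
  have g1 := growIter hη H' hR0 hR hRm (fun r hr => hg X0 σ τ Y' r M H' hY'm hr) m
    (H.validYp (by omega) hvw)
  have g2 : μ.real (As (adjX S X0) σ Y' (R m)) ≤ μ.real (As (adjX S X0) σ Y w) :=
    measureReal_mono (H.Yp_As le_rfl hvw)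
  have g3 : μ.real (As (adjX S X0) σ Y w) ≤ μ.real (As (adjX S X0) σ Y (t + (R m + 3))) :=
    measureReal_mono (As.mono (by omega))
  have g4 : t + (R m + 3) = w + 1 := by omega
  rw [g4] at g3 ⊢
  obtain ⟨-, pt2, -, -⟩ := M.part B H hYm t w
  set A := As (adjX S X0) σ Y t with hA
  set A1 := As (adjX S X0) σ Y (w + 1) with hA1
  have hmA : MeasurableSet A := M.m_As B hYm t
  have hA0 : 0 ≤ μ.real A := measureReal_nonneg
  have hexp := B.exp' hmA
  have hNb : Nb S A ⊆ (A1 ∪ ⋃ s ∈ S, (fun x => s • x) ⁻¹' (σ ⁻¹' Y')) ∪ X0ᶜ := by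
    rintro x ⟨s, hs, hsx⟩
    by_cases hx0 : x ∈ X0
    swap
    · exact Or.inr hx0
    left
    rw [pt2] at hsx
    rcases hsx with h | h
    · left
      have hB : Bs (adjX S X0) σ Y w (σ (s • x)) := by
        rcases h with h | h
        · exact (H.Zs_B (by omega) hvw h).2
        · exact h.1.mono (by omega)
      exact H.out_As hB (adj_symm B M _ _ ⟨hx0, s, hs, rfl⟩)
    · right
      exact Set.mem_biUnion hs h.1
  have hX0 : μ.real X0ᶜ = 0 := by simp [measureReal_def, M.X0n]
  have u1 := measureReal_mono (μ := μ) hNb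
  have u2 := measureReal_union_le (μ := μ) (A1 ∪ ⋃ s ∈ S, (fun x => s • x) ⁻¹' (σ ⁻¹' Y')) X0ᶜ
  have u3 := measureReal_union_le (μ := μ) A1 (⋃ s ∈ S, (fun x => s • x) ⁻¹' (σ ⁻¹' Y'))
  have u4 := measureReal_biUnion_finset_le (μ := μ) S (fun s => (fun x => s • x) ⁻¹' (σ ⁻¹' Y'))
  have u5 : ∑ s ∈ S, μ.real ((fun x => s • x) ⁻¹' (σ ⁻¹' Y')) = S.card * μ.real Y' := by
    rw [Finset.sum_congr rfl fun s _ => (B.mp s).measureReal_preimage (show MeasurableSet (σ ⁻¹' Y') from M.sm B hY'm).nullMeasurableSet]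
    rw [(M.mp B).measureReal_preimage hY'm.nullMeasurableSet]
    simp
  have u6 : (1 - κ) * θ * μ.real A ≤ (1 - κ) * (1 - μ.real A) * μ.real A := by
    gcongr <;> linarith
  by_cases hc : κ1 * μ.real A ≤ μ.real Y'
  · have e1 : 2 * μ.real A ≤ (1 + η) ^ m * μ.real Y' := by
      have e2 : 2 ≤ (1 + η) ^ m * κ1 := by
        rw [div_lt_iff₀ hκ1p] at hm; exact hm.le
      calc 2 * μ.real A ≤ (1 + η) ^ m * κ1 * μ.real A := by gcongr
        _ = (1 + η) ^ m * (κ1 * μ.real A) := by ring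
        _ ≤ _ := by gcongr
    have e3 := min_le_left 1 ((1 - κ) * θ / 2)
    nlinarith
  · push Not at hc
    have e1 : S.card * μ.real Y' ≤ (1 - κ) * θ / 2 * μ.real A := by
      have : S.card * (κ1 * μ.real A) = (1 - κ) * θ / 2 * μ.real A := by
        rw [hκ1]; field_simp
      rw [← this]; gcongr
    have e3 := min_le_right 1 ((1 - κ) * θ / 2)
    nlinarith

lemma polyexp (C K T : ℕ) {p : ℝ} (hp : 1 < p) : ∃ C' : ℝ, ∀ k : ℕ, (C * (k * T + 1) ^ K : ℝ) ≤ C' * p ^ k := by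
  obtain ⟨b, hb⟩ := (tendsto_pow_const_div_const_pow_of_one_lt K hp).bddAbove_range
  refine ⟨C * (T + 1) ^ K * (b * p), fun k => ?_⟩
  have h1 : ((k + 1 : ℕ) : ℝ) ^ K / p ^ (k + 1) ≤ b := hb ⟨k + 1, rfl⟩
  rw [div_le_iff₀ (by positivity)] at h1
  have h2 : ((k:ℝ) * T + 1) ≤ (T + 1) * ((k + 1 : ℕ) : ℝ) := by
    push_cast
    have : (0:ℝ) ≤ k := by positivity
    have : (0:ℝ) ≤ T := by positivity
    nlinarith
  calc (C * (k * T + 1) ^ K : ℝ) ≤ C * ((T + 1) * ((k + 1 : ℕ) : ℝ)) ^ K := by gcongr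
    _ = C * (T + 1) ^ K * ((k + 1 : ℕ) : ℝ) ^ K := by rw [mul_pow]; ring
    _ ≤ C * (T + 1) ^ K * (b * p ^ (k + 1)) := by gcongr
    _ = _ := by ring

lemma Bse.short (B : Bse S μ c κ) : ∃ C0 : ℝ, 0 < C0 ∧
    ∀ (X0 : Set X) (σ : X → X) (τ : X → Γ) (Y : Set X) (n : ℕ), Mtc S μ X0 σ τ →
    Sys (adjX S X0) σ Y → MeasurableSet Y → 0 < μ.real Y → C0 / √(μ.real Y) ≤ n →
    ¬ Valid (adjX S X0) σ Y n := by
  obtain ⟨η, hη, C, K, hC, hK, hg⟩ := growI B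
  set θ : ℝ := η / (2 * (1 + η)) with hθ
  have hθ0 : 0 < θ := by positivity
  have hθ1 : 1 < (1 + η) * (1 - θ) := by
    have : (1 + η) * θ = η / 2 := by rw [hθ]; field_simp
    nlinarith
  obtain ⟨T, η2, hη2, hII⟩ := B.growII hη hC hK hg hθ0
  set p : ℝ := √(1 + η2) with hp
  have hp2 : p ^ 2 = 1 + η2 := Real.sq_sqrt (by linarith)
  have hp1 : 1 < p := by rw [hp, Real.lt_sqrt] <;> linarith
  obtain ⟨C', hC'⟩ := polyexp C K T hp1
  have hC'0 : 0 < C' := by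
    have := hC' 0
    simp at this
    have h : (1:ℝ) ≤ C := by exact_mod_cast hC
    linarith
  refine ⟨C' * p, by positivity, ?_⟩
  intro X0 σ τ Y n M H hYm hY hn hv
  set ε := μ.real Y with hε
  have hε1 : ε ≤ 1 := measureReal_le_one
  have hsq : 0 < √ε := Real.sqrt_pos.2 hY
  have hex : ∃ k : ℕ, 1 / √ε < p ^ k := pow_unbounded_of_one_lt _ hp1
  set k := Nat.find hex with hk
  have hk1 : 1 / √ε < p ^ k := Nat.find_spec hex
  have hk2 : p ^ k ≤ p * (1 / √ε) := by
    rcases Nat.eq_zero_or_pos k with h0 | h0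
    · rw [h0, pow_zero]
      have : 1 ≤ 1 / √ε := by rw [le_div_iff₀ hsq, one_mul]; exact Real.sqrt_le_one.2 hε1
      nlinarith
    · have := Nat.find_min hex (m := k - 1) (by omega)
      push Not at this
      obtain ⟨j, hj⟩ : ∃ j, k = j + 1 := ⟨k - 1, by omega⟩
      rw [hj] at this ⊢
      rw [pow_succ']
      simp at this ⊢
      gcongr
  have hkn : C * (k * T + 1) ^ K ≤ n := by
    have : (C * (k * T + 1) ^ K : ℝ) ≤ n := by
      calc (C * (k * T + 1) ^ K : ℝ) ≤ C' * p ^ k := hC' k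
        _ ≤ C' * (p * (1 / √ε)) := by gcongr
        _ = C' * p / √ε := by ring
        _ ≤ n := hn
    exact_mod_cast this
  have hpow : ∀ j ≤ k, j * T ≤ C * (j * T + 1) ^ K ∧ C * (j * T + 1) ^ K ≤ n := by
    intro j hj
    constructor
    · calc j * T ≤ (j * T + 1) ^ 1 := by rw [pow_one]; omega
        _ ≤ (j * T + 1) ^ K := Nat.pow_le_pow_right (by omega) hK
        _ ≤ C * (j * T + 1) ^ K := Nat.le_mul_of_pos_left _ (by omega)
    · refine le_trans ?_ hkn
      gcongr
  have hsmall : ∀ j ≤ k, μ.real (As (adjX S X0) σ Y (j * T)) ≤ 1 - θ := by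
    intro j hj
    by_contra h
    push Not at h
    have h1 := hg X0 σ τ Y (j * T) M H hYm (hv.mono (hpow j hj).2)
    have h2 : μ.real (As (adjX S X0) σ Y (C * (j * T + 1) ^ K)) ≤ 1 := measureReal_le_one
    nlinarith
  have hgr : ∀ j ≤ k, (1 + η2) ^ j * ε ≤ μ.real (As (adjX S X0) σ Y (j * T)) := by
    intro j
    induction j with
    | zero => intro _; rw [zero_mul, pow_zero, one_mul]; exact measureReal_mono (As0 H)
    | succ j ih =>
      intro hj
      have h1 := ih (by omega)
      have hT1 : (j + 1) * T = j * T + T := by ring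
      have h2 := hII X0 σ τ Y (j * T) M H hYm (hv.mono (by
        have := hpow (j + 1) hj; omega)) (hsmall j (by omega))
      rw [hT1, pow_succ', mul_assoc]
      exact (mul_le_mul_of_nonneg_left h1 (by linarith)).trans h2
  have h1 := hgr k le_rfl
  have h2 : μ.real (As (adjX S X0) σ Y (k * T)) ≤ 1 := measureReal_le_one
  rw [← hp2, ← pow_mul, mul_comm 2 k, pow_mul] at h1
  have h3 : 1 < p ^ k * √ε := by rwa [div_lt_iff₀ hsq] at hk1
  have h4 : (p ^ k) ^ 2 * ε = (p ^ k * √ε) ^ 2 := by rw [mul_pow, Real.sq_sqrt hY.le]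
  nlinarith
end GrowII
end PaperPM

open scoped Classical Pointwise
open MeasureTheory
namespace PaperPM
section Flip
set_option linter.unusedSectionVars false
set_option linter.deprecated false

/-- the augmentation of a path -/
lemma augment {V : Type*} {adj : V → V → Prop} {σ : V → V} {Y : Set V} (H : Sys adj σ Y)
    (hfx : ∀ y ∈ Y, σ y = y) (l : List V) : ∀ a, Pth adj σ Y l → Ext adj σ l a →
    ∃ (P : Finset V) (ρ : V → V), P.card ≤ 2 * l.length ∧ a ∈ P ∧ (∀ x ∈ P, x = a ∨ nd σ l x) ∧
      (∀ x ∈ P, ρ x ∈ P ∧ ρ (ρ x) = x ∧ adj x (ρ x)) ∧ (∀ x ∈ P, x ≠ a → σ x ∈ P ∧ σ x ≠ a) ∧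
      (∃ z ∈ P, z ≠ a ∧ σ z = z) ∧ ∀ O : Set V, (∀ x y, adj x y → x ∈ O → y ∈ O) →
        (∀ x ∈ O, σ x ∈ O) → a ∈ O → ∀ x ∈ P, x ∈ O := by
  induction l with
  | nil => intro a h; exact h.elim
  | cons v l ih =>
    rintro a h ⟨h1, h2⟩
    have hav : a ≠ v := fun h => h2 (Or.inl (by simp [h]))
    have hav' : a ≠ σ v := fun h => h2 (Or.inr (by simp [h, H.inv]))
    rcases h with ⟨rfl, h3⟩ | ⟨h3, h4, h5⟩
    · have hv : σ v = v := by have := hfx _ h3; rw [H.inv] at this; exact this.symm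
      rw [hv] at h1
      refine ⟨{a, v}, fun x => if x = a then v else a, Finset.card_le_two, by simp, ?_, ?_, ?_, ?_, ?_⟩
      · intro x hx
        simp only [Finset.mem_insert, Finset.mem_singleton] at hx
        rcases hx with rfl | rfl
        · exact Or.inl rfl
        · exact Or.inr (Or.inl (by simp))
      · intro x hx
        simp only [Finset.mem_insert, Finset.mem_singleton] at hx
        rcases hx with rfl | rfl
        · simp [hav.symm, H.symm _ _ h1]
        · simp [hav.symm, h1]
      · intro x hx hxa
        simp only [Finset.mem_insert, Finset.mem_singleton] at hx
        have := hx.resolve_left hxa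
        subst this
        simp [hv, hav.symm]
      · exact ⟨v, by simp, hav.symm, hv⟩
      · intro O hO1 hO2 ha x hx
        simp only [Finset.mem_insert, Finset.mem_singleton] at hx
        rcases hx with rfl | rfl
        · exact ha
        · exact hO1 _ _ (H.symm _ _ h1) ha
    · obtain ⟨P, ρ, q1, q2, q3, q4, q5, ⟨z, z1, z2, z3⟩, q7⟩ := ih v h5 h4
      have hvv : σ v ≠ v := fun h => h3.1 (H.fix _ h)
      have hvl : ¬ nd σ l v := by
        cases l with
        | nil => exact h4.elim
        | cons b l => exact h4.2
      have hvP : σ v ∉ P := by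
        intro h
        rcases q3 _ h with h | h
        · exact hvv h
        · apply hvl
          rcases h with h | h
          · exact Or.inr h
          · rw [H.inv] at h; exact Or.inl h
      have haP : a ∉ P := by
        intro h
        apply h2
        rcases q3 _ h with rfl | h
        · exact Or.inl (by simp)
        · rcases h with h | h
          · exact Or.inl (by simp [h])
          · exact Or.inr (by simp [h])
      refine ⟨insert a (insert (σ v) P), fun x => if x = a then σ v else if x = σ v then a else ρ x,
        ?_, by simp, ?_, ?_, ?_, ?_, ?_⟩
      · refine (Finset.card_insert_le _ _).trans ?_
        have := Finset.card_insert_le (σ v) P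
        simp only [List.length_cons]; omega
      · intro x hx
        simp only [Finset.mem_insert] at hx
        rcases hx with rfl | rfl | hx
        · exact Or.inl rfl
        · exact Or.inr (Or.inr (by simp [H.inv]))
        · right
          rcases q3 _ hx with rfl | h
          · exact Or.inl (by simp)
          · rcases h with h | h
            · exact Or.inl (by simp [h])
            · exact Or.inr (by simp [h])
      · intro x hx
        simp only [Finset.mem_insert] at hx
        rcases hx with rfl | rfl | hx
        · simp [hav'.symm, H.symm _ _ h1]
        · simp [hav'.symm, h1]
        · have n1 : x ≠ a := fun h => haP (h ▸ hx)
          have n2 : x ≠ σ v := fun h => hvP (h ▸ hx)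
          obtain ⟨r1, r2, r3⟩ := q4 x hx
          have n3 : ρ x ≠ a := fun h => haP (h ▸ r1)
          have n4 : ρ x ≠ σ v := fun h => hvP (h ▸ r1)
          simp [n1, n2, n3, n4, r1, r2, r3]
      · intro x hx hxa
        simp only [Finset.mem_insert] at hx
        rcases hx.resolve_left hxa with rfl | hx
        · rw [H.inv]; exact ⟨by simp [q2], hav.symm⟩
        · by_cases hxv : x = v
          · subst hxv; exact ⟨by simp, hav'.symm⟩
          · have := q5 x hx hxv
            exact ⟨by simp [this.1], fun h => haP (h ▸ this.1)⟩
      · exact ⟨z, by simp [z1], fun h => haP (h ▸ z1), z3⟩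
      · intro O hO1 hO2 ha x hx
        have hv1 : σ v ∈ O := hO1 _ _ (H.symm _ _ h1) ha
        have hv2 : v ∈ O := by have := hO2 _ hv1; rwa [H.inv] at this
        simp only [Finset.mem_insert] at hx
        rcases hx with rfl | rfl | hx
        · exact ha
        · exact hv1
        · exact q7 O hO1 hO2 hv2 x hx

lemma pth_adj_mono {V : Type*} {adj adj' : V → V → Prop} {σ : V → V} {Y : Set V}
    (h : ∀ a b, adj a b → adj' a b) {l : List V} (hp : Pth adj σ Y l) : Pth adj' σ Y l := by
  induction l with
  | nil => exact hp
  | cons v l ih =>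
    rcases hp with h0 | ⟨h1, h2, h3⟩
    · exact Or.inl h0
    · refine Or.inr ⟨h1, ?_, ih h3⟩
      cases l with
      | nil => exact h2
      | cons b l => exact ⟨h _ _ h2.1, h2.2⟩

variable {Γ : Type*} [Group Γ] [Countable Γ] {X : Type*} [MeasurableSpace X] [MulAction Γ X]
variable {S : Finset Γ} {μ : Measure X} [IsProbabilityMeasure μ] {c κ : ℝ} {X0 : Set X}
  {σ : X → X} {τ : X → Γ} {Y : Set X}

/-- matchings as maps to the group -/
def Mt (S : Finset Γ) (μ : Measure X) (τ : X → Γ) : Prop := Mtc S μ Set.univ (fun x => τ x • x) τ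

lemma Mtc.sysFix (B : Bse S μ c κ) (M : Mtc S μ X0 σ τ) : Sys (adjX S X0) σ {x | τ x = 1} where
  symm := adj_symm B M
  inv := M.inv
  hY y hy _ := by rw [M.st]; simp at hy; simp [hy]
  fix y hy := by rw [M.st] at hy; exact B.free _ _ hy

def GoodR (S : Finset Γ) (n : ℕ) (R : Finset (Γ × Γ)) : Prop :=
  R.card ≤ 2 * n ∧ (∀ g h, (g, h) ∈ R → (h, g) ∈ R ∧ h * g⁻¹ ∈ S) ∧
  ∀ g h h', (g, h) ∈ R → (g, h') ∈ R → h = h'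

def PatS (τ : X → Γ) (R : Finset (Γ × Γ)) (q : Γ) : Set X :=
  {y | τ y = 1 ∧ τ (q • y) = 1 ∧ ∀ p ∈ R, ∃ p' ∈ R, τ (p.1 • y) * p.1 = p'.1}

lemma pat_m (B : Bse S μ c κ) (M : Mt S μ τ) (R : Finset (Γ × Γ)) (q : Γ) : MeasurableSet (PatS τ R q) := by
  have : PatS τ R q = {y | τ y = 1} ∩ ({y | τ (q • y) = 1} ∩ ⋂ p ∈ R, ⋃ p' ∈ R, {y | τ (p.1 • y) = p'.1 * p.1⁻¹}) := by
    ext y; simp [PatS, eq_mul_inv_iff_mul_eq]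
  rw [this]
  exact (M.tm 1).inter ((Mtc.tmg B M _ _).inter (Finset.measurableSet_biInter _ fun p _ =>
    Finset.measurableSet_biUnion _ fun p' _ => Mtc.tmg B M _ _))

lemma exists_pat (B : Bse S μ c κ) (M : Mt S μ τ) {n : ℕ} {y : X} (hy : τ y = 1)
    (hr : Rch (adjX S Set.univ) (fun x => τ x • x) {x | τ x = 1} n y) :
    ∃ R q, GoodR S n R ∧ q ≠ 1 ∧ (∃ p ∈ R, p.1 = q) ∧ (∃ p ∈ R, p.1 = 1) ∧ y ∈ PatS τ R q := by
  obtain ⟨l, h1, h2, h3⟩ := hr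
  have H := Mtc.sysFix B M
  obtain ⟨P, ρ, q1, q2, -, q4, q5, ⟨z, z1, z2, z3⟩, q7⟩ := augment H (by
    intro y hy; simp at hy; simp [hy]) l y h1 h3
  have fr : ∀ {a b : Γ}, a • y = b • y ↔ a = b := Mtc.free' B M
  have horb : ∀ x ∈ P, ∃ g : Γ, x = g • y := q7 {x | ∃ g : Γ, x = g • y}
    (by rintro x z ⟨_, s, _, rfl⟩ ⟨g, rfl⟩; exact ⟨s * g, (mul_smul _ _ _).symm⟩)
    (by rintro x ⟨g, rfl⟩; exact ⟨τ (g • y) * g, (mul_smul _ _ _).symm⟩) ⟨1, by simp⟩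
  choose! γ hγ using horb
  set R : Finset (Γ × Γ) := P.image fun x => (γ x, γ (ρ x)) with hR
  have hmem : ∀ g h, (g, h) ∈ R ↔ ∃ x ∈ P, g = γ x ∧ h = γ (ρ x) := by
    intro g h; simp [hR, eq_comm]
  have hinj : ∀ x ∈ P, ∀ x' ∈ P, γ x = γ x' → x = x' := by
    intro x hx x' hx' h
    rw [hγ x hx, hγ x' hx', h]
  have hfst : ∀ x ∈ P, ∃ p ∈ R, p.1 = γ x := fun x hx => ⟨(γ x, γ (ρ x)), (hmem _ _).2 ⟨x, hx, rfl, rfl⟩, rfl⟩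
  have h1y : γ y = 1 := by
    rw [← fr, ← hγ y q2, one_smul]
  refine ⟨R, γ z, ⟨?_, ?_, ?_⟩, ?_, hfst z z1, by rw [← h1y]; exact hfst y q2, hy, ?_, ?_⟩
  · exact Finset.card_image_le.trans (q1.trans (by omega))
  · intro g h hgh
    obtain ⟨x, hx, rfl, rfl⟩ := (hmem _ _).1 hgh
    obtain ⟨r1, r2, -, s, hs, r3⟩ := q4 x hx
    refine ⟨(hmem _ _).2 ⟨ρ x, r1, rfl, by rw [r2]⟩, ?_⟩
    have : γ (ρ x) = s * γ x := by
      rw [← fr, ← hγ _ r1, mul_smul, ← hγ x hx, r3]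
    rw [this]; simpa using hs
  · intro g h h' hh hh'
    obtain ⟨x, hx, rfl, rfl⟩ := (hmem _ _).1 hh
    obtain ⟨x', hx', e, rfl⟩ := (hmem _ _).1 hh'
    rw [hinj x hx x' hx' e]
  · intro h
    apply z2
    exact hinj z z1 y q2 (by rw [h, h1y])
  · rw [← hγ z z1]
    exact H.fix z z3
  · intro p hp
    obtain ⟨x, hx, e1, -⟩ := (hmem p.1 p.2).1 hp
    have hsx : τ x • x ∈ P := by
      by_cases hxy : x = y
      · subst hxy; simpa [hy] using hx
      · exact (q5 x hx hxy).1
    obtain ⟨p', hp', e2⟩ := hfst _ hsx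
    refine ⟨p', hp', ?_⟩
    rw [e2, e1, ← fr, mul_smul, ← hγ x hx, ← hγ _ hsx]
end Flip
end PaperPM

open scoped Classical Pointwise
open MeasureTheory
namespace PaperPM
section Flip2
set_option linter.unusedSectionVars false
set_option linter.deprecated false
variable {Γ : Type*} [Group Γ] [Countable Γ] {X : Type*} [MeasurableSpace X] [MulAction Γ X]
variable {S : Finset Γ} {μ : Measure X} [IsProbabilityMeasure μ] {c κ : ℝ} {τ : X → Γ}

lemma rch_pos (B : Bse S μ c κ) (M : Mt S μ τ) {n : ℕ}
    (hsh : ∀ (X0 : Set X), Mtc S μ X0 (fun x => τ x • x) τ →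
      ¬ Valid (adjX S X0) (fun x => τ x • x) {x | τ x = 1} n) :
    μ {y | τ y = 1 ∧ Rch (adjX S Set.univ) (fun x => τ x • x) {x | τ x = 1} n y} ≠ 0 := by
  intro h0
  set N := {y | τ y = 1 ∧ Rch (adjX S Set.univ) (fun x => τ x • x) {x | τ x = 1} n y} with hN
  have hNm : MeasurableSet N := (M.tm 1).inter (Mtc.m_Rch B M (M.tm 1) n)
  set X0 : Set X := ⋂ g : Γ, {x | g • x ∈ N}ᶜ with hX0
  have M' : Mtc S μ X0 (fun x => τ x • x) τ := by
    refine ⟨M.st, M.inv, M.ts, M.tm, MeasurableSet.iInter fun g => (Mtc.gm B M hNm g).compl, ?_, ?_⟩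
    · intro g x
      simp only [hX0, Set.mem_iInter, Set.mem_compl_iff, Set.mem_setOf_eq, ← mul_smul]
      constructor
      · intro h k
        have := h (k * g⁻¹)
        simpa using this
      · intro h k; exact h _
    · rw [hX0, Set.compl_iInter, measure_iUnion_null_iff]
      intro g
      rw [compl_compl]
      exact ((B.mp g).measure_preimage hNm.nullMeasurableSet).trans h0
  refine hsh X0 M' fun y hy hr => ?_
  obtain ⟨l, h1, h2, h3⟩ := hr
  have hmono : ∀ a b : X, adjX S X0 a b → adjX S Set.univ a b := fun a b h => ⟨trivial, h.2⟩
  cases l with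
  | nil => exact h1.elim
  | cons b l =>
    have hy0 : y ∈ X0 := (adj_symm B M' _ _ h3.1).1
    have := Set.mem_iInter.1 hy0 1
    apply this
    simp only [Set.mem_setOf_eq, one_smul]
    exact ⟨hy, _, pth_adj_mono hmono h1, h2, hmono _ _ h3.1, h3.2⟩

lemma flip (B : Bse S μ c κ) (hS1 : (1:Γ) ∉ S) (M : Mt S μ τ) {n : ℕ} {R : Finset (Γ × Γ)} {q : Γ}
    (hR : GoodR S n R) (hq : q ≠ 1) (hq1 : ∃ p ∈ R, p.1 = q) (hq2 : ∃ p ∈ R, p.1 = 1) {D : Set X}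
    (hDm : MeasurableSet D) (hD : D ⊆ PatS τ R q)
    (hdis : ∀ p ∈ R, ∀ p' ∈ R, ∀ x ∈ D, ∀ x' ∈ D, p.1 • x = p'.1 • x' → p.1 = p'.1) :
    ∃ τ' : X → Γ, Mt S μ τ' ∧ μ.real {x | τ' x = 1} ≤ μ.real {x | τ x = 1} - 2 * μ.real D ∧
      μ.real {x | τ x ≠ τ' x} ≤ 2 * n * μ.real D := by
  obtain ⟨hc, hR1, hR2⟩ := hR
  set τ' : X → Γ := fun x => if h : ∃ p ∈ R, p.1⁻¹ • x ∈ D then h.choose.2 * h.choose.1⁻¹ else τ x with hτ'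
  have t1 : ∀ p ∈ R, ∀ x, p.1⁻¹ • x ∈ D → τ' x = p.2 * p.1⁻¹ := by
    intro p hp x hx
    have h : ∃ p ∈ R, p.1⁻¹ • x ∈ D := ⟨p, hp, hx⟩
    simp only [hτ', dif_pos h]
    obtain ⟨a1, a2⟩ := h.choose_spec
    have e : h.choose.1 = p.1 := hdis _ a1 _ hp _ a2 _ hx (by simp)
    have e2 : h.choose.2 = p.2 := hR2 p.1 _ _ (by rw [← e]; exact a1) hp
    rw [e, e2]
  have t2 : ∀ x, (∀ p ∈ R, p.1⁻¹ • x ∉ D) → τ' x = τ x := by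
    intro x hx
    have h : ¬ ∃ p ∈ R, p.1⁻¹ • x ∈ D := by push Not; exact hx
    simp only [hτ', dif_neg h]
  have hmD : ∀ g : Γ, MeasurableSet {x | g • x ∈ D} := fun g => Mtc.gm B M hDm g
  have hpD : ∀ g : Γ, μ.real {x | g • x ∈ D} = μ.real D := fun g =>
    (B.mp g).measureReal_preimage hDm.nullMeasurableSet
  refine ⟨τ', ⟨fun x => rfl, ?_, ?_, ?_, MeasurableSet.univ, by simp, by simp⟩, ?_, ?_⟩
  · intro x
    by_cases h : ∃ p ∈ R, p.1⁻¹ • x ∈ D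
    · obtain ⟨p, hp, hx⟩ := h
      have e := t1 p hp x hx
      have e2 := t1 (p.2, p.1) (hR1 _ _ hp).1 (τ' x • x) (by
        rw [e, ← mul_smul]; simpa using hx)
      show τ' (τ' x • x) • τ' x • x = x
      rw [e2, e, ← mul_smul]; simp
    · push Not at h
      have e := t2 x h
      have e2 := t2 (τ x • x) (by
        intro p hp hx
        obtain ⟨p', hp', h3⟩ := (hD hx).2.2 p hp
        rw [smul_inv_smul] at h3
        refine h p' hp' ?_
        rw [← h3]
        have := M.inv x
        rw [← this, ← mul_smul]
        simpa [this] using hx)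
      simp only [e, e2]
      exact M.inv x
  · intro x
    by_cases h : ∃ p ∈ R, p.1⁻¹ • x ∈ D
    · obtain ⟨p, hp, hx⟩ := h
      rw [t1 p hp x hx]
      exact Or.inr (hR1 _ _ hp).2
    · push Not at h
      rw [t2 x h]; exact M.ts x
  · intro γ
    have : {x | τ' x = γ} = (⋃ p ∈ R, ({x | p.1⁻¹ • x ∈ D} ∩ {_x | p.2 * p.1⁻¹ = γ})) ∪
        ((⋃ p ∈ R, {x | p.1⁻¹ • x ∈ D})ᶜ ∩ {x | τ x = γ}) := by
      ext x
      by_cases h : ∃ p ∈ R, p.1⁻¹ • x ∈ D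
      · obtain ⟨p, hp, hx⟩ := h
        have e := t1 p hp x hx
        constructor
        · intro h
          left
          refine Set.mem_biUnion hp ⟨hx, ?_⟩
          rw [← h]; exact e.symm
        · rintro (h | h)
          · obtain ⟨p', hp', h1, h2⟩ := Set.mem_iUnion₂.1 h
            exact (t1 p' hp' x h1).trans h2
          · exact absurd (Set.mem_biUnion hp hx) h.1
      · have e := t2 x (by push Not at h; exact h)
        constructor
        · intro h'
          right
          refine ⟨fun h1 => h ?_, e.symm.trans h'⟩
          obtain ⟨p', hp', h1⟩ := Set.mem_iUnion₂.1 h1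
          exact ⟨p', hp', h1⟩
        · rintro (h1 | h1)
          · obtain ⟨p', hp', h1, h2⟩ := Set.mem_iUnion₂.1 h1
            exact absurd ⟨p', hp', h1⟩ h
          · exact e.trans h1.2
    rw [this]
    exact (Finset.measurableSet_biUnion _ fun p _ => (hmD _).inter (MeasurableSet.const _)).union
      ((Finset.measurableSet_biUnion _ fun p _ => hmD _).compl.inter (M.tm γ))
  · obtain ⟨p1, hp1, e1⟩ := hq1
    obtain ⟨p2, hp2, e2⟩ := hq2
    have d1 : Disjoint D {x | q⁻¹ • x ∈ D} := by
      rw [Set.disjoint_left]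
      intro x hx hx'
      apply hq
      rw [← e1, ← e2]
      exact hdis _ hp1 _ hp2 _ hx' _ hx (by rw [e1, e2]; simp)
    have d2 : Disjoint (D ∪ {x | q⁻¹ • x ∈ D}) {x | τ' x = 1} := by
      have key : ∀ p ∈ R, ∀ x, p.1⁻¹ • x ∈ D → τ' x ≠ 1 := fun p hp x hx h =>
        hS1 (by rw [← h, t1 p hp x hx]; exact (hR1 _ _ hp).2)
      rw [Set.disjoint_left]
      rintro x (hx | hx)
      · exact key p2 hp2 x (by rw [e2]; simpa using hx)
      · exact key p1 hp1 x (by rw [e1]; exact hx)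
    have hsub : (D ∪ {x | q⁻¹ • x ∈ D}) ∪ {x | τ' x = 1} ⊆ {x | τ x = 1} := by
      rintro x ((hx | hx) | hx)
      · exact (hD hx).1
      · have := (hD hx).2.1
        rwa [smul_inv_smul] at this
      · by_cases h : ∃ p ∈ R, p.1⁻¹ • x ∈ D
        · obtain ⟨p, hp, h⟩ := h
          have e := t1 p hp x h
          exact absurd ((e ▸ hx : p.2 * p.1⁻¹ = 1) ▸ (hR1 _ _ hp).2) hS1
        · have e := t2 x (by push Not at h; exact h)
          exact e.symm.trans hx
    have u := measureReal_mono (μ := μ) hsub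
    rw [measureReal_union' d2 (hDm.union (hmD _)), measureReal_union d1 (hmD _), hpD] at u
    linarith
  · have hsub : {x | τ x ≠ τ' x} ⊆ ⋃ p ∈ R, {x | p.1⁻¹ • x ∈ D} := by
      intro x hx
      by_contra h
      apply hx
      refine (t2 x fun p hp h' => h (Set.mem_biUnion hp h')).symm
    refine (measureReal_mono hsub (measure_ne_top _ _)).trans ((measureReal_biUnion_finset_le _ _).trans ?_)
    simp only [hpD, Finset.sum_const, nsmul_eq_mul]
    gcongr
    exact_mod_cast hc

/-- improvement of a matching with holes -/
lemma improve (B : Bse S μ c κ) (hS1 : (1:Γ) ∉ S)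
    (hmk : ∀ F : Finset Γ, (1:Γ) ∉ F → ∃ E : ℕ → Set X, (∀ n, MeasurableSet (E n)) ∧ (∀ x, ∃ n, x ∈ E n) ∧
      ∀ n, ∀ f ∈ F, ∀ x ∈ E n, f • x ∉ E n) :
    ∃ C : ℝ, 0 < C ∧ ∀ τ : X → Γ, Mt S μ τ → 0 < μ.real {x | τ x = 1} → ∃ τ', Mt S μ τ' ∧
      μ.real {x | τ' x = 1} < μ.real {x | τ x = 1} ∧
      μ.real {x | τ x ≠ τ' x} ≤ C * √(μ.real {x | τ x = 1}) - C * √(μ.real {x | τ' x = 1}) := by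
  obtain ⟨C0, hC0, hsh⟩ := B.short
  refine ⟨2 * (C0 + 1), by positivity, fun τ M hu => ?_⟩
  set u := μ.real {x | τ x = 1} with hud
  have hu1 : u ≤ 1 := measureReal_le_one
  have hsq : 0 < √u := Real.sqrt_pos.2 hu
  set n := ⌈C0 / √u⌉₊ with hn
  have hn1 : C0 / √u ≤ n := Nat.le_ceil _
  have hn2 : (n:ℝ) * √u ≤ C0 + 1 := by
    have h1 : (n:ℝ) < C0 / √u + 1 := Nat.ceil_lt_add_one (by positivity)
    have h2 : √u ≤ 1 := Real.sqrt_le_one.2 hu1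
    calc (n:ℝ) * √u ≤ (C0 / √u + 1) * √u := by gcongr
      _ = C0 + √u := by field_simp
      _ ≤ _ := by linarith
  have hpos := rch_pos B M (n := n) fun X0 M' => hsh X0 _ τ _ n M' (Mtc.sysFix B M') (M.tm 1) hu hn1
  have hex : ∃ R q, GoodR S n R ∧ q ≠ 1 ∧ (∃ p ∈ R, p.1 = q) ∧ (∃ p ∈ R, p.1 = 1) ∧ μ (PatS τ R q) ≠ 0 := by
    by_contra hno
    push Not at hno
    apply hpos
    refine measure_mono_null (t := ⋃ i : {i : Finset (Γ × Γ) × Γ // GoodR S n i.1 ∧ i.2 ≠ 1 ∧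
      (∃ p ∈ i.1, p.1 = i.2) ∧ (∃ p ∈ i.1, p.1 = 1)}, PatS τ i.1.1 i.1.2) ?_ ?_
    · rintro y ⟨hy, hr⟩
      obtain ⟨R, q, h1, h2, h3, h4, h5⟩ := exists_pat B M hy hr
      exact Set.mem_iUnion.2 ⟨⟨(R, q), h1, h2, h3, h4⟩, h5⟩
    · rw [measure_iUnion_null_iff]
      rintro ⟨⟨R, q⟩, h1, h2, h3, h4⟩
      by_contra h
      exact h (hno R q h1 h2 h3 h4)
  obtain ⟨R, q, h1, h2, h3, h4, h5⟩ := hex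
  obtain ⟨E, hE1, hE2, hE3⟩ := hmk (((R.image fun p => p.1)⁻¹ * (R.image fun p => p.1)).erase 1) (by simp)
  have hk : ∃ k, μ (PatS τ R q ∩ E k) ≠ 0 := by
    by_contra hno
    push Not at hno
    apply h5
    refine measure_mono_null (t := ⋃ k, PatS τ R q ∩ E k) ?_ (measure_iUnion_null_iff.2 hno)
    intro x hx
    obtain ⟨k, hk⟩ := hE2 x
    exact Set.mem_iUnion.2 ⟨k, hx, hk⟩
  obtain ⟨k, hk⟩ := hk
  set D := PatS τ R q ∩ E k with hDd
  have hb : 0 < μ.real D := by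
    rw [measureReal_def]; exact ENNReal.toReal_pos hk (measure_ne_top _ _)
  obtain ⟨τ', m1, m2, m3⟩ := flip B hS1 M h1 h2 h3 h4 ((pat_m B M R q).inter (hE1 k))
    (Set.inter_subset_left (t := E k)) (by
      intro p hp p' hp' x hx x' hx' e
      by_contra hne
      have hx2 : (p'.1⁻¹ * p.1) • x = x' := by rw [mul_smul, e, inv_smul_smul]
      refine hE3 k (p'.1⁻¹ * p.1) ?_ x hx.2 (by rw [hx2]; exact hx'.2)
      refine Finset.mem_erase.2 ⟨fun h => hne (inv_mul_eq_one.1 h).symm, Finset.mul_mem_mul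
        (Finset.inv_mem_inv (Finset.mem_image_of_mem _ hp')) (Finset.mem_image_of_mem _ hp)⟩)
  rw [← hDd] at m2 m3
  refine ⟨τ', m1, by linarith, m3.trans ?_⟩
  set u' := μ.real {x | τ' x = 1} with hu'
  have hu'0 : 0 ≤ u' := measureReal_nonneg
  have s1 := Real.sq_sqrt hu.le
  have s2 := Real.sq_sqrt hu'0
  have s3 : √u' ≤ √u := Real.sqrt_le_sqrt (by linarith)
  have s4 : μ.real D ≤ √u * (√u - √u') := by nlinarith
  have s5 : (n:ℝ) * μ.real D ≤ (C0 + 1) * (√u - √u') :=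
    calc (n:ℝ) * μ.real D ≤ n * (√u * (√u - √u')) := by gcongr
      _ = n * √u * (√u - √u') := by ring
      _ ≤ _ := mul_le_mul_of_nonneg_right hn2 (by linarith)
  linarith
end Flip2
end PaperPM

open scoped Classical Pointwise
open MeasureTheory
namespace PaperPM
section Eke
set_option linter.unusedSectionVars false
set_option linter.deprecated false
open Filter Topology
variable {Γ : Type*} [Group Γ] [Countable Γ] {X : Type*} [MeasurableSpace X] [MulAction Γ X]
variable {S : Finset Γ} {μ : Measure X} [IsProbabilityMeasure μ] {c κ : ℝ}

/-- limits of summable sequences of matchings -/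
lemma mt_lim (B : Bse S μ c κ) (s : ℕ → X → Γ) (hs : ∀ n, Mt S μ (s n))
    (hsum : ∑' n, μ {x | s n x ≠ s (n+1) x} ≠ ⊤) :
    ∃ τ, Mt S μ τ ∧ Tendsto (fun n => μ.real {x | s n x ≠ τ x}) atTop (𝓝 0) := by
  set D : ℕ → Set X := fun n => {x | s n x ≠ s (n+1) x} with hD
  set N := limsup D atTop with hN
  have hNm : MeasurableSet N := by
    refine MeasurableSet.measurableSet_limsup fun n => ?_
    have : D n = (⋃ g : Γ, {x | s n x = g} ∩ {x | s (n+1) x = g})ᶜ := by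
      ext x
      simp only [hD, Set.mem_setOf_eq, Set.mem_compl_iff, Set.mem_iUnion, Set.mem_inter_iff, not_exists, not_and]
      constructor
      · rintro h g rfl h2; exact h h2.symm
      · intro h h2; exact h _ rfl h2.symm
    rw [this]
    exact (MeasurableSet.iUnion fun g => ((hs n).tm g).inter ((hs (n+1)).tm g)).compl
  have hN0 : μ N = 0 := measure_limsup_atTop_eq_zero hsum
  set N' : Set X := ⋃ g : Γ, {x | g • x ∈ N} with hN'
  have hN'm : MeasurableSet N' := MeasurableSet.iUnion fun g => Mtc.gm B (hs 0) hNm g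
  have hN'0 : μ N' = 0 := by
    rw [hN', measure_iUnion_null_iff]
    intro g
    exact ((B.mp g).measure_preimage hNm.nullMeasurableSet).trans hN0
  have hN'i : ∀ (g : Γ) x, g • x ∈ N' → x ∈ N' := by
    intro g x h
    obtain ⟨k, hk⟩ := Set.mem_iUnion.1 h
    refine Set.mem_iUnion.2 ⟨k * g, ?_⟩
    simpa only [Set.mem_setOf_eq, mul_smul] using hk
  have hconst : ∀ x (k : ℕ), (∀ n, k ≤ n → x ∉ D n) → ∀ n, k ≤ n → s n x = s k x := by
    intro x k h n hn
    induction n, hn using Nat.le_induction with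
    | base => rfl
    | succ n hn ih => rw [← ih]; exact (not_not.1 (h n hn)).symm
  have hev : ∀ x, x ∉ N' → ∃ v, ∀ᶠ n in atTop, s n x = v := by
    intro x hx
    have h1 : x ∉ N := fun h => hx (Set.mem_iUnion.2 ⟨1, by simpa using h⟩)
    rw [hN, Filter.mem_limsup_iff_frequently_mem, not_frequently, eventually_atTop] at h1
    obtain ⟨k, hk⟩ := h1
    exact ⟨s k x, eventually_atTop.2 ⟨k, hconst x k hk⟩⟩
  set τ : X → Γ := fun x => if h : x ∈ N' then 1 else (hev x h).choose with hτ
  have t1 : ∀ x ∈ N', τ x = 1 := fun x h => by simp only [hτ, dif_pos h]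
  have t2 : ∀ x, x ∉ N' → ∀ᶠ n in atTop, s n x = τ x := fun x h => by
    simp only [hτ, dif_neg h]; exact (hev x h).choose_spec
  refine ⟨τ, ⟨fun x => rfl, ?_, ?_, ?_, MeasurableSet.univ, by simp, by simp⟩, ?_⟩
  · intro x
    show τ (τ x • x) • τ x • x = x
    by_cases h : x ∈ N'
    · rw [t1 x h, one_smul, t1 x h, one_smul]
    · obtain ⟨n, e1, e2⟩ := ((t2 x h).and (t2 (τ x • x) fun h' => h (hN'i _ _ h'))).exists
      rw [← e2, ← e1]
      exact (hs n).inv x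
  · intro x
    by_cases h : x ∈ N'
    · exact Or.inl (t1 x h)
    · obtain ⟨n, e1⟩ := (t2 x h).exists
      rw [← e1]; exact (hs n).ts x
  · intro γ
    have : {x | τ x = γ} = (N' ∩ {_x | 1 = γ}) ∪ (N'ᶜ ∩ ⋃ k : ℕ, ⋂ n : ℕ, ⋂ _ : k ≤ n, {x | s n x = γ}) := by
      ext x
      by_cases h : x ∈ N'
      · simp [h, t1 x h]
      · have := t2 x h
        simp only [Set.mem_setOf_eq, Set.mem_union, Set.mem_inter_iff, h, false_and, false_or,
          Set.mem_compl_iff, not_false_eq_true, true_and, Set.mem_iUnion, Set.mem_iInter]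
        constructor
        · rintro rfl; exact eventually_atTop.1 this
        · intro h2
          obtain ⟨n, e1, e2⟩ := (this.and (eventually_atTop.2 h2)).exists
          rw [← e1, e2]
    rw [this]
    exact (hN'm.inter (MeasurableSet.const _)).union (hN'm.compl.inter
      (MeasurableSet.iUnion fun k => MeasurableSet.iInter fun n => MeasurableSet.iInter fun _ => (hs n).tm γ))
  · have hle : ∀ m, μ {x | s m x ≠ τ x} ≤ ∑' k, μ (D (k + m)) := by
      intro m
      have : {x | s m x ≠ τ x} ⊆ N' ∪ ⋃ k, D (k + m) := by
        intro x hx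
        by_contra hn
        simp only [Set.mem_union, not_or, Set.mem_iUnion, not_exists] at hn
        apply hx
        obtain ⟨n, e1, e2⟩ := ((t2 x hn.1).and (eventually_ge_atTop m)).exists
        rw [← e1]
        exact (hconst x m (fun n hn' => by have := hn.2 (n - m); rwa [Nat.sub_add_cancel hn'] at this) n e2).symm
      refine (measure_mono this).trans ((measure_union_le _ _).trans ?_)
      rw [hN'0, zero_add]
      exact measure_iUnion_le _
    have := tendsto_of_tendsto_of_tendsto_of_le_of_le tendsto_const_nhds
      (ENNReal.tendsto_sum_nat_add (fun n => μ (D n)) hsum) (fun m => zero_le) hle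
    simpa [measureReal_def, Function.comp_def] using (ENNReal.tendsto_toReal ENNReal.zero_ne_top).comp this

lemma exists_pm (B : Bse S μ c κ) (hS1 : (1:Γ) ∉ S)
    (hmk : ∀ F : Finset Γ, (1:Γ) ∉ F → ∃ E : ℕ → Set X, (∀ n, MeasurableSet (E n)) ∧ (∀ x, ∃ n, x ∈ E n) ∧
      ∀ n, ∀ f ∈ F, ∀ x ∈ E n, f • x ∉ E n) :
    ∃ τ : X → Γ, Mt S μ τ ∧ μ {x | τ x = 1} = 0 := by
  obtain ⟨C, hC, himp⟩ := improve B hS1 hmk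
  set f : (X → Γ) → ℝ := fun τ => C * √(μ.real {x | τ x = 1}) with hf
  have hf0 : ∀ τ, 0 ≤ f τ := fun τ => by positivity
  set d : (X → Γ) → (X → Γ) → ℝ := fun τ τ' => μ.real {x | τ x ≠ τ' x} with hd
  have hd0 : ∀ a b, 0 ≤ d a b := fun a b => measureReal_nonneg
  have tri : ∀ a b e, d a e ≤ d a b + d b e := by
    intro a b e
    refine (measureReal_mono (s₂ := {x | a x ≠ b x} ∪ {x | b x ≠ e x}) ?_ (measure_ne_top _ _)).trans
      (measureReal_union_le _ _)
    intro x hx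
    by_contra h
    simp only [Set.mem_union, Set.mem_setOf_eq, not_or, not_not] at h
    exact hx (h.1.trans h.2)
  have hnx : ∀ (n : ℕ) (t : {τ // Mt S μ τ}), ∃ t' : {τ // Mt S μ τ}, d t t' ≤ f t - f t' ∧
      ∀ z : {τ // Mt S μ τ}, d t z ≤ f t - f z → f t' ≤ f z + (1/2)^n := by
    intro n t
    set I := (fun z : {τ // Mt S μ τ} => f z) '' {z | d t z ≤ f t - f z} with hI
    have hb : BddBelow I := ⟨0, by rintro _ ⟨z, _, rfl⟩; exact hf0 _⟩
    have hne : I.Nonempty := ⟨f t, t, by simp [hd], rfl⟩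
    obtain ⟨_, ⟨t', h1, rfl⟩, h2⟩ := exists_lt_of_csInf_lt hne
      (show sInf I < sInf I + (1/2)^n by have : (0:ℝ) < (1/2)^n := by positivity
                                         linarith)
    refine ⟨t', h1, fun z hz => ?_⟩
    have := csInf_le hb ⟨z, hz, rfl⟩
    simp only at this h2 ⊢
    linarith
  choose nx nx1 nx2 using hnx
  have M0 : Mt S μ (fun _ : X => (1:Γ)) :=
    ⟨fun x => rfl, fun x => by simp, fun x => Or.inl rfl, fun g => MeasurableSet.const _,
      MeasurableSet.univ, by simp, by simp⟩
  set s : ℕ → {τ // Mt S μ τ} := fun n => Nat.rec ⟨_, M0⟩ (fun n t => nx n t) n with hs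
  have hss : ∀ n, s (n+1) = nx n (s n) := fun n => rfl
  have hst : ∀ n, d (s n) (s (n+1)) ≤ f (s n) - f (s (n+1)) := fun n => nx1 n (s n)
  have hle : ∀ n m, n ≤ m → d (s n) (s m) ≤ f (s n) - f (s m) := by
    intro n m h
    induction m, h using Nat.le_induction with
    | base => simp [hd]
    | succ m hm ih => linarith [tri (s n) (s m) (s (m+1)), hst m]
  have hsum : Summable fun n => d (s n) (s (n+1)) := by
    refine summable_of_sum_range_le (c := f (s 0)) (fun n => hd0 _ _) fun n => ?_
    refine (Finset.sum_le_sum fun i _ => hst i).trans ?_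
    rw [Finset.sum_range_sub' (fun i => f (s i))]
    linarith [hf0 (s n)]
  obtain ⟨τ, M, hlim⟩ := mt_lim B (fun n => (s n).1) (fun n => (s n).2) (by
    have := hsum.tsum_ofReal_ne_top
    have e : ∀ n, ENNReal.ofReal (d (s n) (s (n+1))) = μ {x | (s n).1 x ≠ (s (n+1)).1 x} :=
      fun n => ofReal_measureReal
    rwa [tsum_congr e] at this)
  have hu : ∀ a b : X → Γ, μ.real {x | a x = 1} ≤ μ.real {x | b x = 1} + d a b := by
    intro a b
    refine (measureReal_mono (s₂ := {x | b x = 1} ∪ {x | a x ≠ b x}) ?_ (measure_ne_top _ _)).trans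
      (measureReal_union_le _ _)
    intro x hx
    by_contra h
    simp only [Set.mem_union, Set.mem_setOf_eq, not_or, not_not] at h
    exact h.1 (h.2.symm.trans hx)
  have hsy : ∀ a b, d a b = d b a := fun a b => by simp only [hd, ne_comm]
  have hul : Tendsto (fun n => μ.real {x | (s n).1 x = 1}) atTop (𝓝 (μ.real {x | τ x = 1})) := by
    rw [tendsto_iff_dist_tendsto_zero]
    refine squeeze_zero (fun _ => dist_nonneg) (fun n => ?_) hlim
    rw [Real.dist_eq, abs_le]
    have h1 := hu (s n) τ
    have h2 := hu τ (s n)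
    rw [hsy] at h2
    simp only [hd] at h1 h2
    constructor <;> linarith
  have hfl : Tendsto (fun n => f (s n)) atTop (𝓝 (f τ)) := (hul.sqrt).const_mul C
  have hdl : ∀ n, d (s n) τ ≤ f (s n) - f τ := by
    intro n
    have h1 : Tendsto (fun m => f (s n) - f (s m) + d (s m) τ) atTop (𝓝 (f (s n) - f τ + 0)) :=
      (tendsto_const_nhds.sub hfl).add hlim
    rw [add_zero] at h1
    refine ge_of_tendsto h1 (eventually_atTop.2 ⟨n, fun m hm => ?_⟩)
    linarith [tri (s n) (s m) τ, hle n m hm]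
  refine ⟨τ, M, ?_⟩
  by_contra hne
  obtain ⟨z, Mz, z1, z2⟩ := himp τ M (ENNReal.toReal_pos hne (measure_ne_top _ _))
  have z3 : f z < f τ := by
    simp only [hf]
    exact mul_lt_mul_of_pos_left (Real.sqrt_lt_sqrt measureReal_nonneg z1) hC
  have z4 : ∀ n, f (s (n+1)) ≤ f z + (1/2)^n := fun n => nx2 n (s n) ⟨z, Mz⟩ (by
    have h1 := tri (s n) τ z
    have h2 := hdl n
    have : d τ z ≤ f τ - f z := z2
    show d (s n) z ≤ f (s n) - f z
    linarith)
  have z5 := le_of_tendsto_of_tendsto' (hfl.comp (tendsto_add_atTop_nat 1))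
    (tendsto_const_nhds.add (tendsto_pow_atTop_nhds_zero_of_lt_one (by norm_num) (by norm_num : (1/2:ℝ) < 1))) z4
  linarith
end Eke
end PaperPM

open scoped Classical Pointwise
open MeasureTheory
namespace PaperPM
section Bern
set_option linter.unusedSectionVars false
set_option linter.deprecated false
variable {Γ : Type*} [Group Γ]

def sh (g : Γ) (x : Γ → unitInterval) : Γ → unitInterval := fun γ => x (g⁻¹ * γ)

noncomputable def bern (Γ : Type*) : Measure (Γ → unitInterval) := Measure.infinitePi fun _ => volume

instance : IsProbabilityMeasure (bern Γ) := by unfold bern; infer_instance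

lemma sh_meas (g : Γ) : Measurable (sh g) := by unfold sh; fun_prop

lemma sh_mp (g : Γ) : MeasurePreserving (sh g) (bern Γ) (bern Γ) := by
  refine ⟨sh_meas g, Measure.eq_infinitePi _ fun s t ht => ?_⟩
  rw [Measure.map_apply (sh_meas g) (MeasurableSet.pi s.countable_toSet fun i _ => ht i)]
  have : sh g ⁻¹' (Set.pi s t) = Set.pi (s.image fun i => g⁻¹ * i : Finset Γ) (fun j => t (g * j)) := by
    ext x
    simp only [sh, Set.mem_preimage, Set.mem_pi, Finset.coe_image, Set.forall_mem_image, mul_inv_cancel_left]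
  rw [this, bern, Measure.infinitePi_pi _ fun i _ => ht _, Finset.prod_image (by simp)]
  simp

lemma bern_mix (D : Set (Γ → unitInterval)) (hD : MeasurableSet D) (ε : ℝ) (hε : 0 < ε) :
    ∃ C, MeasurableSet C ∧ (bern Γ).real (D \ C) ≤ ε ∧ (bern Γ).real (C \ D) ≤ ε ∧
      {g : Γ | (bern Γ).real (C ∩ sh g ⁻¹' C) ≠ (bern Γ).real C ^ 2}.Finite := by
  obtain ⟨C, hC, h⟩ := (Measure.MeasureDense.of_generateFrom_isSetAlgebra_finite (bern Γ)
    isSetAlgebra_measurableCylinders generateFrom_measurableCylinders.symm).approx D hD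
    (measure_ne_top _ _) ε hε
  have h' : (bern Γ).real (symmDiff D C) ≤ ε := by
    rw [measureReal_def]
    exact ENNReal.toReal_le_of_le_ofReal hε.le h.le
  have hCm := MeasurableSet.of_mem_measurableCylinders hC
  refine ⟨C, hCm, (measureReal_mono (fun x hx => Or.inl hx) (measure_ne_top _ _)).trans h',
    (measureReal_mono (fun x hx => Or.inr hx) (measure_ne_top _ _)).trans h', ?_⟩
  obtain ⟨J, A, hA, rfl⟩ := (mem_measurableCylinders C).1 hC
  refine (J * J⁻¹ : Finset Γ).finite_toSet.subset fun g hg => ?_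
  by_contra hn
  apply hg
  have hdis : Disjoint J (J.image fun i => g⁻¹ * i) := by
    rw [Finset.disjoint_left]
    intro a ha hb
    obtain ⟨b, hb', rfl⟩ := Finset.mem_image.1 hb
    apply hn
    have : g = b * (g⁻¹ * b)⁻¹ := by group
    rw [this]
    exact Finset.mul_mem_mul hb' (Finset.inv_mem_inv ha)
  have hind : ProbabilityTheory.iIndepFun (fun (i : Γ) (x : Γ → unitInterval) => x i) (bern Γ) :=
    ProbabilityTheory.iIndepFun_infinitePi (X := fun _ y => y) fun i => measurable_id
  have key := hind.indepFun_finset J (J.image fun i => g⁻¹ * i) hdis fun i => measurable_pi_apply i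
  set T : ((J.image fun i => g⁻¹ * i : Finset Γ) → unitInterval) → (J → unitInterval) :=
    fun y i => y ⟨g⁻¹ * i, Finset.mem_image_of_mem _ i.2⟩ with hT
  have hTm : Measurable T := by rw [hT]; fun_prop
  have k2 := key.measure_inter_preimage_eq_mul A (T ⁻¹' A) hA (hTm hA)
  have e1 : (fun (a : Γ → unitInterval) (i : (J.image fun i => g⁻¹ * i : Finset Γ)) => a i) ⁻¹' (T ⁻¹' A) =
      sh g ⁻¹' (cylinder J A) := rfl
  have e2 : (fun (a : Γ → unitInterval) (i : J) => a i) ⁻¹' A = cylinder J A := rfl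
  rw [e1, e2, (sh_mp g).measure_preimage hCm.nullMeasurableSet] at k2
  rw [measureReal_def, k2, ENNReal.toReal_mul, sq, measureReal_def]

lemma bern_ne {a b : Γ} (h : a ≠ b) : bern Γ {x | x a = x b} = 0 := by
  have hind : ProbabilityTheory.iIndepFun (fun (i : Γ) (x : Γ → unitInterval) => x i) (bern Γ) :=
    ProbabilityTheory.iIndepFun_infinitePi (X := fun _ y => y) fun i => measurable_id
  have h1 := (ProbabilityTheory.indepFun_iff_map_prod_eq_prod_map_map (measurable_pi_apply a).aemeasurable
    (measurable_pi_apply b).aemeasurable).1 (hind.indepFun h)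
  have hd : MeasurableSet {p : unitInterval × unitInterval | p.1 = p.2} :=
    measurableSet_eq_fun measurable_fst measurable_snd
  have h2 := Measure.map_apply (μ := bern Γ) (f := fun x => (x a, x b)) (by fun_prop) hd
  rw [h1, bern, Measure.infinitePi_map_eval, Measure.infinitePi_map_eval] at h2
  have h3 : bern Γ {x | x a = x b} = _ := h2.symm
  rw [h3, Measure.measure_prod_null hd]
  refine Filter.Eventually.of_forall fun x => ?_
  have : Prod.mk x ⁻¹' {p : unitInterval × unitInterval | p.1 = p.2} = {x} := by ext y; simp [eq_comm]
  simp [this]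

abbrev IX (Γ : Type*) : Type _ := {x : Γ → unitInterval // Function.Injective x}

lemma sh_inj (g : Γ) {x : Γ → unitInterval} (h : Function.Injective x) : Function.Injective (sh g x) :=
  fun _ _ e => mul_left_cancel (h e)

instance : MulAction Γ (IX Γ) where
  smul g x := ⟨sh g x.1, sh_inj g x.2⟩
  one_smul x := Subtype.ext (funext fun γ => by show x.1 (1⁻¹ * γ) = x.1 γ; simp)
  mul_smul g h x := Subtype.ext (funext fun γ => by
    show x.1 ((g * h)⁻¹ * γ) = x.1 (h⁻¹ * (g⁻¹ * γ)); simp [mul_assoc])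

lemma IX.smul_val (g : Γ) (x : IX Γ) : (g • x).1 = sh g x.1 := rfl

noncomputable def bX (Γ : Type*) : Measure (IX Γ) := (bern Γ).comap Subtype.val

variable [Countable Γ]

lemma inj_meas : MeasurableSet {x : Γ → unitInterval | Function.Injective x} := by
  have : {x : Γ → unitInterval | Function.Injective x} = ⋂ a, ⋂ b, {x | x a = x b}ᶜ ∪ {_x | a = b} := by
    ext x
    simp only [Function.Injective, Set.mem_setOf_eq, Set.mem_iInter, Set.mem_union, Set.mem_compl_iff, imp_iff_not_or]
  rw [this]
  exact MeasurableSet.iInter fun a => MeasurableSet.iInter fun b =>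
    (measurableSet_eq_fun (measurable_pi_apply a) (measurable_pi_apply b)).compl.union (MeasurableSet.const _)

lemma inj_ae : ∀ᵐ x ∂(bern Γ), x ∈ {x : Γ → unitInterval | Function.Injective x} := by
  have : ∀ a b : Γ, ∀ᵐ x ∂(bern Γ), x a = x b → a = b := by
    intro a b
    by_cases h : a = b
    · exact Filter.Eventually.of_forall fun _ _ => h
    · have h0 := bern_ne h
      rw [ae_iff]
      simpa [h] using h0
  have h2 : ∀ᵐ x ∂(bern Γ), ∀ a b : Γ, x a = x b → a = b := by
    rw [ae_all_iff]; intro a; rw [ae_all_iff]; exact this a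
  filter_upwards [h2] with x hx
  exact fun a b => hx a b

lemma val_mp : MeasurePreserving (Subtype.val : IX Γ → Γ → unitInterval) (bX Γ) (bern Γ) := by
  have := measurePreserving_subtype_coe (μa := bern Γ) (inj_meas (Γ := Γ))
  rwa [Measure.restrict_eq_self_of_ae_mem inj_ae] at this

instance : IsProbabilityMeasure (bX Γ) :=
  ⟨by have := (val_mp (Γ := Γ)).measure_preimage MeasurableSet.univ.nullMeasurableSet; simpa using this⟩

lemma im_real {D : Set (IX Γ)} : (bX Γ) D = bern Γ (Subtype.val '' D) :=
  (MeasurableEmbedding.subtype_coe inj_meas).comap_apply _ _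

lemma IX.mp (g : Γ) : MeasurePreserving (fun x : IX Γ => g • x) (bX Γ) (bX Γ) := by
  have hm : Measurable (fun x : IX Γ => g • x) := ((sh_meas g).comp measurable_subtype_coe).subtype_mk
  refine ⟨hm, Measure.ext fun D hD => ?_⟩
  have hD' : MeasurableSet (Subtype.val '' D : Set (Γ → unitInterval)) :=
    (MeasurableEmbedding.subtype_coe inj_meas).measurableSet_image.2 hD
  rw [Measure.map_apply hm hD, im_real (D := D), ← (sh_mp g).measure_preimage hD'.nullMeasurableSet,
    ← val_mp.measure_preimage ((sh_meas g) hD').nullMeasurableSet]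
  congr 1
  ext x
  constructor
  · intro h; exact ⟨g • x, h, rfl⟩
  · rintro ⟨y, hy, e⟩
    have : y = g • x := Subtype.ext e
    show g • x ∈ D
    rw [← this]; exact hy

lemma IX.mix (D : Set (IX Γ)) (hD : MeasurableSet D) (ε : ℝ) (hε : 0 < ε) :
    ∃ C : Set (IX Γ), MeasurableSet C ∧ (bX Γ).real (D \ C) ≤ ε ∧ (bX Γ).real (C \ D) ≤ ε ∧
      {g : Γ | (bX Γ).real (C ∩ (fun x => g • x) ⁻¹' C) ≠ (bX Γ).real C ^ 2}.Finite := by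
  have hD' : MeasurableSet (Subtype.val '' D : Set (Γ → unitInterval)) :=
    (MeasurableEmbedding.subtype_coe inj_meas).measurableSet_image.2 hD
  obtain ⟨C, h1, h2, h3, h4⟩ := bern_mix _ hD' ε hε
  have e : ∀ A : Set (Γ → unitInterval), MeasurableSet A →
      (bX Γ).real (Subtype.val ⁻¹' A) = (bern Γ).real A := fun A hA =>
    val_mp.measureReal_preimage hA.nullMeasurableSet
  have eD : (Subtype.val ⁻¹' (Subtype.val '' D) : Set (IX Γ)) = D :=
    Set.preimage_image_eq _ Subtype.val_injective
  refine ⟨Subtype.val ⁻¹' C, measurable_subtype_coe h1, ?_, ?_, ?_⟩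
  · rw [← e _ (hD'.diff h1), Set.preimage_diff, eD] at h2; exact h2
  · rw [← e _ (h1.diff hD'), Set.preimage_diff, eD] at h3; exact h3
  · convert h4 using 3
    rw [← e _ h1, ← e _ (h1.inter (sh_meas _ h1))]; rfl

lemma IX.free (g : Γ) (x : IX Γ) (h : g • x = x) : g = 1 := by
  have h1 := congrFun (congrArg Subtype.val h) 1
  have h2 := x.2 h1
  simpa using h2

lemma IX.mk (F : Finset Γ) (hF : (1:Γ) ∉ F) : ∃ E : ℕ → Set (IX Γ), (∀ n, MeasurableSet (E n)) ∧
    (∀ x, ∃ n, x ∈ E n) ∧ ∀ n, ∀ f ∈ F, ∀ x ∈ E n, f • x ∉ E n := by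
  obtain ⟨b, hb1, -, hb⟩ := TopologicalSpace.exists_countable_basis unitInterval
  have hbn : b.Nonempty := by
    obtain ⟨t, ht, _⟩ := hb.exists_subset_of_mem_open (Set.mem_univ (0:unitInterval)) isOpen_univ
    exact ⟨t, ht⟩
  obtain ⟨U, hU⟩ := hb1.exists_eq_range hbn
  have hUm : ∀ n, MeasurableSet (U n) := fun n =>
    (hb.isOpen (by rw [hU]; exact ⟨n, rfl⟩)).measurableSet
  have hev : ∀ (n : ℕ) (g : Γ), MeasurableSet {x : IX Γ | x.1 g ∈ U n} := fun n g =>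
    ((measurable_pi_apply g).comp measurable_subtype_coe) (hUm n)
  refine ⟨fun n => {x | x.1 1 ∈ U n} ∩ ⋂ f ∈ F, {x | x.1 f⁻¹ ∈ U n}ᶜ, fun n => ?_, fun x => ?_, ?_⟩
  · exact (hev n 1).inter (Finset.measurableSet_biInter _ fun f _ => (hev n _).compl)
  · set K : Finset unitInterval := F.image fun f => x.1 f⁻¹
    have hx : x.1 1 ∈ (K : Set unitInterval)ᶜ := by
      intro h
      obtain ⟨f, hf, e⟩ := Finset.mem_image.1 (Finset.mem_coe.1 h)
      have := x.2 e
      rw [inv_eq_one] at this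
      exact hF (this ▸ hf)
    obtain ⟨t, ht, h1, h2⟩ := hb.exists_subset_of_mem_open hx K.finite_toSet.isClosed.isOpen_compl
    rw [hU] at ht
    obtain ⟨n, rfl⟩ := ht
    refine ⟨n, h1, Set.mem_iInter₂.2 fun f hf h => h2 h ?_⟩
    exact Finset.mem_coe.2 (Finset.mem_image_of_mem _ hf)
  · rintro n f hf x ⟨h1, h2⟩ ⟨h3, h4⟩
    apply Set.mem_iInter₂.1 h2 f hf
    have : x.1 (f⁻¹ * 1) ∈ U n := h3
    simpa using this

end Bern
end PaperPM

namespace PaperPM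
section Fin
set_option linter.unusedSectionVars false
set_option linter.deprecated false
variable {Γ : Type*} [Group Γ]

lemma ctbl {S : Set Γ} (hfin : S.Finite) (hsym : ∀ s ∈ S, s⁻¹ ∈ S) (hgen : Subgroup.closure S = ⊤) :
    Countable Γ := by
  have : Countable S := hfin.countable
  refine Function.Surjective.countable (f := fun l : List S => (l.map Subtype.val).prod) fun x => ?_
  obtain ⟨l, h1, h2⟩ := Submonoid.exists_list_of_mem_closure (s := S ∪ S⁻¹) (x := x)
    (by rw [← Subgroup.closure_toSubmonoid, hgen]; trivial)
  lift l to List S using fun y hy => (h1 y hy).elim id fun h => by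
    simpa using hsym _ (Set.mem_inv.1 h)
  exact ⟨l, h2⟩

lemma sh_sh (g h : Γ) (x : Γ → unitInterval) : sh g (sh h x) = sh (g * h) x := by
  funext γ; simp [sh, mul_assoc]

lemma cay_adj {S : Set Γ} (hsym : ∀ s ∈ S, s⁻¹ ∈ S) (hone : (1 : Γ) ∉ S) (a b : Γ) :
    (cayley S).Adj a b ↔ a⁻¹ * b ∈ S := by
  rw [cayley, SimpleGraph.fromRel_adj]
  constructor
  · rintro ⟨_, h | h⟩
    · exact h
    · simpa using hsym _ h
  · intro h
    exact ⟨fun e => hone (by simpa [e] using h), Or.inl h⟩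

lemma fin_step {S : Set Γ} [Countable Γ] (hsym : ∀ s ∈ S, s⁻¹ ∈ S) (hone : (1 : Γ) ∉ S)
    (T : (Γ → unitInterval) → Γ) (hT : ∀ γ, MeasurableSet {x | T x = γ})
    (hae : ∀ᵐ x ∂(bern Γ), T x ∈ S ∧ T (sh (T x)⁻¹ x) = (T x)⁻¹) :
    ∃ μ : Measure (Γ → unitInterval), IsProbabilityMeasure μ ∧
      (∀ (J : Finset Γ) (t : Γ → Set unitInterval), (∀ i ∈ J, MeasurableSet (t i)) →
        μ {x | ∀ i ∈ J, x i ∈ t i} = ∏ i ∈ J, volume (t i)) ∧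
      ∃ φ : (Γ → unitInterval) → ((cayley S).edgeSet → Bool),
        Measurable φ ∧
        (∀ (g : Γ) (x : Γ → unitInterval),
          φ (fun γ => x (g⁻¹ * γ)) = fun e => φ x (edgeShift S g⁻¹ e)) ∧
        ∀ᵐ x ∂μ, IsPerfectMatching (cayley S)
          {e : Sym2 Γ | ∃ h : e ∈ (cayley S).edgeSet, φ x ⟨e, h⟩ = true} := by
  refine ⟨bern Γ, inferInstance, fun J t ht => Measure.infinitePi_pi _ ht,
    fun x e => decide (∃ a, e.1 = s(a, a * T (sh a⁻¹ x))), ?_, ?_, ?_⟩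
  · refine measurable_pi_iff.2 fun e => measurable_to_bool ?_
    have : ((fun x => decide (∃ a, e.1 = s(a, a * T (sh a⁻¹ x)))) ⁻¹' {true}) =
        ⋃ a : Γ, ⋃ γ : Γ, ({_x | e.1 = s(a, a * γ)} ∩ sh a⁻¹ ⁻¹' {x | T x = γ}) := by
      ext x
      simp
    rw [this]
    exact MeasurableSet.iUnion fun a => MeasurableSet.iUnion fun γ =>
      (MeasurableSet.const _).inter (sh_meas _ (hT γ))
  · intro g x
    funext e
    rw [decide_eq_decide]
    have hx : (fun γ => x (g⁻¹ * γ)) = sh g x := rfl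
    rw [hx]
    have hinj : Function.Injective (Sym2.map (fun v : Γ => g⁻¹ * v)) :=
      Sym2.map.injective (mul_right_injective g⁻¹)
    constructor
    · rintro ⟨a, h⟩
      refine ⟨g⁻¹ * a, ?_⟩
      simp only [edgeShift, h, Sym2.map_mk, sh_sh, mul_inv_rev, inv_inv, mul_assoc]
    · rintro ⟨b, h⟩
      refine ⟨g * b, hinj ?_⟩
      simp only [edgeShift] at h
      rw [h]
      simp [sh_sh, mul_assoc]
  · have h2 : ∀ᵐ x ∂(bern Γ), ∀ a : Γ, T (sh a⁻¹ x) ∈ S ∧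
        T (sh (T (sh a⁻¹ x))⁻¹ (sh a⁻¹ x)) = (T (sh a⁻¹ x))⁻¹ :=
      ae_all_iff.2 fun a => (sh_mp a⁻¹).quasiMeasurePreserving.ae hae
    filter_upwards [h2] with x hx
    refine ⟨fun e he => he.1, fun v => ⟨s(v, v * T (sh v⁻¹ x)), ⟨⟨?_, ?_⟩, by simp⟩, ?_⟩⟩
    · rw [SimpleGraph.mem_edgeSet, cay_adj hsym hone]
      simpa using (hx v).1
    · simp only [decide_eq_true_eq]; exact ⟨v, rfl⟩
    · rintro e ⟨⟨he, h⟩, hv⟩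
      simp only [decide_eq_true_eq] at h
      obtain ⟨a, rfl⟩ := h
      rw [Sym2.mem_iff] at hv
      rcases hv with rfl | hv
      · rfl
      · have h3 := (hx a).2
        rw [sh_sh, ← mul_inv_rev, ← hv] at h3
        rw [h3, Sym2.eq_swap, ← hv]
        congr 2
        rw [hv]; group

lemma hna_conv {S : Finset Γ} (hsym : ∀ s ∈ S, s⁻¹ ∈ S) (hone : (1 : Γ) ∉ S) {c0 : ℝ}
    (h : ∀ A : Set Γ, A.Finite → A.Nonempty →
      c0 * A.ncard ≤ ((cutEdges (cayley (S : Set Γ)) A).ncard : ℝ)) (A : Finset Γ) (hA : A.Nonempty) :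
    c0 * A.card ≤ bd S A := by
  have h1 := h (A⁻¹ : Finset Γ) (Finset.finite_toSet _) (by simpa using hA)
  rw [Set.ncard_coe_finset, Finset.card_inv] at h1
  refine h1.trans ?_
  have hb : bd S A = ((A ×ˢ S).filter fun p => p.2 * p.1 ∉ A).card := by
    rw [bd, Finset.card_filter, Finset.sum_product]
    push_cast
    refine Finset.sum_congr rfl fun a _ => Finset.sum_congr rfl fun s _ => ?_
    split_ifs <;> simp_all
  rw [hb]
  have hsub : cutEdges (cayley (S : Set Γ)) (A⁻¹ : Finset Γ) ⊆
      ((((A ×ˢ S).filter fun p => p.2 * p.1 ∉ A).image fun p => s(p.1⁻¹, p.1⁻¹ * p.2⁻¹) : Finset (Sym2 Γ)) : Set _) := by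
    rintro e ⟨he, u, v, rfl, hu, hv⟩
    rw [SimpleGraph.mem_edgeSet, cay_adj (by simpa using hsym) (by simpa using hone)] at he
    simp only [Finset.coe_inv, Set.mem_inv, Finset.mem_coe] at hu hv
    refine Finset.mem_coe.2 (Finset.mem_image.2 ⟨(u⁻¹, v⁻¹ * u), ?_, by simp⟩)
    refine Finset.mem_filter.2 ⟨Finset.mem_product.2 ⟨hu, ?_⟩, by simpa using hv⟩
    have := hsym _ (Finset.mem_coe.1 he)
    simpa using this
  have h2 := Set.ncard_le_ncard hsub (Finset.finite_toSet _)
  rw [Set.ncard_coe_finset] at h2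
  exact_mod_cast h2.trans Finset.card_image_le

lemma main_case {S : Finset Γ} [Countable Γ] (hsym : ∀ s ∈ S, s⁻¹ ∈ S) (hone : (1 : Γ) ∉ S)
    (hinv : ∀ s ∈ S, s⁻¹ ≠ s) {c0 : ℝ} (hc0 : 0 < c0)
    (hna : ∀ A : Finset Γ, A.Nonempty → c0 * A.card ≤ bd S A) :
    ∃ T : (Γ → unitInterval) → Γ, (∀ γ, MeasurableSet {x | T x = γ}) ∧
      ∀ᵐ x ∂(bern Γ), T x ∈ S ∧ T (sh (T x)⁻¹ x) = (T x)⁻¹ := by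
  have h3 := card_ge_three hsym hone hc0 hna
  have hne : S.Nonempty := Finset.card_pos.1 (by omega)
  obtain ⟨c, hc, hiso⟩ := iso hsym hone hinv hc0 hna
  obtain ⟨κ, k0, k1, hexp⟩ := expn (μ := bX Γ) hc0 hne hsym hna IX.mp IX.mix
  have B : Bse S (bX Γ) c κ := ⟨hsym, hne, IX.mp, IX.free, hc, hiso, k0, k1, hexp⟩
  obtain ⟨τ, M, h0⟩ := exists_pm B hone IX.mk
  set T : (Γ → unitInterval) → Γ := fun x => if h : Function.Injective x then (τ ⟨x, h⟩)⁻¹ else 1 with hTd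
  have hT : ∀ x : IX Γ, T x.1 = (τ x)⁻¹ := fun x => by simp only [hTd, dif_pos x.2]
  refine ⟨T, fun γ => ?_, ?_⟩
  · have : {x | T x = γ} = (Subtype.val '' {x : IX Γ | τ x = γ⁻¹}) ∪
        ({x | Function.Injective x}ᶜ ∩ {_x | 1 = γ}) := by
      ext x
      by_cases h : Function.Injective x
      · simp [hTd, h, inv_eq_iff_eq_inv]
      · simp [hTd, h]
    rw [this]
    exact ((MeasurableEmbedding.subtype_coe inj_meas).measurableSet_image.2 (M.tm _)).union
      (inj_meas.compl.inter (MeasurableSet.const _))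
  · have hz : bern Γ (Subtype.val '' {x : IX Γ | τ x = 1}) = 0 := by rw [← im_real]; exact h0
    filter_upwards [inj_ae, measure_eq_zero_iff_ae_notMem.1 hz] with x hx hx2
    set y : IX Γ := ⟨x, hx⟩ with hy
    have hxy : x = y.1 := rfl
    have hτ : τ y ≠ 1 := fun h => hx2 ⟨y, h, rfl⟩
    have hS := (M.ts y).resolve_left hτ
    rw [hxy, hT y, inv_inv]
    refine ⟨hsym _ hS, ?_⟩
    rw [← IX.smul_val, hT]
    have := M.inv y
    simp only [← mul_smul] at this
    exact inv_eq_of_mul_eq_one_right (IX.free _ _ this)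
end Fin

open MeasureTheory in
/-- Every non-amenable Cayley graph admits a factor of IID perfect matching: for `μ`
the product over `Γ` of Lebesgue measure on `[0,1]`, there is a measurable
`Γ`-equivariant map `φ : [0,1]^Γ → {0,1}^{E(G)}` such that for `μ`-a.e. `x` the edge
set `{e : φ x e = 1}` is a perfect matching of the Cayley graph. -/
theorem factor_of_iid_perfect_matching {Γ : Type*} [Group Γ]
    (S : Set Γ) (hfin : S.Finite) (hsym : ∀ s ∈ S, s⁻¹ ∈ S) (hone : (1 : Γ) ∉ S)
    (hgen : Subgroup.closure S = ⊤)
    (c0 : ℝ) (hc0 : 0 < c0)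
    (hnonamenable : ∀ A : Set Γ, A.Finite → A.Nonempty →
      c0 * A.ncard ≤ ((cutEdges (cayley S) A).ncard : ℝ)) :
    ∃ μ : Measure (Γ → unitInterval), IsProbabilityMeasure μ ∧
      (∀ (J : Finset Γ) (t : Γ → Set unitInterval), (∀ i ∈ J, MeasurableSet (t i)) →
        μ {x | ∀ i ∈ J, x i ∈ t i} = ∏ i ∈ J, volume (t i)) ∧
      ∃ φ : (Γ → unitInterval) → ((cayley S).edgeSet → Bool),
        Measurable φ ∧
        (∀ (g : Γ) (x : Γ → unitInterval),
          φ (fun γ => x (g⁻¹ * γ)) = fun e => φ x (edgeShift S g⁻¹ e)) ∧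
        ∀ᵐ x ∂μ, IsPerfectMatching (cayley S)
          {e : Sym2 Γ | ∃ h : e ∈ (cayley S).edgeSet, φ x ⟨e, h⟩ = true} := by
  have := ctbl hfin hsym hgen
  by_cases hinv : ∃ s ∈ S, s⁻¹ = s
  · obtain ⟨s, hs, e⟩ := hinv
    exact fin_step hsym hone (fun _ => s) (fun γ => MeasurableSet.const _)
      (Filter.Eventually.of_forall fun x => ⟨hs, e.symm⟩)
  · push Not at hinv
    obtain ⟨S, rfl⟩ := hfin.exists_finset_coe
    obtain ⟨T, h1, h2⟩ := main_case (S := S) hsym hone hinv hc0 (hna_conv hsym hone hnonamenable)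
    exact fin_step hsym hone T h1 h2

end PaperPM
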